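/- Theorem 4 (global existence and decay for the damped compressible Euler system): There exist constants δ₀ > 0 and C > 0 (independent of time and of the data) such that for every smooth initial datum (ρ₀,u₀) with (ρ₀−ρ̄,u₀) Schwartz and ‖(ρ₀−ρ̄, u₀)‖_{H²} ≤ δ₀, there exists a global-in-time classical solution (ρ,u) of the damped compressible Euler system on ℝ × [0,∞) with data (ρ₀,u₀), which satisfies sup_{t≥0} ‖(ρ−ρ̄,u)(t)‖²_{H²} ≤ C‖(ρ₀−ρ̄,u₀)‖²_{H²} and, for all t > 0, ‖u(t)‖_{L²} + ‖∂ₓ(ρ−ρ̄, u)(t)‖_{L²} ≤ C(1+t)^{−1/2} ‖(ρ₀−ρ̄, u₀)‖_{H²}. -/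

import Mathlib

open MeasureTheory

noncomputable section

/-- Squared `L²` norm of a scalar function. -/
def sqL2 (f : ℝ → ℝ) : ℝ := ∫ x, (f x) ^ 2

/-- Squared `H¹` norm. -/
def sqH1 (f : ℝ → ℝ) : ℝ := sqL2 f + sqL2 (deriv f)

/-- Squared `H²` norm. -/
def sqH2 (f : ℝ → ℝ) : ℝ := sqH1 f + sqL2 (deriv (deriv f))

/-- Squared `H²` norm of a pair. -/
def sqH2pair (f g : ℝ → ℝ) : ℝ := sqH2 f + sqH2 g

/-- A classical solution of the damped compressible Euler system
`∂ₜρ + ∂ₓ(ρu) = 0`, `∂ₜ(ρu) + ∂ₓ(ρu²) + ∂ₓP(ρ) = −λρu` on `ℝ × [0,T)`: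
a smooth positive-density pair, with `(ρ−ρ̄,u)` Schwartz in `x` locally uniformly in
`t`, solving the system (time is the first argument). -/
structure IsEulerSolution (P : ℝ → ℝ) (lam ρbar T : ℝ) (ρ u : ℝ → ℝ → ℝ) : Prop where
  rho_pos : ∀ t x : ℝ, 0 ≤ t → t < T → 0 < ρ t x
  smooth_rho : ContDiff ℝ (⊤ : ℕ∞) (fun p : ℝ × ℝ => ρ p.1 p.2)
  smooth_u : ContDiff ℝ (⊤ : ℕ∞) (fun p : ℝ × ℝ => u p.1 p.2)
  decay : ∀ (k m : ℕ) (T' : ℝ), T' < T → ∃ C : ℝ, ∀ t : ℝ, 0 ≤ t → t ≤ T' → ∀ x : ℝ,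
      |x| ^ k * (|iteratedDeriv m (fun y => ρ t y - ρbar) x| +
        |iteratedDeriv m (fun y => u t y) x|) ≤ C
  mass : ∀ t x : ℝ, 0 ≤ t → t < T →
      deriv (fun s => ρ s x) t + deriv (fun y => ρ t y * u t y) x = 0
  momentum : ∀ t x : ℝ, 0 ≤ t → t < T →
      deriv (fun s => ρ s x * u s x) t + deriv (fun y => ρ t y * (u t y) ^ 2) x +
          deriv (fun y => P (ρ t y)) x = -(lam * (ρ t x * u t x))

/-- A global-in-time classical solution of the damped compressible Euler system. -/
structure IsGlobalEulerSolution (P : ℝ → ℝ) (lam ρbar : ℝ) (ρ u : ℝ → ℝ → ℝ) :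
    Prop where
  rho_pos : ∀ t x : ℝ, 0 ≤ t → 0 < ρ t x
  smooth_rho : ContDiff ℝ (⊤ : ℕ∞) (fun p : ℝ × ℝ => ρ p.1 p.2)
  smooth_u : ContDiff ℝ (⊤ : ℕ∞) (fun p : ℝ × ℝ => u p.1 p.2)
  decay : ∀ (k m : ℕ) (T' : ℝ), ∃ C : ℝ, ∀ t : ℝ, 0 ≤ t → t ≤ T' → ∀ x : ℝ,
      |x| ^ k * (|iteratedDeriv m (fun y => ρ t y - ρbar) x| +
        |iteratedDeriv m (fun y => u t y) x|) ≤ C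
  mass : ∀ t x : ℝ, 0 ≤ t →
      deriv (fun s => ρ s x) t + deriv (fun y => ρ t y * u t y) x = 0
  momentum : ∀ t x : ℝ, 0 ≤ t →
      deriv (fun s => ρ s x * u s x) t + deriv (fun y => ρ t y * (u t y) ^ 2) x +
          deriv (fun y => P (ρ t y)) x = -(lam * (ρ t x * u t x))

section

open Set Filter Topology
open scoped ContDiff

/-- A family of smooth functions all of whose Schwartz seminorms are bounded uniformly over the
index set `s`. -/
structure SchwartzFamily {τ E : Type*} [NormedAddCommGroup E] [NormedSpace ℝ E]
    (s : Set τ) (f : τ → ℝ → E) : Prop where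
  smooth : ∀ t ∈ s, ContDiff ℝ ∞ (f t)
  decay : ∀ k m : ℕ, ∃ C : ℝ, ∀ t ∈ s, ∀ x : ℝ, (1 + |x|) ^ k * ‖iteratedDeriv m (f t) x‖ ≤ C

lemma ContDiff.deriv_smooth {E : Type*} [NormedAddCommGroup E] [NormedSpace ℝ E] {f : ℝ → E}
    (hf : ContDiff ℝ ∞ f) : ContDiff ℝ ∞ (deriv f) :=
  (contDiff_infty_iff_deriv.1 hf).2

lemma ContDiff.hasDerivAt_smooth {E : Type*} [NormedAddCommGroup E] [NormedSpace ℝ E] {f : ℝ → E}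
    (hf : ContDiff ℝ ∞ f) (x : ℝ) : HasDerivAt f (deriv f x) x :=
  (hf.differentiable (by simp) x).hasDerivAt

/-- On a ball, a `C¹` function vanishing at the origin is dominated by the norm. -/
lemma exists_norm_le_mul_norm_of_contDiff {E F : Type*} [NormedAddCommGroup E] [NormedSpace ℝ E]
    [ProperSpace E] [NormedAddCommGroup F] [NormedSpace ℝ F] {H : E → F} (hH : ContDiff ℝ ∞ H)
    (B : ℝ) : ∃ L : ℝ, 0 ≤ L ∧ (∀ v, ‖v‖ ≤ B → ‖fderiv ℝ H v‖ ≤ L) ∧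
      ∀ v w, ‖v‖ ≤ B → ‖w‖ ≤ B → ‖H v - H w‖ ≤ L * ‖v - w‖ := by
  have hc : Continuous (fun v => ‖fderiv ℝ H v‖) := (hH.continuous_fderiv (by simp)).norm
  obtain ⟨L, hL⟩ := (isCompact_closedBall (0 : E) B).bddAbove_image hc.continuousOn
  have key : ∀ v, ‖v‖ ≤ B → ‖fderiv ℝ H v‖ ≤ max L 0 := fun v hv =>
    (hL ⟨v, by simpa using hv, rfl⟩).trans (le_max_left _ _)
  refine ⟨max L 0, le_max_right _ _, key, fun v w hv hw => ?_⟩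
  exact (convex_closedBall (0 : E) B).norm_image_sub_le_of_norm_fderiv_le (𝕜 := ℝ)
    (fun z _ => hH.differentiable (by simp) z) (fun z hz => key z (by simpa using hz))
    (by simpa using hw) (by simpa using hv)

namespace SchwartzFamily

variable {τ E F : Type*} [NormedAddCommGroup E] [NormedSpace ℝ E]
  [NormedAddCommGroup F] [NormedSpace ℝ F] {s : Set τ} {f : τ → ℝ → E}

lemma mono (hf : SchwartzFamily s f) {s' : Set τ} (h : s' ⊆ s) : SchwartzFamily s' f :=
  ⟨fun t ht => hf.smooth t (h ht), fun k m => (hf.decay k m).imp fun _ hC t ht => hC t (h ht)⟩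

lemma congr (hf : SchwartzFamily s f) {g : τ → ℝ → E} (h : ∀ t ∈ s, g t = f t) :
    SchwartzFamily s g :=
  ⟨fun t ht => by rw [h t ht]; exact hf.smooth t ht,
   fun k m => (hf.decay k m).imp fun _ hC t ht => by rw [h t ht]; exact hC t ht⟩

lemma comp_index {τ' : Type*} (hf : SchwartzFamily s f) {s' : Set τ'} {g : τ' → τ}
    (h : ∀ t ∈ s', g t ∈ s) : SchwartzFamily s' (fun t => f (g t)) :=
  ⟨fun t ht => hf.smooth _ (h t ht), fun k m => (hf.decay k m).imp fun _ hC t ht => hC _ (h t ht)⟩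

lemma union (hf : SchwartzFamily s f) {s' : Set τ} (hf' : SchwartzFamily s' f) :
    SchwartzFamily (s ∪ s') f := by
  refine ⟨fun t ht => ht.elim (hf.smooth t) (hf'.smooth t), fun k m => ?_⟩
  obtain ⟨C, hC⟩ := hf.decay k m
  obtain ⟨C', hC'⟩ := hf'.decay k m
  exact ⟨max C C', fun t ht x => ht.elim (fun h => (hC t h x).trans (le_max_left _ _))
    (fun h => (hC' t h x).trans (le_max_right _ _))⟩

lemma deriv (hf : SchwartzFamily s f) : SchwartzFamily s (fun t => deriv (f t)) :=
  ⟨fun t ht => (hf.smooth t ht).deriv_smooth, fun k m => by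
    simpa only [iteratedDeriv_succ'] using hf.decay k (m + 1)⟩

lemma bound (hf : SchwartzFamily s f) (m : ℕ) :
    ∃ C : ℝ, ∀ t ∈ s, ∀ x : ℝ, ‖iteratedDeriv m (f t) x‖ ≤ C := by
  simpa using hf.decay 0 m

lemma prodMk {g : τ → ℝ → F} (hf : SchwartzFamily s f) (hg : SchwartzFamily s g) :
    SchwartzFamily s (fun t x => (f t x, g t x)) := by
  refine ⟨fun t ht => (hf.smooth t ht).prodMk (hg.smooth t ht), fun k m => ?_⟩
  have key : ∀ t ∈ s, iteratedDeriv m (fun x => (f t x, g t x)) =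
      fun x => (iteratedDeriv m (f t) x, iteratedDeriv m (g t) x) := by
    intro t ht
    induction m with
    | zero => simp
    | succ m ih =>
      rw [iteratedDeriv_succ, ih]
      ext1 x
      have h1 := (hf.smooth t ht).differentiable_iteratedDeriv m
        (by exact_mod_cast WithTop.coe_lt_top _) x
      have h2 := (hg.smooth t ht).differentiable_iteratedDeriv m
        (by exact_mod_cast WithTop.coe_lt_top _) x
      rw [(h1.hasDerivAt.prodMk h2.hasDerivAt).deriv, iteratedDeriv_succ, iteratedDeriv_succ]
  obtain ⟨C, hC⟩ := hf.decay k m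
  obtain ⟨C', hC'⟩ := hg.decay k m
  refine ⟨max C C', fun t ht x => ?_⟩
  rw [key t ht, Prod.norm_mk, mul_max_of_nonneg _ _ (by positivity)]
  exact max_le_max (hC t ht x) (hC' t ht x)

/-- Smooth functions vanishing at the origin preserve Schwartz families. -/
lemma smooth_comp {τ : Type*} {s : Set τ} {E F : Type} [NormedAddCommGroup E] [NormedSpace ℝ E]
    [ProperSpace E] [NormedAddCommGroup F] [NormedSpace ℝ F] {f : τ → ℝ → E}
    (hf : SchwartzFamily s f) {H : E → F}
    (hH : ContDiff ℝ ∞ H) (h0 : H 0 = 0) : SchwartzFamily s (fun t x => H (f t x)) := by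
  refine ⟨fun t ht => hH.comp (hf.smooth t ht), fun k m => ?_⟩
  induction m generalizing E F with
  | zero =>
    obtain ⟨B, hB⟩ := hf.bound 0
    obtain ⟨C, hC⟩ := hf.decay k 0
    obtain ⟨L, hL0, -, hL⟩ := exists_norm_le_mul_norm_of_contDiff hH (max B 0)
    refine ⟨L * C, fun t ht x => ?_⟩
    have h1 := hL (f t x) 0
      ((by simpa only [iteratedDeriv_zero] using hB t ht x : _ ≤ B).trans (le_max_left _ _))
      (by simp)
    simp only [h0, sub_zero] at h1
    have h2 := hC t ht x
    simp only [iteratedDeriv_zero] at h2 ⊢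
    calc _ ≤ (1 + |x|) ^ k * (L * ‖f t x‖) := by gcongr
      _ = L * ((1 + |x|) ^ k * ‖f t x‖) := by ring
      _ ≤ _ := by gcongr
  | succ m ih =>
    have hH' : ContDiff ℝ ∞ (fun p : E × E => fderiv ℝ H p.1 p.2) :=
      (hH.fderiv_right (m := ∞) (by simp)).comp contDiff_fst |>.clm_apply contDiff_snd
    obtain ⟨C, hC⟩ := ih (hf.prodMk hf.deriv) hH' (by simp)
    refine ⟨C, fun t ht x => ?_⟩
    have : _root_.deriv (fun x => H (f t x)) =
        fun x => fderiv ℝ H (f t x) (_root_.deriv (f t) x) := by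
      ext1 x
      exact ((hH.differentiable (by simp) (f t x)).hasFDerivAt.comp_hasDerivAt x
        ((hf.smooth t ht).hasDerivAt_smooth x)).deriv
    rw [iteratedDeriv_succ', this]
    exact hC t ht x

end SchwartzFamily

/-- Uniform bounds on a ball for a finite family of smooth functions. -/
lemma exists_uniform_bounds_on_ball {ι E F : Type*} [Fintype ι] [NormedAddCommGroup E]
    [NormedSpace ℝ E] [ProperSpace E] [NormedAddCommGroup F] [NormedSpace ℝ F] {H : ι → E → F}
    (hH : ∀ i, ContDiff ℝ ∞ (H i)) (B : ℝ) :
    ∃ L : ℝ, 0 ≤ L ∧ (∀ i v, ‖v‖ ≤ B → ‖H i v‖ ≤ L) ∧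
      (∀ i v, ‖v‖ ≤ B → ‖fderiv ℝ (H i) v‖ ≤ L) ∧
      ∀ i v w, ‖v‖ ≤ B → ‖w‖ ≤ B → ‖H i v - H i w‖ ≤ L * ‖v - w‖ := by
  have hex := fun i => exists_norm_le_mul_norm_of_contDiff (hH i) B
  choose L hL0 hL1 hL2 using hex
  have hex' := fun i => (isCompact_closedBall (0 : E) B).exists_bound_of_continuousOn
    (hH i).continuous.continuousOn
  choose K hK using hex'
  have hLi : ∀ i, L i ≤ ∑ i, (L i + |K i|) := fun i =>
    (le_add_of_nonneg_right (abs_nonneg (K i))).trans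
      (Finset.single_le_sum (f := fun i => L i + |K i|)
        (fun i _ => add_nonneg (hL0 i) (abs_nonneg _)) (Finset.mem_univ i))
  have hKi : ∀ i, K i ≤ ∑ i, (L i + |K i|) := fun i =>
    ((le_abs_self _).trans (le_add_of_nonneg_left (hL0 i))).trans
      (Finset.single_le_sum (f := fun i => L i + |K i|)
        (fun i _ => add_nonneg (hL0 i) (abs_nonneg _)) (Finset.mem_univ i))
  refine ⟨∑ i, (L i + |K i|), Finset.sum_nonneg fun i _ => add_nonneg (hL0 i) (abs_nonneg _),
    fun i v hv => (hK i v (by simpa using hv)).trans (hKi i),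
    fun i v hv => (hL1 i v hv).trans (hLi i), fun i v w hv hw => (hL2 i v w hv hw).trans ?_⟩
  gcongr
  exact hLi i

/-- A family, indexed by `n`, of semi-Lagrangian time discretisations with step `h n` of the
diagonal system `∂ₜVᵢ + Aᵢ(V) ∂ₓVᵢ = Fᵢ(0, V, V)`. -/
structure IsRun {ι E : Type} [Fintype ι] [NormedAddCommGroup E] [NormedSpace ℝ E]
    (A : ι → (ι → E) → ℝ) (F : ι → ℝ × (ι → E) × (ι → E) → E) (h : ℕ → ℝ)
    (V : ℕ → ℕ → ℝ → ι → E) : Prop where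
  step : ∀ n j x i, V n (j + 1) x i = V n j (x - h n * A i (V n j x)) i +
    h n • F i (h n, V n j x, V n j (x - h n * A i (V n j x)))
  speed_smooth : ∀ i, ContDiff ℝ ∞ (A i)
  source_smooth : ∀ i, ContDiff ℝ ∞ (F i)
  source_zero : ∀ i h, F i (h, 0, 0) = 0
  init_smooth : ∀ n, ContDiff ℝ ∞ (V n 0)
  h_pos : ∀ n, 0 < h n
  h_le : ∀ n, h n ≤ 1

/-- The pairs (discretisation, step) reached before time `T`. -/
def stepsBefore (h : ℕ → ℝ) (T : ℝ) : Set (ℕ × ℕ) := {p | p.2 * h p.1 ≤ T}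

lemma mem_stepsBefore_of_succ {h : ℕ → ℝ} {T : ℝ} (hh : ∀ n, 0 < h n) {n j : ℕ}
    (hj : (n, j + 1) ∈ stepsBefore h T) : (n, j) ∈ stepsBefore h T := by
  change ((j + 1 : ℕ) : ℝ) * h n ≤ T at hj
  change (j : ℝ) * h n ≤ T
  push_cast at hj
  nlinarith [hh n]

namespace IsRun

variable {ι E : Type} [Fintype ι] [NormedAddCommGroup E] [NormedSpace ℝ E]
  {A : ι → (ι → E) → ℝ} {F : ι → ℝ × (ι → E) × (ι → E) → E} {h : ℕ → ℝ}
  {V : ℕ → ℕ → ℝ → ι → E}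

lemma smooth (hV : IsRun A F h V) (n j : ℕ) : ContDiff ℝ ∞ (V n j) := by
  induction j with
  | zero => exact hV.init_smooth n
  | succ j ih =>
    rw [contDiff_pi]
    intro i
    have hA := hV.speed_smooth i
    have hF := hV.source_smooth i
    have hy : ContDiff ℝ ∞ (fun x => x - h n * A i (V n j x)) :=
      contDiff_id.sub (contDiff_const.mul (hA.comp ih))
    have e : (fun x => V n (j + 1) x i) = fun x => V n j (x - h n * A i (V n j x)) i +
        h n • F i (h n, V n j x, V n j (x - h n * A i (V n j x))) := by
      ext1 x; exact hV.step n j x i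
    rw [e]
    exact ((contDiff_pi.1 (ih.comp hy)) i).add
      (contDiff_const.smul (hF.comp (contDiff_const.prodMk (ih.prodMk (ih.comp hy)))))

/-- The speeds of the system satisfied by `(V, ∂ₓV)`. -/
def prolongSpeed (A : ι → (ι → E) → ℝ) : ι → (ι → E × E) → ℝ :=
  fun i v => A i (fun l => (v l).1)

/-- The sources of the discretised system satisfied by `(V, ∂ₓV)`. -/
def prolongSource (A : ι → (ι → E) → ℝ) (F : ι → ℝ × (ι → E) × (ι → E) → E) :
    ι → ℝ × (ι → E × E) × (ι → E × E) → E × E := fun i q =>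
  (F i (q.1, (fun l => (q.2.1 l).1), (fun l => (q.2.2 l).1)),
    -(fderiv ℝ (A i) (fun l => (q.2.1 l).1) (fun l => (q.2.1 l).2)) • (q.2.2 i).2 +
    fderiv ℝ (F i) (q.1, (fun l => (q.2.1 l).1), (fun l => (q.2.2 l).1))
      (0, (fun l => (q.2.1 l).2),
        (1 - q.1 * fderiv ℝ (A i) (fun l => (q.2.1 l).1) (fun l => (q.2.1 l).2)) •
          fun l => (q.2.2 l).2))

/-- The discretisation together with its spatial derivative. -/
def prolong (V : ℕ → ℕ → ℝ → ι → E) : ℕ → ℕ → ℝ → ι → E × E :=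
  fun n j x i => (V n j x i, deriv (V n j) x i)

lemma deriv_step (hV : IsRun A F h V) (n j : ℕ) (x : ℝ) (i : ι) :
    deriv (V n (j + 1)) x i =
      (1 - h n * fderiv ℝ (A i) (V n j x) (deriv (V n j) x)) •
        deriv (V n j) (x - h n * A i (V n j x)) i +
      h n • fderiv ℝ (F i) (h n, V n j x, V n j (x - h n * A i (V n j x)))
        (0, deriv (V n j) x, (1 - h n * fderiv ℝ (A i) (V n j x) (deriv (V n j) x)) •
          deriv (V n j) (x - h n * A i (V n j x))) := by
  have hVd := (hV.smooth n j).hasDerivAt_smooth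
  have hA : HasDerivAt (fun x => A i (V n j x)) (fderiv ℝ (A i) (V n j x) (deriv (V n j) x)) x :=
    ((hV.speed_smooth i).differentiable (by simp) _).hasFDerivAt.comp_hasDerivAt x (hVd x)
  have hy : HasDerivAt (fun x => x - h n * A i (V n j x))
      (1 - h n * fderiv ℝ (A i) (V n j x) (deriv (V n j) x)) x :=
    (hasDerivAt_id x).sub (hA.const_mul (h n))
  have hVy : HasDerivAt (fun x => V n j (x - h n * A i (V n j x)))
      ((1 - h n * fderiv ℝ (A i) (V n j x) (deriv (V n j) x)) •
        deriv (V n j) (x - h n * A i (V n j x))) x := (hVd _).scomp x hy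
  have hF := ((hV.source_smooth i).differentiable (by simp)
    (h n, V n j x, V n j (x - h n * A i (V n j x)))).hasFDerivAt.comp_hasDerivAt x
      ((hasDerivAt_const x (h n)).prodMk ((hVd x).prodMk hVy))
  have key := ((hasDerivAt_pi.1 hVy) i).add (hF.const_smul (h n))
  have e : (fun x => V n (j + 1) x i) = fun x => V n j (x - h n * A i (V n j x)) i +
      h n • F i (h n, V n j x, V n j (x - h n * A i (V n j x))) := by
    ext1 x; exact hV.step n j x i
  have h2 := (hasDerivAt_pi.1 ((hV.smooth n (j + 1)).hasDerivAt_smooth x)) i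
  rw [e] at h2
  exact h2.unique key

lemma prolong_isRun (hV : IsRun A F h V) :
    IsRun (prolongSpeed A) (prolongSource A F) h (prolong V) where
  step n j x i := by
    refine Prod.ext ?_ ?_
    · simp [prolong, prolongSpeed, prolongSource, hV.step n j x i]
    · simp only [prolong, prolongSpeed, prolongSource, hV.deriv_step n j x i, Prod.snd_add,
        Prod.smul_snd]
      have aux : ∀ (a c : ℝ) (d e : E), (1 - a * c) • d + a • e = d + a • (-c • d + e) := by
        intros; module
      exact aux _ _ _ _
  speed_smooth i := (hV.speed_smooth i).comp (by fun_prop)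
  source_smooth i := by
    have e1 : ContDiff ℝ ∞ (fun q : ℝ × (ι → E × E) × (ι → E × E) => fun l => (q.2.1 l).1) := by
      fun_prop
    have e2 : ContDiff ℝ ∞ (fun q : ℝ × (ι → E × E) × (ι → E × E) => fun l => (q.2.1 l).2) := by
      fun_prop
    have e3 : ContDiff ℝ ∞ (fun q : ℝ × (ι → E × E) × (ι → E × E) => fun l => (q.2.2 l).1) := by
      fun_prop
    have e4 : ContDiff ℝ ∞ (fun q : ℝ × (ι → E × E) × (ι → E × E) => fun l => (q.2.2 l).2) := by
      fun_prop
    have e5 := ((hV.speed_smooth i).fderiv_right (m := ∞) (by simp)).comp e1 |>.clm_apply e2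
    have e6 : ContDiff ℝ ∞ (fun q : ℝ × (ι → E × E) × (ι → E × E) =>
        (q.1, (fun l => (q.2.1 l).1), (fun l => (q.2.2 l).1))) :=
      contDiff_fst.prodMk (e1.prodMk e3)
    have e7 := ((hV.source_smooth i).fderiv_right (m := ∞) (by simp)).comp e6
    exact ((hV.source_smooth i).comp e6).prodMk ((e5.neg.smul ((contDiff_pi.1 e4) i)).add
      (e7.clm_apply (contDiff_const.prodMk (e2.prodMk
        ((contDiff_const.sub (contDiff_fst.mul e5)).smul e4)))))
  source_zero i h := by
    change (F i (h, 0, 0), -(fderiv ℝ (A i) 0 0) • (0 : E) + fderiv ℝ (F i) (h, 0, 0)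
      (0, 0, (1 - h * fderiv ℝ (A i) 0 0) • (0 : ι → E))) = 0
    rw [hV.source_zero, smul_zero, smul_zero, Prod.mk_zero_zero, Prod.mk_zero_zero, map_zero,
      add_zero, Prod.mk_zero_zero]
  init_smooth n := by
    rw [contDiff_pi]
    exact fun i => ((contDiff_pi.1 (hV.smooth n 0)) i).prodMk
      ((contDiff_pi.1 (hV.smooth n 0).deriv_smooth) i)
  h_pos := hV.h_pos
  h_le := hV.h_le

end IsRun

lemma ContinuousLinearMap.iteratedDeriv_comp_smooth {E F : Type*} [NormedAddCommGroup E]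
    [NormedSpace ℝ E] [NormedAddCommGroup F] [NormedSpace ℝ F] (Q : E →L[ℝ] F) {f : ℝ → E}
    (hf : ContDiff ℝ ∞ f) (m : ℕ) :
    iteratedDeriv m (fun x => Q (f x)) = fun x => Q (iteratedDeriv m f x) := by
  induction m with
  | zero => simp
  | succ m ih =>
    rw [iteratedDeriv_succ, ih]
    ext1 x
    have h1 := hf.differentiable_iteratedDeriv m (by exact_mod_cast WithTop.coe_lt_top _) x
    rw [iteratedDeriv_succ]
    exact (Q.hasFDerivAt.comp_hasDerivAt x h1.hasDerivAt).deriv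

namespace IsRun

variable {ι E : Type} [Fintype ι] [NormedAddCommGroup E] [NormedSpace ℝ E] [ProperSpace E]
  {A : ι → (ι → E) → ℝ} {F : ι → ℝ × (ι → E) × (ι → E) → E} {h : ℕ → ℝ}
  {V : ℕ → ℕ → ℝ → ι → E} {T B : ℝ}

lemma exists_weighted_bound (hV : IsRun A F h V)
    (hB : ∀ p ∈ stepsBefore h T, ∀ x, ‖V p.1 p.2 x‖ ≤ B) (k : ℕ) {C₀ : ℝ}
    (h0 : ∀ n x, (1 + |x|) ^ k * ‖V n 0 x‖ ≤ C₀) :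
    ∃ C, ∀ p ∈ stepsBefore h T, ∀ x, (1 + |x|) ^ k * ‖V p.1 p.2 x‖ ≤ C := by
  obtain ⟨K, hK0, hK, -, -⟩ := exists_uniform_bounds_on_ball hV.speed_smooth B
  obtain ⟨L, hL0, -, -, hL⟩ := exists_uniform_bounds_on_ball hV.source_smooth (max 1 B)
  set M := max C₀ 0
  set Λ := k * K + 2 * L
  have growth : ∀ n j, (n, j) ∈ stepsBefore h T → ∀ x,
      (1 + |x|) ^ k * ‖V n j x‖ ≤ M * Real.exp (Λ * (j * h n)) := by
    intro n j
    induction j with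
    | zero =>
      intro _ x
      simp only [Nat.cast_zero, zero_mul, mul_zero, Real.exp_zero, mul_one]
      exact (h0 n x).trans (le_max_left _ _)
    | succ j ih =>
      intro hj x
      have hj' := mem_stepsBefore_of_succ hV.h_pos hj
      have hh := hV.h_pos n
      replace ih := ih hj'
      set N := M * Real.exp (Λ * (j * h n)) with hN
      have hN0 : 0 ≤ N := by positivity
      suffices H : ∀ i, (1 + |x|) ^ k * ‖V n (j + 1) x i‖ ≤ N * Real.exp (Λ * h n) by
        have hpos : (0 : ℝ) < (1 + |x|) ^ k := by positivity
        have : ‖V n (j + 1) x‖ ≤ N * Real.exp (Λ * h n) / (1 + |x|) ^ k := by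
          rw [pi_norm_le_iff_of_nonneg (by positivity)]
          intro i
          rw [le_div_iff₀ hpos, mul_comm]
          exact H i
        rw [le_div_iff₀ hpos, mul_comm] at this
        refine this.trans_eq ?_
        rw [hN, mul_assoc, ← Real.exp_add]
        push_cast
        ring_nf
      intro i
      rw [hV.step n j x i]
      set y := x - h n * A i (V n j x) with hy
      set e := Real.exp (k * (h n * K)) with he
      have he1 : 1 ≤ e := Real.one_le_exp (by positivity)
      have hbx := hB _ hj' x
      have hby := hB _ hj' y
      have hA : |A i (V n j x)| ≤ K := hK i _ hbx
      have hw : (1 + |x|) ^ k ≤ (1 + |y|) ^ k * e := by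
        rw [he, Real.exp_nat_mul, ← mul_pow]
        refine pow_le_pow_left₀ (by positivity) ?_ k
        have h1 : |x| ≤ |y| + h n * K := by
          calc |x| = |y + h n * A i (V n j x)| := by rw [hy]; ring_nf
            _ ≤ |y| + |h n * A i (V n j x)| := abs_add_le _ _
            _ ≤ |y| + h n * K := by rw [abs_mul, abs_of_pos hh]; gcongr
        have h2 := Real.add_one_le_exp (h n * K)
        have h3 := abs_nonneg y
        have h4 : 0 ≤ h n * K := by positivity
        nlinarith
      have hF : ‖F i (h n, V n j x, V n j y)‖ ≤ L * (‖V n j x‖ + ‖V n j y‖) := by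
        have hn1 : ‖(h n, V n j x, V n j y)‖ ≤ max 1 B := by
          rw [Prod.norm_mk, Prod.norm_mk]
          refine max_le ?_ (max_le (hbx.trans (le_max_right _ _)) (hby.trans (le_max_right _ _)))
          rw [Real.norm_of_nonneg hh.le]
          exact (hV.h_le n).trans (le_max_left _ _)
        have hn2 : ‖((h n, 0, 0) : ℝ × (ι → E) × (ι → E))‖ ≤ max 1 B := by
          rw [Prod.norm_mk, ← Prod.zero_eq_mk, norm_zero, Real.norm_of_nonneg hh.le]
          exact (max_le (hV.h_le n) zero_le_one).trans (le_max_left _ _)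
        have := hL i _ _ hn1 hn2
        rw [hV.source_zero, sub_zero] at this
        refine this.trans ?_
        gcongr
        simp only [Prod.mk_sub_mk, sub_self, sub_zero, Prod.norm_mk, norm_zero]
        exact max_le (by positivity) (max_le (le_add_of_nonneg_right (norm_nonneg _))
          (le_add_of_nonneg_left (norm_nonneg _)))
      have ihx := ih x
      have ihy := ih y
      have hVi : ‖V n j y i‖ ≤ ‖V n j y‖ := norm_le_pi_norm _ i
      have hwy : (1 + |x|) ^ k * ‖V n j y‖ ≤ N * e := by
        calc _ ≤ (1 + |y|) ^ k * e * ‖V n j y‖ := by gcongr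
          _ = ((1 + |y|) ^ k * ‖V n j y‖) * e := by ring
          _ ≤ _ := by gcongr
      calc (1 + |x|) ^ k * ‖V n j y i + h n • F i (h n, V n j x, V n j y)‖
          ≤ (1 + |x|) ^ k * (‖V n j y‖ + h n * (L * (‖V n j x‖ + ‖V n j y‖))) := by
            gcongr
            refine (norm_add_le _ _).trans ?_
            rw [norm_smul, Real.norm_of_nonneg hh.le]
            gcongr
        _ = (1 + |x|) ^ k * ‖V n j y‖ * (1 + h n * L) +
              h n * L * ((1 + |x|) ^ k * ‖V n j x‖) := by ring
        _ ≤ N * e * (1 + h n * L) + h n * L * (N * e) := by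
            have : N ≤ N * e := le_mul_of_one_le_right hN0 he1
            refine add_le_add (mul_le_mul_of_nonneg_right hwy (by positivity))
              (mul_le_mul_of_nonneg_left (ihx.trans this) (by positivity))
        _ = N * (e * (2 * L * h n + 1)) := by ring
        _ ≤ N * (e * Real.exp (2 * L * h n)) := by
            gcongr
            exact Real.add_one_le_exp _
        _ = N * Real.exp (Λ * h n) := by
            rw [he, ← Real.exp_add]
            congr 2
            simp only [Λ]
            ring
  refine ⟨M * Real.exp (|Λ| * |T|), fun p hp x => (growth p.1 p.2 hp x).trans ?_⟩
  have hp' : (p.2 : ℝ) * h p.1 ≤ T := hp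
  have hp0 : 0 ≤ (p.2 : ℝ) * h p.1 := mul_nonneg (Nat.cast_nonneg _) (hV.h_pos _).le
  gcongr
  · exact le_abs_self _
  · exact hp'.trans (le_abs_self _)

lemma exists_deriv_bound (hV : IsRun A F h V) {K : ℝ}
    (hB : ∀ p ∈ stepsBefore h T, ∀ x, ‖V p.1 p.2 x‖ ≤ B)
    (hK : ∀ p ∈ stepsBefore h T, ∀ x i,
      |fderiv ℝ (A i) (V p.1 p.2 x) (deriv (V p.1 p.2) x)| ≤ K) {C₀ : ℝ}
    (h0 : ∀ n x, ‖deriv (V n 0) x‖ ≤ C₀) :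
    ∃ C, ∀ p ∈ stepsBefore h T, ∀ x, ‖deriv (V p.1 p.2) x‖ ≤ C := by
  obtain ⟨L, hL0, -, hL, -⟩ := exists_uniform_bounds_on_ball hV.source_smooth (max 1 B)
  set M := max C₀ 0
  set K' := max K 0
  have hK'0 : 0 ≤ K' := le_max_right _ _
  set Λ := K' + L * (1 + K')
  have growth : ∀ n j, (n, j) ∈ stepsBefore h T → ∀ x,
      ‖deriv (V n j) x‖ ≤ M * Real.exp (Λ * (j * h n)) := by
    intro n j
    induction j with
    | zero =>
      intro _ x
      simp only [Nat.cast_zero, zero_mul, mul_zero, Real.exp_zero, mul_one]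
      exact (h0 n x).trans (le_max_left _ _)
    | succ j ih =>
      intro hj x
      have hj' := mem_stepsBefore_of_succ hV.h_pos hj
      have hh := hV.h_pos n
      replace ih := ih hj'
      set N := M * Real.exp (Λ * (j * h n)) with hN
      have hN0 : 0 ≤ N := by positivity
      suffices H : ∀ i, ‖deriv (V n (j + 1)) x i‖ ≤ N * Real.exp (Λ * h n) by
        refine ((pi_norm_le_iff_of_nonneg (by positivity)).2 H).trans_eq ?_
        rw [hN, mul_assoc, ← Real.exp_add]
        push_cast
        ring_nf
      intro i
      rw [hV.deriv_step n j x i]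
      set y := x - h n * A i (V n j x) with hy
      set α := fderiv ℝ (A i) (V n j x) (deriv (V n j) x)
      have hα : |α| ≤ K' := (hK _ hj' x i).trans (le_max_left _ _)
      have hbx := hB _ hj' x
      have hby := hB _ hj' y
      have hn1 : ‖(h n, V n j x, V n j y)‖ ≤ max 1 B := by
        rw [Prod.norm_mk, Prod.norm_mk]
        refine max_le ?_ (max_le (hbx.trans (le_max_right _ _)) (hby.trans (le_max_right _ _)))
        rw [Real.norm_of_nonneg hh.le]
        exact (hV.h_le n).trans (le_max_left _ _)
      have hα1 : |1 - h n * α| ≤ 1 + h n * K' := by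
        refine (abs_sub _ _).trans ?_
        rw [abs_one, abs_mul, abs_of_pos hh]
        gcongr
      have hα2 : |1 - h n * α| ≤ 1 + K' :=
        hα1.trans (by nlinarith [hV.h_le n])
      have hF : ‖fderiv ℝ (F i) (h n, V n j x, V n j y)
          (0, deriv (V n j) x, (1 - h n * α) • deriv (V n j) y)‖ ≤ L * ((1 + K') * N) := by
        refine (ContinuousLinearMap.le_opNorm _ _).trans ?_
        gcongr
        · exact hL i _ hn1
        · simp only [Prod.norm_mk, norm_zero, norm_smul, Real.norm_eq_abs]
          refine max_le (by positivity) (max_le ?_ ?_)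
          · nlinarith [ih x, mul_nonneg hK'0 hN0]
          · gcongr
            exact ih y
      calc _ ≤ (1 + h n * K') * N + h n * (L * ((1 + K') * N)) := by
            refine (norm_add_le _ _).trans ?_
            rw [norm_smul, norm_smul, Real.norm_of_nonneg hh.le, Real.norm_eq_abs]
            gcongr
            exact (norm_le_pi_norm _ i).trans (ih y)
        _ = N * (Λ * h n + 1) := by simp only [Λ]; ring
        _ ≤ N * Real.exp (Λ * h n) := by
            gcongr
            exact Real.add_one_le_exp _
  refine ⟨M * Real.exp (|Λ| * |T|), fun p hp x => (growth p.1 p.2 hp x).trans ?_⟩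
  have hp' : (p.2 : ℝ) * h p.1 ≤ T := hp
  have hp0 : 0 ≤ (p.2 : ℝ) * h p.1 := mul_nonneg (Nat.cast_nonneg _) (hV.h_pos _).le
  gcongr
  · exact le_abs_self _
  · exact hp'.trans (le_abs_self _)

omit [ProperSpace E] in
lemma fderiv_prolongSpeed (hV : IsRun A F h V) (n j : ℕ) (x : ℝ) (i : ι) :
    fderiv ℝ (prolongSpeed A i) (prolong V n j x) (deriv (prolong V n j) x) =
      fderiv ℝ (A i) (V n j x) (deriv (V n j) x) := by
  have h1 := ((hV.prolong_isRun.speed_smooth i).differentiable (by simp)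
    (prolong V n j x)).hasFDerivAt.comp_hasDerivAt x
    (hV.prolong_isRun.smooth n j |>.hasDerivAt_smooth x)
  have h2 := ((hV.speed_smooth i).differentiable (by simp)
    (V n j x)).hasFDerivAt.comp_hasDerivAt x (hV.smooth n j |>.hasDerivAt_smooth x)
  exact h1.unique h2

omit [Fintype ι] in
variable (ι E) in
/-- Interleaving two vectors. -/
def interleave : ((ι → E) × (ι → E)) →L[ℝ] (ι → E × E) :=
  ContinuousLinearMap.pi fun i =>
    ((ContinuousLinearMap.proj i).comp (ContinuousLinearMap.fst ℝ (ι → E) (ι → E))).prod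
      ((ContinuousLinearMap.proj i).comp (ContinuousLinearMap.snd ℝ (ι → E) (ι → E)))

omit [Fintype ι] in
variable (ι E) in
/-- The vector of second components. -/
def secondComponents : (ι → E × E) →L[ℝ] (ι → E) :=
  ContinuousLinearMap.pi fun i =>
    (ContinuousLinearMap.snd ℝ E E).comp (ContinuousLinearMap.proj i)

lemma prolong_schwartzFamily {τ : Type*} {s : Set τ} {g : τ → ℕ × ℕ}
    (hf : SchwartzFamily s (fun t => V (g t).1 (g t).2)) :
    SchwartzFamily s (fun t => prolong V (g t).1 (g t).2) :=
  (hf.prodMk hf.deriv).smooth_comp (interleave ι E).contDiff (map_zero _)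

omit [ProperSpace E] in
lemma iteratedDeriv_succ_eq (hV : IsRun A F h V) (m n j : ℕ) (x : ℝ) :
    iteratedDeriv (m + 1) (V n j) x =
      secondComponents ι E (iteratedDeriv m (prolong V n j) x) := by
  rw [iteratedDeriv_succ']
  exact congrFun ((secondComponents ι E).iteratedDeriv_comp_smooth
    (hV.prolong_isRun.smooth n j) m) x

/-- If the discretisations and the derivatives of their speeds are bounded, then the
discretisations form a Schwartz family. -/
theorem schwartzFamily (hV : IsRun A F h V) {K : ℝ}
    (hB : ∀ p ∈ stepsBefore h T, ∀ x, ‖V p.1 p.2 x‖ ≤ B)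
    (hK : ∀ p ∈ stepsBefore h T, ∀ x i,
      |fderiv ℝ (A i) (V p.1 p.2 x) (deriv (V p.1 p.2) x)| ≤ K)
    (h0 : SchwartzFamily univ (fun n => V n 0)) :
    SchwartzFamily (stepsBefore h T) (fun p => V p.1 p.2) := by
  refine ⟨fun p _ => hV.smooth p.1 p.2, fun k m => ?_⟩
  induction m generalizing E B with
  | zero =>
    obtain ⟨C₀, hC₀⟩ := h0.decay k 0
    simp only [iteratedDeriv_zero] at hC₀ ⊢
    exact hV.exists_weighted_bound hB k fun n x => hC₀ n (mem_univ n) x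
  | succ m ih =>
    obtain ⟨C₀, hC₀⟩ := h0.bound 1
    simp only [iteratedDeriv_one] at hC₀
    obtain ⟨C₁, hC₁⟩ := hV.exists_deriv_bound hB hK fun n x => hC₀ n (mem_univ n) x
    obtain ⟨C, hC⟩ := ih hV.prolong_isRun (B := max (max B C₁) 0)
      (fun p hp x => (pi_norm_le_iff_of_nonneg (le_max_right _ _)).2 fun i =>
        (max_le_max ((norm_le_pi_norm (V p.1 p.2 x) i).trans (hB p hp x))
          ((norm_le_pi_norm (deriv (V p.1 p.2) x) i).trans (hC₁ p hp x))).trans (le_max_left _ _))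
      (fun p hp x i => by rw [hV.fderiv_prolongSpeed]; exact hK p hp x i)
      (prolong_schwartzFamily (g := fun n => (n, 0)) h0)
    refine ⟨‖secondComponents ι E‖ * C, fun p hp x => ?_⟩
    rw [hV.iteratedDeriv_succ_eq]
    calc _ ≤ (1 + |x|) ^ k * (‖secondComponents ι E‖ *
            ‖iteratedDeriv m (prolong V p.1 p.2) x‖) := by
          gcongr; exact ContinuousLinearMap.le_opNorm _ _
      _ = ‖secondComponents ι E‖ * ((1 + |x|) ^ k *
            ‖iteratedDeriv m (prolong V p.1 p.2) x‖) := by ring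
      _ ≤ _ := by gcongr; exact hC p hp x

/-- All spatial derivatives of the discretisations vary by `O(h n)` in one time step. -/
theorem exists_time_increment_bound (hV : IsRun A F h V)
    (hS : SchwartzFamily (stepsBefore h T) (fun p => V p.1 p.2)) (m : ℕ) :
    ∃ C, 0 ≤ C ∧ ∀ n j, (n, j) ∈ stepsBefore h T → ∀ x,
      ‖iteratedDeriv m (V n (j + 1)) x - iteratedDeriv m (V n j) x‖ ≤ C * h n := by
  induction m generalizing E with
  | zero =>
    obtain ⟨B, hB⟩ := hS.bound 0
    obtain ⟨D, hD⟩ := hS.bound 1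
    simp only [iteratedDeriv_zero, iteratedDeriv_one] at hB hD ⊢
    obtain ⟨K, hK0, hK, -, -⟩ := exists_uniform_bounds_on_ball hV.speed_smooth B
    obtain ⟨L, hL0, hL, -, -⟩ := exists_uniform_bounds_on_ball hV.source_smooth (max 1 B)
    set D' := max D 0
    have hD'0 : 0 ≤ D' := le_max_right _ _
    refine ⟨D' * K + L, by positivity, fun n j hj x => ?_⟩
    have hh := hV.h_pos n
    rw [pi_norm_le_iff_of_nonneg (by positivity)]
    intro i
    rw [Pi.sub_apply, hV.step n j x i]
    set y := x - h n * A i (V n j x) with hy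
    have hxy : ‖V n j y - V n j x‖ ≤ D' * ‖y - x‖ :=
      convex_univ.norm_image_sub_le_of_norm_deriv_le
        (fun z _ => (hV.smooth n j).differentiable (by simp) z)
        (fun z _ => (hD _ hj z).trans (le_max_left _ _)) (mem_univ _) (mem_univ _)
    have hyx : ‖y - x‖ ≤ K * h n := by
      have : y - x = -(h n * A i (V n j x)) := by rw [hy]; ring
      rw [this, norm_neg, norm_mul, Real.norm_of_nonneg hh.le, mul_comm]
      gcongr
      exact hK i _ (hB _ hj x)
    have hn1 : ‖(h n, V n j x, V n j y)‖ ≤ max 1 B := by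
      rw [Prod.norm_mk, Prod.norm_mk]
      refine max_le ?_ (max_le ((hB _ hj x).trans (le_max_right _ _))
        ((hB _ hj y).trans (le_max_right _ _)))
      rw [Real.norm_of_nonneg hh.le]
      exact (hV.h_le n).trans (le_max_left _ _)
    calc _ = ‖(V n j y - V n j x) i + h n • F i (h n, V n j x, V n j y)‖ := by
          rw [Pi.sub_apply]; congr 1; abel
      _ ≤ D' * (K * h n) + h n * L := by
          refine (norm_add_le _ _).trans ?_
          rw [norm_smul, Real.norm_of_nonneg hh.le]
          gcongr
          · exact (norm_le_pi_norm _ i).trans (hxy.trans (by gcongr))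
          · exact hL i _ hn1
      _ = _ := by ring
  | succ m ih =>
    obtain ⟨C, hC0, hC⟩ := ih hV.prolong_isRun (prolong_schwartzFamily (g := id) hS)
    refine ⟨‖secondComponents ι E‖ * C, by positivity, fun n j hj x => ?_⟩
    rw [hV.iteratedDeriv_succ_eq, hV.iteratedDeriv_succ_eq, ← map_sub, mul_assoc]
    exact (ContinuousLinearMap.le_opNorm _ _).trans (by gcongr; exact hC n j hj x)

end IsRun

section Run

variable {ι : Type} [Fintype ι]

/-- The semi-Lagrangian discretisation with time step `h` of `∂ₜVᵢ + Aᵢ(V) ∂ₓVᵢ = fᵢ(V)`. -/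
def semiLagrangian (A f : ι → (ι → ℝ) → ℝ) (V₀ : ℝ → ι → ℝ) (h : ℝ) : ℕ → ℝ → ι → ℝ
  | 0 => V₀
  | j + 1 => fun x i =>
      semiLagrangian A f V₀ h j (x - h * A i (semiLagrangian A f V₀ h j x)) i +
        h * f i (semiLagrangian A f V₀ h j x)

variable {A f : ι → (ι → ℝ) → ℝ} {V₀ : ℝ → ι → ℝ}

lemma semiLagrangian_isRun (hA : ∀ i, ContDiff ℝ ∞ (A i)) (hf : ∀ i, ContDiff ℝ ∞ (f i))
    (hf0 : ∀ i, f i 0 = 0) (hV₀ : ContDiff ℝ ∞ V₀) {h : ℕ → ℝ} (h_pos : ∀ n, 0 < h n)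
    (h_le : ∀ n, h n ≤ 1) :
    IsRun A (fun i q => f i q.2.1) h (fun n => semiLagrangian A f V₀ (h n)) where
  step _ _ _ _ := rfl
  speed_smooth := hA
  source_smooth i := (hf i).comp (by fun_prop)
  source_zero i _ := hf0 i
  init_smooth _ := hV₀
  h_pos := h_pos
  h_le := h_le

/-- The discretisations and their first derivatives at most double in a short time. -/
lemma exists_time_semiLagrangian_bound (hA : ∀ i, ContDiff ℝ ∞ (A i))
    (hf : ∀ i, ContDiff ℝ ∞ (f i)) (hf0 : ∀ i, f i 0 = 0) {M : ℝ} (hM : 0 ≤ M) {h : ℕ → ℝ}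
    (h_pos : ∀ n, 0 < h n) (h_le : ∀ n, h n ≤ 1) :
    ∃ T, 0 < T ∧ ∀ V₀ : ℝ → ι → ℝ, ContDiff ℝ ∞ V₀ → (∀ x, ‖V₀ x‖ ≤ M) →
      (∀ x, ‖deriv V₀ x‖ ≤ M) → ∀ p ∈ stepsBefore h T, ∀ x,
        ‖semiLagrangian A f V₀ (h p.1) p.2 x‖ ≤ 2 * M ∧
        ‖deriv (semiLagrangian A f V₀ (h p.1) p.2) x‖ ≤ 2 * M := by
  obtain ⟨K, hK0, -, hK, -⟩ := exists_uniform_bounds_on_ball hA (2 * M)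
  obtain ⟨L, hL0, -, hL, hL'⟩ := exists_uniform_bounds_on_ball hf (2 * M)
  set Λ := K * (2 * M) + L with hΛ
  have hΛ0 : 0 ≤ Λ := by positivity
  have hlog : 0 < Real.log 2 := Real.log_pos (by norm_num)
  refine ⟨Real.log 2 / (Λ + 1), by positivity, fun V₀ hV₀ h0 h1 => ?_⟩
  have hV := semiLagrangian_isRun (V₀ := V₀) hA hf hf0 hV₀ h_pos h_le
  have hexp : ∀ s : ℝ, s ≤ Real.log 2 / (Λ + 1) → M * Real.exp (Λ * s) ≤ 2 * M := by
    intro s hs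
    rw [le_div_iff₀ (by positivity)] at hs
    have : Λ * s ≤ Real.log 2 := by
      rcases le_total 0 s with h | h
      · nlinarith
      · nlinarith
    calc M * Real.exp (Λ * s) ≤ M * Real.exp (Real.log 2) := by gcongr
      _ = 2 * M := by rw [Real.exp_log (by norm_num)]; ring
  have growth : ∀ n j, (n, j) ∈ stepsBefore h (Real.log 2 / (Λ + 1)) → ∀ x,
      ‖semiLagrangian A f V₀ (h n) j x‖ ≤ M * Real.exp (Λ * (j * h n)) ∧
      ‖deriv (semiLagrangian A f V₀ (h n) j) x‖ ≤ M * Real.exp (Λ * (j * h n)) := by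
    intro n j
    induction j with
    | zero =>
      intro _ x
      simp only [Nat.cast_zero, zero_mul, mul_zero, Real.exp_zero, mul_one]
      exact ⟨h0 x, h1 x⟩
    | succ j ih =>
      intro hj x
      have hj' := mem_stepsBefore_of_succ hV.h_pos hj
      have hh := h_pos n
      replace ih := ih hj'
      have hN2 := hexp _ hj'
      dsimp only at hN2
      set N := M * Real.exp (Λ * (j * h n)) with hN
      have hN0 : 0 ≤ N := by positivity
      have hstep : N * (1 + Λ * h n) ≤ M * Real.exp (Λ * ((j + 1 : ℕ) * h n)) := by
        calc N * (1 + Λ * h n) ≤ N * Real.exp (Λ * h n) := by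
              gcongr; rw [add_comm]; exact Real.add_one_le_exp _
          _ = _ := by
            rw [hN, mul_assoc, ← Real.exp_add]
            push_cast
            ring_nf
      set v := semiLagrangian A f V₀ (h n) j with hv
      have hx2 : ‖v x‖ ≤ 2 * M := (ih x).1.trans hN2
      constructor
      · refine le_trans ?_ hstep
        rw [pi_norm_le_iff_of_nonneg (by positivity)]
        intro i
        have hfi : ‖f i (v x)‖ ≤ L * N := by
          have := hL' i (v x) 0 hx2 (by simpa using hM)
          rw [hf0, sub_zero, sub_zero] at this
          exact this.trans (by gcongr; exact (ih x).1)
        calc ‖semiLagrangian A f V₀ (h n) (j + 1) x i‖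
            = ‖v (x - h n * A i (v x)) i + h n * f i (v x)‖ := rfl
          _ ≤ N + h n * (L * N) := by
              refine (norm_add_le _ _).trans ?_
              rw [norm_mul, Real.norm_of_nonneg hh.le]
              gcongr
              exact (norm_le_pi_norm _ i).trans (ih _).1
          _ = N * (1 + L * h n) := by ring
          _ ≤ N * (1 + Λ * h n) := by
              gcongr
              rw [hΛ]; exact le_add_of_nonneg_left (by positivity)
      · refine le_trans ?_ hstep
        rw [pi_norm_le_iff_of_nonneg (by positivity)]
        intro i
        rw [hV.deriv_step n j x i, ← hv]
        set y := x - h n * A i (v x)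
        have hα : ‖fderiv ℝ (A i) (v x) (deriv v x)‖ ≤ K * (2 * M) :=
          (ContinuousLinearMap.le_opNorm _ _).trans
            (mul_le_mul (hK i _ hx2) ((ih x).2.trans hN2) (norm_nonneg _) hK0)
        have hFd : ∀ a b : ι → ℝ, fderiv ℝ (fun q : ℝ × (ι → ℝ) × (ι → ℝ) => f i q.2.1)
            (h n, v x, v y) (0, a, b) = fderiv ℝ (f i) (v x) a := by
          intro a b
          have h1 : HasFDerivAt (fun q : ℝ × (ι → ℝ) × (ι → ℝ) => f i q.2.1)
              ((fderiv ℝ (f i) (v x)).comp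
                ((ContinuousLinearMap.fst ℝ (ι → ℝ) (ι → ℝ)).comp
                  (ContinuousLinearMap.snd ℝ ℝ ((ι → ℝ) × (ι → ℝ))))) (h n, v x, v y) :=
            HasFDerivAt.comp (h n, v x, v y)
              (((hf i).differentiable (by simp) (v x)).hasFDerivAt)
              (ContinuousLinearMap.hasFDerivAt
                ((ContinuousLinearMap.fst ℝ (ι → ℝ) (ι → ℝ)).comp
                  (ContinuousLinearMap.snd ℝ ℝ ((ι → ℝ) × (ι → ℝ)))))
          rw [h1.fderiv]
          rfl
        rw [hFd]
        have hα1 : ‖1 - h n * fderiv ℝ (A i) (v x) (deriv v x)‖ ≤ 1 + h n * (K * (2 * M)) := by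
          refine (norm_sub_le _ _).trans ?_
          rw [norm_one, norm_mul, Real.norm_of_nonneg hh.le]
          gcongr
        calc _ ≤ (1 + h n * (K * (2 * M))) * N + h n * (L * N) := by
              refine (norm_add_le _ _).trans ?_
              rw [norm_smul, norm_smul, Real.norm_of_nonneg hh.le]
              gcongr
              · exact (norm_le_pi_norm _ i).trans (ih y).2
              · exact (ContinuousLinearMap.le_opNorm _ _).trans
                  (mul_le_mul (hL i _ hx2) (ih x).2 (norm_nonneg _) hL0)
          _ = N * (1 + Λ * h n) := by rw [hΛ]; ring
  exact fun p hp x => ⟨(growth p.1 p.2 hp x).1.trans (hexp _ hp),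
    (growth p.1 p.2 hp x).2.trans (hexp _ hp)⟩

end Run

lemma hasDerivWithinAt_of_norm_sub_le_sq {E : Type*} [NormedAddCommGroup E] [NormedSpace ℝ E]
    {f : ℝ → E} {d : E} {s : Set ℝ} {x C : ℝ}
    (h : ∀ y ∈ s, ‖f y - f x - (y - x) • d‖ ≤ C * (y - x) ^ 2) : HasDerivWithinAt f d s x := by
  rw [hasDerivWithinAt_iff_isLittleO]
  have h1 : (fun y => f y - f x - (y - x) • d) =O[𝓝[s] x] fun y => (y - x) ^ 2 :=
    Asymptotics.IsBigO.of_bound C (eventually_mem_nhdsWithin.mono fun y hy => by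
      rw [Real.norm_of_nonneg (sq_nonneg _)]; exact h y hy)
  refine h1.trans_isLittleO ?_
  have h2 : (fun y : ℝ => (y - x) ^ 2) =o[𝓝 x] fun y => y - x :=
    by simpa using Asymptotics.isLittleO_pow_sub_sub x one_lt_two
  exact h2.mono nhdsWithin_le_nhds

lemma norm_sub_sub_smul_le_sq {E : Type*} [NormedAddCommGroup E] [NormedSpace ℝ E]
    {g g' g'' : ℝ → E} (h1 : ∀ x, HasDerivAt g (g' x) x) (h2 : ∀ x, HasDerivAt g' (g'' x) x)
    {B : ℝ} (hB : ∀ x, ‖g'' x‖ ≤ B) (x y : ℝ) :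
    ‖g y - g x - (y - x) • g' x‖ ≤ B * (y - x) ^ 2 := by
  have hB0 : 0 ≤ B := (norm_nonneg _).trans (hB 0)
  have hlip : ∀ z, ‖g' z - g' x‖ ≤ B * ‖z - x‖ := fun z =>
    convex_univ.norm_image_sub_le_of_norm_hasDerivWithin_le
      (fun z _ => (h2 z).hasDerivWithinAt) (fun z _ => hB z) (mem_univ _) (mem_univ _)
  have hd : ∀ z, HasDerivAt (fun z => g z - z • g' x) (g' z - g' x) z := fun z => by
    have := (h1 z).sub ((hasDerivAt_id z).smul_const (g' x))
    rw [one_smul] at this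
    exact this
  have := (convex_uIcc x y).norm_image_sub_le_of_norm_hasDerivWithin_le
    (f := fun z => g z - z • g' x) (C := B * ‖y - x‖)
    (fun z _ => (hd z).hasDerivWithinAt) (fun z hz => (hlip z).trans (by
      gcongr
      rw [Real.norm_eq_abs, Real.norm_eq_abs]
      exact abs_sub_left_of_mem_uIcc hz)) left_mem_uIcc right_mem_uIcc
  calc _ = ‖g y - y • g' x - (g x - x • g' x)‖ := by congr 1; module
    _ ≤ _ := this
    _ = _ := by rw [mul_assoc, Real.norm_eq_abs, ← sq, sq_abs]

/-- A family of Schwartz functions, indexed by a time in `I`, bounded in the Schwartz space and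
jointly continuous together with all its spatial derivatives. -/
structure RegularOn {E : Type*} [NormedAddCommGroup E] [NormedSpace ℝ E] (I : Set ℝ)
    (U : ℝ → ℝ → E) : Prop where
  schwartz : SchwartzFamily I U
  jets : ∀ m, ContinuousOn (fun p : ℝ × ℝ => iteratedDeriv m (U p.1) p.2) (I ×ˢ univ)

namespace IsRun

variable {ι E : Type} [Fintype ι] [NormedAddCommGroup E] [NormedSpace ℝ E] [ProperSpace E]
  {A : ι → (ι → E) → ℝ} {F : ι → ℝ × (ι → E) × (ι → E) → E} {h : ℕ → ℝ}
  {V : ℕ → ℕ → ℝ → ι → E} {T : ℝ}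

/-- The time derivative prescribed by the system. -/
def velocity (A : ι → (ι → E) → ℝ) (F : ι → ℝ × (ι → E) × (ι → E) → E) (v d : ι → E) : ι → E :=
  fun i => -(A i v) • d i + F i (0, v, v)

omit [ProperSpace E] in
lemma velocity_smooth (hV : IsRun A F h V) :
    ContDiff ℝ ∞ (fun q : (ι → E) × (ι → E) => velocity A F q.1 q.2) := by
  rw [contDiff_pi]
  intro i
  have e1 : ContDiff ℝ ∞ (fun q : (ι → E) × (ι → E) => q.2 i) := by fun_prop
  exact (((hV.speed_smooth i).comp contDiff_fst).neg.smul e1).add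
    ((hV.source_smooth i).comp (contDiff_const.prodMk (contDiff_fst.prodMk contDiff_fst)))

lemma exists_lipschitz_in_time (hV : IsRun A F h V)
    (hS : SchwartzFamily (stepsBefore h T) (fun p => V p.1 p.2)) (m : ℕ) :
    ∃ C, 0 ≤ C ∧ ∀ n j k, (n, j + k) ∈ stepsBefore h T → ∀ x,
      ‖iteratedDeriv m (V n (j + k)) x - iteratedDeriv m (V n j) x‖ ≤ C * (k * h n) := by
  obtain ⟨C, hC0, hC⟩ := hV.exists_time_increment_bound hS m
  refine ⟨C, hC0, fun n j k => ?_⟩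
  induction k with
  | zero => intro _ x; simp
  | succ k ih =>
    intro hk x
    have hk' := mem_stepsBefore_of_succ hV.h_pos hk
    have h1 := hC n (j + k) hk' x
    have h2 := ih hk' x
    have h3 := norm_sub_le_norm_sub_add_norm_sub (iteratedDeriv m (V n (j + k + 1)) x)
      (iteratedDeriv m (V n (j + k)) x) (iteratedDeriv m (V n j) x)
    rw [← add_assoc]
    push_cast
    linarith

lemma exists_consistency_bound (hV : IsRun A F h V)
    (hS : SchwartzFamily (stepsBefore h T) (fun p => V p.1 p.2)) :
    ∃ C, 0 ≤ C ∧ ∀ n j, (n, j) ∈ stepsBefore h T → ∀ x,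
      ‖V n (j + 1) x - V n j x - h n • velocity A F (V n j x) (deriv (V n j) x)‖
        ≤ C * h n ^ 2 := by
  obtain ⟨B, hB⟩ := hS.bound 0
  obtain ⟨D, hD⟩ := hS.bound 1
  obtain ⟨D2, hD2⟩ := hS.bound 2
  simp only [iteratedDeriv_zero] at hB
  simp only [iteratedDeriv_one] at hD
  have hD2' : ∀ p ∈ stepsBefore h T, ∀ x, ‖deriv (deriv (V p.1 p.2)) x‖ ≤ max D2 0 := by
    intro p hp x
    have := hD2 p hp x
    rw [iteratedDeriv_succ', iteratedDeriv_one] at this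
    exact this.trans (le_max_left _ _)
  obtain ⟨K, hK0, hK, -, -⟩ := exists_uniform_bounds_on_ball hV.speed_smooth B
  obtain ⟨L, hL0, -, -, hL⟩ := exists_uniform_bounds_on_ball hV.source_smooth (max 1 B)
  set D' := max D 0
  set D2' := max D2 0
  have hD'0 : 0 ≤ D' := le_max_right _ _
  have hD2'0 : 0 ≤ D2' := le_max_right _ _
  refine ⟨D2' * K ^ 2 + L * (1 + D' * K), by positivity, fun n j hj x => ?_⟩
  have hh := hV.h_pos n
  rw [pi_norm_le_iff_of_nonneg (by positivity)]
  intro i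
  rw [Pi.sub_apply, Pi.sub_apply, Pi.smul_apply, hV.step n j x i, velocity]
  set y := x - h n * A i (V n j x) with hy
  have hyx' : y - x = -(h n * A i (V n j x)) := by rw [hy]; ring
  have hyx : ‖y - x‖ ≤ K * h n := by
    rw [hyx', norm_neg, norm_mul, Real.norm_of_nonneg hh.le, mul_comm]
    gcongr
    exact hK i _ (hB _ hj x)
  have h1 := norm_sub_sub_smul_le_sq ((hV.smooth n j).hasDerivAt_smooth)
    ((hV.smooth n j).deriv_smooth.hasDerivAt_smooth) (hD2' _ hj) x y
  have hxy : ‖V n j y - V n j x‖ ≤ D' * ‖y - x‖ :=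
    convex_univ.norm_image_sub_le_of_norm_deriv_le
      (fun z _ => (hV.smooth n j).differentiable (by simp) z)
      (fun z _ => (hD _ hj z).trans (le_max_left _ _)) (mem_univ _) (mem_univ _)
  have hbx : ‖V n j x‖ ≤ max 1 B := (hB _ hj x).trans (le_max_right _ _)
  have hby : ‖V n j y‖ ≤ max 1 B := (hB _ hj y).trans (le_max_right _ _)
  have hFF : ‖F i (h n, V n j x, V n j y) - F i (0, V n j x, V n j x)‖ ≤
      L * ((1 + D' * K) * h n) := by
    refine (hL i _ _ ?_ ?_).trans ?_
    · rw [Prod.norm_mk, Prod.norm_mk, Real.norm_of_nonneg hh.le]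
      exact max_le ((hV.h_le n).trans (le_max_left _ _)) (max_le hbx hby)
    · rw [Prod.norm_mk, Prod.norm_mk, norm_zero]
      exact max_le (zero_le_one.trans (le_max_left _ _)) (max_le hbx hbx)
    · gcongr
      simp only [Prod.mk_sub_mk, sub_self, sub_zero, Prod.norm_mk, norm_zero,
        Real.norm_of_nonneg hh.le]
      have : 0 ≤ D' * K * h n := by positivity
      refine max_le (by nlinarith) (max_le (by positivity) (hxy.trans ?_))
      nlinarith [mul_le_mul_of_nonneg_left hyx hD'0]
  have hsq : (y - x) ^ 2 ≤ K ^ 2 * h n ^ 2 := by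
    rw [← mul_pow, ← sq_abs, ← Real.norm_eq_abs]
    gcongr
  calc _ = ‖(V n j y - V n j x - (y - x) • deriv (V n j) x) i +
        h n • (F i (h n, V n j x, V n j y) - F i (0, V n j x, V n j x))‖ := by
        congr 1
        simp only [Pi.sub_apply, Pi.smul_apply, hyx']
        module
    _ ≤ D2' * (K ^ 2 * h n ^ 2) + h n * (L * ((1 + D' * K) * h n)) := by
        refine (norm_add_le _ _).trans ?_
        rw [norm_smul, Real.norm_of_nonneg hh.le]
        gcongr
        exact (norm_le_pi_norm _ i).trans (h1.trans (by gcongr))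
    _ = _ := by ring

lemma exists_taylor_in_time (hV : IsRun A F h V)
    (hS : SchwartzFamily (stepsBefore h T) (fun p => V p.1 p.2)) :
    ∃ C, 0 ≤ C ∧ ∀ n j k, (n, j + k) ∈ stepsBefore h T → ∀ x,
      ‖V n (j + k) x - V n j x - (k * h n) • velocity A F (V n j x) (deriv (V n j) x)‖
        ≤ C * (k * h n) ^ 2 := by
  obtain ⟨B, hB⟩ := hS.bound 0
  obtain ⟨D, hD⟩ := hS.bound 1
  obtain ⟨C₁, hC₁, h₁⟩ := hV.exists_consistency_bound hS
  obtain ⟨a, ha, h₂⟩ := hV.exists_lipschitz_in_time hS 0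
  obtain ⟨b, hb, h₃⟩ := hV.exists_lipschitz_in_time hS 1
  simp only [iteratedDeriv_zero] at hB h₂
  simp only [iteratedDeriv_one] at hD h₃
  obtain ⟨L, hL0, -, hL⟩ := exists_norm_le_mul_norm_of_contDiff hV.velocity_smooth (max B D)
  have hQ : ∀ n j k, (n, j + k) ∈ stepsBefore h T → ∀ x,
      ‖velocity A F (V n (j + k) x) (deriv (V n (j + k)) x) -
        velocity A F (V n j x) (deriv (V n j) x)‖ ≤ L * ((a + b) * (k * h n)) := by
    intro n j k hk x
    have hj : (n, j) ∈ stepsBefore h T := by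
      refine le_trans ?_ (show ((j + k : ℕ) : ℝ) * h n ≤ T from hk)
      have := (hV.h_pos n).le
      dsimp only
      gcongr
      exact Nat.le_add_right _ _
    have hkh : 0 ≤ k * h n := mul_nonneg (Nat.cast_nonneg _) (hV.h_pos n).le
    refine (hL (V n (j + k) x, deriv (V n (j + k)) x) (V n j x, deriv (V n j) x)
      (max_le_max (hB _ hk x) (hD _ hk x)) (max_le_max (hB _ hj x) (hD _ hj x))).trans ?_
    gcongr
    refine max_le ((h₂ n j k hk x).trans ?_) ((h₃ n j k hk x).trans ?_)
    · gcongr; exact le_add_of_nonneg_right hb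
    · gcongr; exact le_add_of_nonneg_left ha
  refine ⟨C₁ + L * (a + b), by positivity, fun n j k => ?_⟩
  induction k with
  | zero => intro _ x; simp
  | succ k ih =>
    intro hk x
    have hk' := mem_stepsBefore_of_succ hV.h_pos hk
    have hh := hV.h_pos n
    set Q := fun j => velocity A F (V n j x) (deriv (V n j) x)
    have i1 := ih hk' x
    have i2 := h₁ n (j + k) hk' x
    have i3 := hQ n j k hk' x
    rw [← add_assoc]
    calc _ = ‖(V n (j + k) x - V n j x - (k * h n) • Q j) +
          (V n (j + k + 1) x - V n (j + k) x - h n • Q (j + k)) +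
          h n • (Q (j + k) - Q j)‖ := by
          congr 1; push_cast; module
      _ ≤ (C₁ + L * (a + b)) * (k * h n) ^ 2 + C₁ * h n ^ 2 +
          h n * (L * ((a + b) * (k * h n))) := by
          refine (norm_add₃_le).trans ?_
          rw [norm_smul, Real.norm_of_nonneg hh.le]
          gcongr
      _ ≤ _ := by
          push_cast
          have : 0 ≤ (2 * C₁ * k + L * (a + b) * k + L * (a + b)) * h n ^ 2 := by positivity
          nlinarith

/-- The discretisations have a limit (along an ultrafilter), which solves the system. -/
theorem exists_limit (hV : IsRun A F h V)
    (hS : SchwartzFamily (stepsBefore h T) (fun p => V p.1 p.2)) (hh : Tendsto h atTop (𝓝 0))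
    {V₀ : ℝ → ι → E} (hV₀ : ∀ n, V n 0 = V₀) :
    ∃ U : ℝ → ℝ → ι → E, U 0 = V₀ ∧ RegularOn (Icc 0 T) U ∧
      (∀ t ∈ Icc 0 T, ∀ x, HasDerivWithinAt (fun s => U s x)
        (velocity A F (U t x) (deriv (U t) x)) (Icc 0 T) t) ∧
      (∀ m B, (∀ p ∈ stepsBefore h T, ∀ x, ‖iteratedDeriv m (V p.1 p.2) x‖ ≤ B) →
        ∀ t ∈ Icc 0 T, ∀ x, ‖iteratedDeriv m (U t) x‖ ≤ B) := by
  set l : Filter ℕ := ((hyperfilter ℕ : Ultrafilter ℕ) : Filter ℕ) with hl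
  have hl' : l ≤ atTop := Nat.hyperfilter_le_atTop
  have hhl : Tendsto h l (𝓝 0) := hh.mono_left hl'
  set idx : ℕ → ℝ → ℕ := fun n t => ⌊t / h n⌋₊ with hidx
  have idx_le : ∀ n t, 0 ≤ t → (idx n t : ℝ) * h n ≤ t := fun n t ht => by
    rw [← le_div_iff₀ (hV.h_pos n)]
    exact Nat.floor_le (div_nonneg ht (hV.h_pos n).le)
  have lt_idx : ∀ n t, t < (idx n t : ℝ) * h n + h n := fun n t => by
    have := Nat.lt_floor_add_one (t / h n)
    rw [div_lt_iff₀ (hV.h_pos n)] at this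
    linarith
  have idx_mem : ∀ n, ∀ t ∈ Icc 0 T, (n, idx n t) ∈ stepsBefore h T := fun n t ht =>
    (idx_le n t ht.1).trans ht.2
  have idx_tendsto : ∀ t, 0 ≤ t → Tendsto (fun n => (idx n t : ℝ) * h n) l (𝓝 t) := by
    intro t ht
    refine tendsto_of_tendsto_of_tendsto_of_le_of_le (g := fun n => t - h n) (h := fun _ => t)
      (by simpa using tendsto_const_nhds.sub hhl) tendsto_const_nhds (fun n => ?_)
      (fun n => idx_le n t ht)
    dsimp only
    linarith [lt_idx n t]
  have hex : ∀ m t x, ∃ v, t ∈ Icc 0 T →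
      Tendsto (fun n => iteratedDeriv m (V n (idx n t)) x) l (𝓝 v) := by
    intro m t x
    by_cases ht : t ∈ Icc 0 T
    · obtain ⟨B, hB⟩ := hS.bound m
      obtain ⟨v, -, hv⟩ := (isCompact_closedBall (0 : ι → E) B).ultrafilter_le_nhds
        ((hyperfilter ℕ).map fun n => iteratedDeriv m (V n (idx n t)) x) (by
          rw [le_principal_iff, Ultrafilter.mem_coe, Ultrafilter.mem_map]
          exact univ_mem' fun n => by simpa using hB (n, idx n t) (idx_mem n t ht) x)
      exact ⟨v, fun _ => hv⟩
    · exact ⟨0, fun h => absurd h ht⟩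
  choose L hL using hex
  have deriv_L : ∀ m, ∀ t ∈ Icc 0 T, ∀ x, HasDerivAt (L m t) (L (m + 1) t x) x := by
    intro m t ht x
    obtain ⟨B, hB⟩ := hS.bound (m + 2)
    rw [← hasDerivWithinAt_univ]
    refine hasDerivWithinAt_of_norm_sub_le_sq (C := B) fun y _ => ?_
    refine le_of_tendsto (((hL m t y ht).sub (hL m t x ht)).sub
      ((hL (m + 1) t x ht).const_smul (y - x))).norm (Eventually.of_forall fun n => ?_)
    have hd : ∀ m z, HasDerivAt (iteratedDeriv m (V n (idx n t)))
        (iteratedDeriv (m + 1) (V n (idx n t)) z) z := fun m z => by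
      rw [iteratedDeriv_succ]
      exact ((hV.smooth n _).differentiable_iteratedDeriv m
        (by exact_mod_cast WithTop.coe_lt_top _) z).hasDerivAt
    exact norm_sub_sub_smul_le_sq (hd m) (hd (m + 1))
      (fun z => hB (n, idx n t) (idx_mem n t ht) z) x y
  have iter_L : ∀ m, ∀ t ∈ Icc 0 T, iteratedDeriv m (L 0 t) = L m t := by
    intro m t ht
    induction m with
    | zero => simp
    | succ m ih =>
      rw [iteratedDeriv_succ, ih]
      exact funext fun x => (deriv_L m t ht x).deriv
  have split : ∀ n s t, s ≤ t → ∃ k, idx n t = idx n s + k := fun n s t hst =>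
    Nat.exists_eq_add_of_le (Nat.floor_mono (div_le_div_of_nonneg_right hst (hV.h_pos n).le))
  have lip_le : ∀ m, ∃ C, 0 ≤ C ∧ ∀ s ∈ Icc 0 T, ∀ t ∈ Icc 0 T, s ≤ t → ∀ x,
      ‖L m t x - L m s x‖ ≤ C * (t - s) := by
    intro m
    obtain ⟨C, hC0, hC⟩ := hV.exists_lipschitz_in_time hS m
    refine ⟨C, hC0, fun s hs t ht hst x => ?_⟩
    refine le_of_tendsto_of_tendsto ((hL m t x ht).sub (hL m s x hs)).norm
      (((idx_tendsto t ht.1).sub (idx_tendsto s hs.1)).const_mul C)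
      (Eventually.of_forall fun n => ?_)
    obtain ⟨k, hk⟩ := split n s t hst
    have := hC n (idx n s) k (hk ▸ idx_mem n t ht) x
    dsimp only
    rw [hk]
    refine this.trans_eq ?_
    push_cast
    ring
  have lip : ∀ m, ∃ C, 0 ≤ C ∧ ∀ s ∈ Icc 0 T, ∀ t ∈ Icc 0 T, ∀ x,
      ‖L m t x - L m s x‖ ≤ C * |t - s| := by
    intro m
    obtain ⟨C, hC0, hC⟩ := lip_le m
    refine ⟨C, hC0, fun s hs t ht x => ?_⟩
    rcases le_total s t with h | h
    · rw [abs_of_nonneg (sub_nonneg.2 h)]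
      exact hC s hs t ht h x
    · rw [abs_sub_comm, abs_of_nonneg (sub_nonneg.2 h), norm_sub_rev]
      exact hC t ht s hs h x
  have bd : ∀ m B, (∀ p ∈ stepsBefore h T, ∀ x, ‖iteratedDeriv m (V p.1 p.2) x‖ ≤ B) →
        ∀ t ∈ Icc 0 T, ∀ x, ‖L m t x‖ ≤ B := fun m B hB t ht x =>
    le_of_tendsto (hL m t x ht).norm
      (Eventually.of_forall fun n => hB (n, idx n t) (idx_mem n t ht) x)
  have zero_eq : 0 ≤ T → L 0 0 = V₀ := fun hT => by
    funext x
    refine tendsto_nhds_unique (hL 0 0 x ⟨le_rfl, hT⟩) ?_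
    simp [hidx, hV₀]
  have reg : RegularOn (Icc 0 T) (L 0) := by
    refine ⟨⟨fun t ht => ?_, fun k m => ?_⟩, fun m => ?_⟩
    · refine contDiff_of_differentiable_iteratedDeriv fun m _ => ?_
      rw [iter_L m t ht]
      exact fun x => (deriv_L m t ht x).differentiableAt
    · obtain ⟨C, hC⟩ := hS.decay k m
      refine ⟨C, fun t ht x => ?_⟩
      rw [iter_L m t ht]
      exact le_of_tendsto ((hL m t x ht).norm.const_mul _)
        (Eventually.of_forall fun n => hC (n, idx n t) (idx_mem n t ht) x)
    · obtain ⟨C, hC0, hC⟩ := lip m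
      obtain ⟨B, hB⟩ := hS.bound (m + 1)
      have hB' := bd (m + 1) B hB
      rintro ⟨t, x⟩ ⟨ht, -⟩
      have key : ∀ q ∈ Icc 0 T ×ˢ (univ : Set ℝ),
          ‖iteratedDeriv m (L 0 q.1) q.2 - iteratedDeriv m (L 0 t) x‖ ≤
            C * |q.1 - t| + B * |q.2 - x| := by
        rintro ⟨s, y⟩ ⟨hs, -⟩
        dsimp only at hs ⊢
        rw [iter_L m t ht, iter_L m s hs]
        refine (norm_sub_le_norm_sub_add_norm_sub _ (L m t y) _).trans
          (add_le_add (hC t ht s hs y) ?_)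
        exact convex_univ.norm_image_sub_le_of_norm_hasDerivWithin_le
          (fun z _ => (deriv_L m t ht z).hasDerivWithinAt) (fun z _ => hB' t ht z)
          (mem_univ _) (mem_univ _)
      have h0 : Tendsto (fun q : ℝ × ℝ => C * |q.1 - t| + B * |q.2 - x|)
          (𝓝[Icc 0 T ×ˢ univ] (t, x)) (𝓝 0) := by
        have : Continuous (fun q : ℝ × ℝ => C * |q.1 - t| + B * |q.2 - x|) := by fun_prop
        have h := this.tendsto (t, x)
        simp only [sub_self, abs_zero, mul_zero, add_zero] at h
        exact h.mono_left nhdsWithin_le_nhds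
      exact tendsto_iff_norm_sub_tendsto_zero.2 (squeeze_zero'
        (Eventually.of_forall fun _ => norm_nonneg _)
        (eventually_mem_nhdsWithin.mono key) h0)
  rcases lt_or_ge T 0 with hT | hT
  · have hemp : ∀ t, t ∉ Icc 0 T := fun t ht => by linarith [ht.1, ht.2]
    refine ⟨fun _ => V₀, rfl, ⟨⟨fun t ht => absurd ht (hemp t), fun k m => ⟨0, fun t ht =>
      absurd ht (hemp t)⟩⟩, fun m p hp => absurd hp.1 (hemp _)⟩, fun t ht => absurd ht (hemp t),
      fun _ _ _ t ht => absurd ht (hemp t)⟩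
  refine ⟨L 0, zero_eq hT, reg, ?_, fun m B hB t ht x => ?_⟩
  · obtain ⟨C, hC0, hC⟩ := hV.exists_taylor_in_time hS
    obtain ⟨B, hB⟩ := hS.bound 0
    obtain ⟨D, hD⟩ := hS.bound 1
    obtain ⟨a, ha, h₂⟩ := lip 0
    obtain ⟨b, hb, h₃⟩ := lip 1
    obtain ⟨K, hK0, -, hK⟩ := exists_norm_le_mul_norm_of_contDiff hV.velocity_smooth (max B D)
    set Q : ℝ → ℝ → ι → E := fun t x => velocity A F (L 0 t x) (L 1 t x) with hQ
    have hQc : Continuous (fun q : (ι → E) × (ι → E) => velocity A F q.1 q.2) :=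
      hV.velocity_smooth.continuous
    have forward : ∀ s ∈ Icc 0 T, ∀ t ∈ Icc 0 T, s ≤ t → ∀ x,
        ‖L 0 t x - L 0 s x - (t - s) • Q s x‖ ≤ C * (t - s) ^ 2 := by
      intro s hs t ht hst x
      have hd := (idx_tendsto t ht.1).sub (idx_tendsto s hs.1)
      have hQl := (hQc.tendsto (L 0 s x, L 1 s x)).comp
        ((hL 0 s x hs).prodMk_nhds (hL 1 s x hs))
      refine le_of_tendsto_of_tendsto
        (((hL 0 t x ht).sub (hL 0 s x hs)).sub (hd.smul hQl)).norm
        ((hd.pow 2).const_mul C) (Eventually.of_forall fun n => ?_)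
      obtain ⟨k, hk⟩ := split n s t hst
      have := hC n (idx n s) k (hk ▸ idx_mem n t ht) x
      simp only [iteratedDeriv_zero, iteratedDeriv_one, Function.comp_apply]
      rw [hk]
      have e : ((idx n s + k : ℕ) : ℝ) * h n - idx n s * h n = k * h n := by push_cast; ring
      rw [e]
      exact this
    have hQlip : ∀ s ∈ Icc 0 T, ∀ t ∈ Icc 0 T, ∀ x,
        ‖Q t x - Q s x‖ ≤ K * ((a + b) * |t - s|) := by
      intro s hs t ht x
      refine (hK (L 0 t x, L 1 t x) (L 0 s x, L 1 s x)
        (max_le_max (bd 0 B hB t ht x) (bd 1 D hD t ht x))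
        (max_le_max (bd 0 B hB s hs x) (bd 1 D hD s hs x))).trans ?_
      gcongr
      refine max_le ((h₂ s hs t ht x).trans ?_) ((h₃ s hs t ht x).trans ?_)
      · gcongr; exact le_add_of_nonneg_right hb
      · gcongr; exact le_add_of_nonneg_left ha
    intro t ht x
    have e : deriv (L 0 t) x = L 1 t x := (deriv_L 0 t ht x).deriv
    rw [e]
    refine hasDerivWithinAt_of_norm_sub_le_sq (C := C + K * (a + b)) fun s hs => ?_
    change ‖L 0 s x - L 0 t x - (s - t) • Q t x‖ ≤ _
    rcases le_total t s with hts | hst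
    · refine (forward t ht s hs hts x).trans ?_
      gcongr
      exact le_add_of_nonneg_right (by positivity)
    · have h1 := forward s hs t ht hst x
      have h2 := hQlip s hs t ht x
      rw [abs_of_nonneg (sub_nonneg.2 hst)] at h2
      calc _ = ‖-(L 0 t x - L 0 s x - (t - s) • Q s x) + (t - s) • (Q t x - Q s x)‖ := by
            congr 1; module
        _ ≤ C * (t - s) ^ 2 + (t - s) * (K * ((a + b) * (t - s))) := by
            refine (norm_add_le _ _).trans ?_
            rw [norm_neg, norm_smul, Real.norm_of_nonneg (sub_nonneg.2 hst)]
            have := sub_nonneg.2 hst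
            gcongr
        _ = _ := by ring
  · rw [iter_L m t ht]
    exact bd m B hB t ht x

end IsRun

/-- A classical solution of `∂ₜU = G(U, ∂ₓU)` on the time interval `I`. -/
structure IsSolutionOn {E : Type*} [NormedAddCommGroup E] [NormedSpace ℝ E] (G : E × E → E)
    (I : Set ℝ) (U : ℝ → ℝ → E) : Prop where
  regular : RegularOn I U
  eq : ∀ t ∈ I, ∀ x, HasDerivWithinAt (fun s => U s x) (G (U t x, deriv (U t) x)) I t

section Local

variable {ι : Type} [Fintype ι]

/-- The time derivative in the system `∂ₜVᵢ + Aᵢ(V) ∂ₓVᵢ = fᵢ(V)`. -/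
def diagonalVelocity (A f : ι → (ι → ℝ) → ℝ) (q : (ι → ℝ) × (ι → ℝ)) : ι → ℝ :=
  fun i => -(A i q.1) * q.2 i + f i q.1

/-- Local existence, with a lifespan depending only on the `C¹` norm of the data. -/
theorem exists_local_solution {A f : ι → (ι → ℝ) → ℝ} (hA : ∀ i, ContDiff ℝ ∞ (A i))
    (hf : ∀ i, ContDiff ℝ ∞ (f i)) (hf0 : ∀ i, f i 0 = 0) {M : ℝ} (hM : 0 ≤ M) :
    ∃ T, 0 < T ∧ ∀ V₀ : ℝ → ι → ℝ, SchwartzFamily univ (fun _ : ℕ => V₀) →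
      (∀ x, ‖V₀ x‖ ≤ M) → (∀ x, ‖deriv V₀ x‖ ≤ M) →
      ∃ U : ℝ → ℝ → ι → ℝ, U 0 = V₀ ∧ IsSolutionOn (diagonalVelocity A f) (Icc 0 T) U ∧
        ∀ t ∈ Icc 0 T, ∀ x, ‖U t x‖ ≤ 2 * M ∧ ‖deriv (U t) x‖ ≤ 2 * M := by
  set h : ℕ → ℝ := fun n => 1 / ((n : ℝ) + 1) with hh
  have h_pos : ∀ n, 0 < h n := fun n => Nat.one_div_pos_of_nat
  have h_le : ∀ n, h n ≤ 1 := fun n => by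
    rw [hh, div_le_one (by positivity)]
    exact le_add_of_nonneg_left (Nat.cast_nonneg _)
  have h_lim : Tendsto h atTop (𝓝 0) := tendsto_one_div_add_atTop_nhds_zero_nat
  obtain ⟨T, hT, hb⟩ := exists_time_semiLagrangian_bound hA hf hf0 hM h_pos h_le
  refine ⟨T, hT, fun V₀ hV₀ h0 h1 => ?_⟩
  have hsm : ContDiff ℝ ∞ V₀ := hV₀.smooth 0 (mem_univ _)
  have hV := semiLagrangian_isRun hA hf hf0 hsm h_pos h_le
  have hbb := hb V₀ hsm h0 h1
  obtain ⟨K, hK0, -, hK, -⟩ := exists_uniform_bounds_on_ball hA (2 * M)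
  have hS := hV.schwartzFamily (T := T) (B := 2 * M) (K := K * (2 * M))
    (fun p hp x => (hbb p hp x).1)
    (fun p hp x i => (ContinuousLinearMap.le_opNorm _ _).trans
      (mul_le_mul (hK i _ (hbb p hp x).1) (hbb p hp x).2 (norm_nonneg _) hK0)) hV₀
  obtain ⟨U, hU0, hUr, hUe, hUb⟩ := hV.exists_limit hS h_lim (V₀ := V₀) fun _ => rfl
  refine ⟨U, hU0, ⟨hUr, hUe⟩, fun t ht x => ⟨?_, ?_⟩⟩
  · simpa only [iteratedDeriv_zero] using hUb 0 (2 * M)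
      (fun p hp x => by simpa only [iteratedDeriv_zero] using (hbb p hp x).1) t ht x
  · simpa only [iteratedDeriv_one] using hUb 1 (2 * M)
      (fun p hp x => by simpa only [iteratedDeriv_one] using (hbb p hp x).2) t ht x

end Local

/-- Interchange of a time derivative and a space derivative. -/
lemma hasDerivAt_of_hasDerivAt_swap {E : Type*} [NormedAddCommGroup E] [NormedSpace ℝ E]
    {S R S' R' : ℝ → ℝ → E} {t x : ℝ}
    (hS : ∀ᶠ s in 𝓝 t, ∀ y, HasDerivAt (S s) (S' s y) y)
    (hR : ∀ᶠ s in 𝓝 t, ∀ y, HasDerivAt (R s) (R' s y) y)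
    (ht : ∀ᶠ s in 𝓝 t, ∀ y, HasDerivAt (fun r => S r y) (R s y) s)
    (hc : ContinuousAt (fun p : ℝ × ℝ => R' p.1 p.2) (t, x)) :
    HasDerivAt (fun s => S' s x) (R' t x) t := by
  rw [hasDerivAt_iff_isLittleO, Asymptotics.isLittleO_iff]
  intro ε hε
  obtain ⟨δ, hδ, hball⟩ := Metric.continuousAt_iff.1 hc ε hε
  obtain ⟨δ', hδ', hall⟩ := Metric.eventually_nhds_iff_ball.1 (hS.and (hR.and ht))
  set r := min δ δ' with hr
  have hr0 : 0 < r := lt_min hδ hδ'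
  have hR'ε : ∀ s ∈ Metric.ball t r, ∀ z ∈ Metric.ball x r, ‖R' s z - R' t x‖ ≤ ε := by
    intro s hs z hz
    rw [← dist_eq_norm]
    refine (hball (x := (s, z)) ?_).le
    rw [Prod.dist_eq]
    exact max_lt (hs.out.trans_le (min_le_left _ _)) (hz.out.trans_le (min_le_left _ _))
  have hin : ∀ s ∈ Metric.ball t r, s ∈ Metric.ball t δ' := fun s hs =>
    hs.out.trans_le (min_le_right _ _)
  have key1 : ∀ s ∈ Metric.ball t r, ∀ y ∈ Metric.ball x r,
      ‖R s y - R s x - (y - x) • R' t x‖ ≤ ε * ‖y - x‖ := by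
    intro s hs y hy
    have hd : ∀ z, HasDerivAt (fun z => R s z - z • R' t x) (R' s z - R' t x) z := fun z => by
      have := ((hall s (hin s hs)).2.1 z).sub ((hasDerivAt_id z).smul_const (R' t x))
      rw [one_smul] at this
      exact this
    have := (convex_ball x r).norm_image_sub_le_of_norm_hasDerivWithin_le
      (fun z _ => (hd z).hasDerivWithinAt) (fun z hz => hR'ε s hs z hz)
      (Metric.mem_ball_self hr0) hy
    refine le_trans (le_of_eq ?_) this
    congr 1
    module
  have key2 : ∀ s ∈ Metric.ball t r, ∀ y ∈ Metric.ball x r,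
      ‖(S s y - S s x) - (S t y - S t x) - ((s - t) * (y - x)) • R' t x‖ ≤
        ε * ‖y - x‖ * ‖s - t‖ := by
    intro s hs y hy
    have hd : ∀ q ∈ Metric.ball t r, HasDerivAt
        (fun q => S q y - S q x - q • ((y - x) • R' t x))
        (R q y - R q x - (y - x) • R' t x) q := fun q hq => by
      have := (((hall q (hin q hq)).2.2 y).sub ((hall q (hin q hq)).2.2 x)).sub
        ((hasDerivAt_id q).smul_const ((y - x) • R' t x))
      rw [one_smul] at this
      exact this
    have := (convex_ball t r).norm_image_sub_le_of_norm_hasDerivWithin_le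
      (fun q hq => (hd q hq).hasDerivWithinAt) (fun q hq => key1 q hq y hy)
      (Metric.mem_ball_self hr0) hs
    refine le_trans (le_of_eq ?_) this
    congr 1
    module
  filter_upwards [Metric.ball_mem_nhds t hr0] with s hs
  have hl : ∀ q ∈ Metric.ball t r, Tendsto (fun y => (y - x)⁻¹ • (S q y - S q x)) (𝓝[≠] x)
      (𝓝 (S' q x)) := fun q hq =>
    hasDerivAt_iff_tendsto_slope.1 ((hall q (hin q hq)).1 x)
  refine le_of_tendsto (((hl s hs).sub (hl t (Metric.mem_ball_self hr0))).sub
    (tendsto_const_nhds (x := (s - t) • R' t x))).norm ?_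
  filter_upwards [self_mem_nhdsWithin, mem_nhdsWithin_of_mem_nhds (Metric.ball_mem_nhds x hr0)]
    with y hne hy
  have hyx : y - x ≠ 0 := sub_ne_zero.2 hne
  have e : (y - x)⁻¹ • (S s y - S s x) - (y - x)⁻¹ • (S t y - S t x) - (s - t) • R' t x =
      (y - x)⁻¹ • ((S s y - S s x) - (S t y - S t x) - ((s - t) * (y - x)) • R' t x) := by
    rw [smul_sub _ _ (((s - t) * (y - x)) • R' t x), smul_smul, ← smul_sub]
    congr 2
    field_simp
  rw [e, norm_smul, norm_inv]
  have hpos : 0 < ‖y - x‖ := norm_pos_iff.2 hyx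
  rw [inv_mul_le_iff₀ hpos]
  exact (key2 s hs y hy).trans_eq (by ring)

lemma iteratedDeriv_prodMk_smooth {E F : Type*} [NormedAddCommGroup E] [NormedSpace ℝ E]
    [NormedAddCommGroup F] [NormedSpace ℝ F] {f : ℝ → E} {g : ℝ → F} (hf : ContDiff ℝ ∞ f)
    (hg : ContDiff ℝ ∞ g) (m : ℕ) :
    iteratedDeriv m (fun x => (f x, g x)) =
      fun x => (iteratedDeriv m f x, iteratedDeriv m g x) := by
  induction m with
  | zero => simp
  | succ m ih =>
    rw [iteratedDeriv_succ, ih]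
    ext1 x
    have h1 := hf.differentiable_iteratedDeriv m (by exact_mod_cast WithTop.coe_lt_top _) x
    have h2 := hg.differentiable_iteratedDeriv m (by exact_mod_cast WithTop.coe_lt_top _) x
    rw [iteratedDeriv_succ, iteratedDeriv_succ]
    exact (h1.hasDerivAt.prodMk h2.hasDerivAt).deriv

/-- A solution of a first-order evolution equation with continuous spatial jets is smooth in space
and time. -/
theorem contDiff_of_evolution {E : Type} [NormedAddCommGroup E] [NormedSpace ℝ E]
    {S : ℝ → ℝ → E} (hs : ∀ t, ContDiff ℝ ∞ (S t))
    (hj : ∀ m, Continuous (fun p : ℝ × ℝ => iteratedDeriv m (S p.1) p.2))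
    {H : ℝ × E × E → E} (hH : ContDiff ℝ ∞ H)
    (ht : ∀ t x, HasDerivAt (fun s => S s x) (H (t, S t x, deriv (S t) x)) t) :
    ContDiff ℝ ∞ (fun p : ℝ × ℝ => S p.1 p.2) := by
  rw [contDiff_infty]
  intro k
  induction k generalizing E with
  | zero =>
    have := hj 0
    simp only [iteratedDeriv_zero] at this
    exact contDiff_zero.2 this
  | succ k ih =>
    set S' : ℝ → ℝ → E × E := fun t x => (S t x, deriv (S t) x)
    set H' : ℝ × (E × E) × (E × E) → E × E := fun q =>
      (H (q.1, q.2.1.1, q.2.1.2), fderiv ℝ H (q.1, q.2.1.1, q.2.1.2) (0, q.2.1.2, q.2.2.2))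
    have hd : ∀ t x, HasDerivAt (S t) (deriv (S t) x) x := fun t => (hs t).hasDerivAt_smooth
    have hdd : ∀ t x, HasDerivAt (deriv (S t)) (deriv (deriv (S t)) x) x := fun t =>
      (hs t).deriv_smooth.hasDerivAt_smooth
    have c0 : Continuous fun p : ℝ × ℝ => S p.1 p.2 := by simpa only [iteratedDeriv_zero] using hj 0
    have c1 : Continuous fun p : ℝ × ℝ => deriv (S p.1) p.2 := by
      simpa only [iteratedDeriv_one] using hj 1
    have c2 : Continuous fun p : ℝ × ℝ => deriv (deriv (S p.1)) p.2 := by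
      simpa only [iteratedDeriv_succ', iteratedDeriv_zero] using hj 2
    have hS' : ContDiff ℝ k (fun p : ℝ × ℝ => S' p.1 p.2) := by
      refine ih (H := H') (fun t => (hs t).prodMk (hs t).deriv_smooth) (fun m => ?_) ?_
        fun t x => ?_
      · have e : ∀ t, iteratedDeriv m (S' t) =
            fun x => (iteratedDeriv m (S t) x, iteratedDeriv (m + 1) (S t) x) := fun t => by
          rw [iteratedDeriv_succ']
          exact iteratedDeriv_prodMk_smooth (hs t) (hs t).deriv_smooth m
        simp only [e]
        exact (hj m).prodMk (hj (m + 1))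
      · have e1 : ContDiff ℝ ∞ (fun q : ℝ × (E × E) × (E × E) => (q.1, q.2.1.1, q.2.1.2)) := by
          fun_prop
        have e2 : ContDiff ℝ ∞
            (fun q : ℝ × (E × E) × (E × E) => ((0, q.2.1.2, q.2.2.2) : ℝ × E × E)) := by
          fun_prop
        exact (hH.comp e1).prodMk (((hH.fderiv_right (m := ∞) (by simp)).comp e1).clm_apply e2)
      · have e : deriv (S' t) x = (deriv (S t) x, deriv (deriv (S t)) x) :=
          ((hd t x).prodMk (hdd t x)).deriv
        rw [e]
        refine (ht t x).prodMk ?_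
        refine hasDerivAt_of_hasDerivAt_swap
          (R := fun t x => H (t, S t x, deriv (S t) x)) (S := S)
          (R' := fun t x => fderiv ℝ H (t, S t x, deriv (S t) x)
            (0, deriv (S t) x, deriv (deriv (S t)) x))
          (Eventually.of_forall hd) (Eventually.of_forall fun s y => ?_) (Eventually.of_forall ht)
          ?_
        · exact (hH.differentiable (by simp) _).hasFDerivAt.comp_hasDerivAt y
            ((hasDerivAt_const y s).prodMk ((hd s y).prodMk (hdd s y)))
        · refine Continuous.continuousAt ?_
          have e1 : Continuous fun p : ℝ × ℝ => (p.1, S p.1 p.2, deriv (S p.1) p.2) :=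
            continuous_fst.prodMk (c0.prodMk c1)
          exact ((hH.continuous_fderiv (by simp)).comp e1).clm_apply
            (continuous_const.prodMk (c1.prodMk c2))
    have hS0 : ContDiff ℝ k (fun p : ℝ × ℝ => S p.1 p.2) := hS'.fst
    have hS1 : ContDiff ℝ k (fun p : ℝ × ℝ => deriv (S p.1) p.2) := hS'.snd
    have hHk : ContDiff ℝ k (fun p : ℝ × ℝ => H (p.1, S p.1 p.2, deriv (S p.1) p.2)) :=
      (hH.of_le (by exact_mod_cast le_top)).comp (contDiff_fst.prodMk (hS0.prodMk hS1))
    push_cast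
    refine contDiff_succ_iff_hasFDerivAt.2 ⟨fun p =>
      ((1 : ℝ →L[ℝ] ℝ).smulRight (H (p.1, S p.1 p.2, deriv (S p.1) p.2))).coprod
      ((1 : ℝ →L[ℝ] ℝ).smulRight (deriv (S p.1) p.2)), ?_, fun p => ?_⟩
    · have e : (fun p : ℝ × ℝ =>
          ((1 : ℝ →L[ℝ] ℝ).smulRight (H (p.1, S p.1 p.2, deriv (S p.1) p.2))).coprod
          ((1 : ℝ →L[ℝ] ℝ).smulRight (deriv (S p.1) p.2))) = fun p : ℝ × ℝ =>
          (ContinuousLinearMap.fst ℝ ℝ ℝ).smulRight (H (p.1, S p.1 p.2, deriv (S p.1) p.2)) +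
          (ContinuousLinearMap.snd ℝ ℝ ℝ).smulRight (deriv (S p.1) p.2) := by
        ext p <;> simp
      rw [e]
      exact (contDiff_const.smulRight hHk).add (contDiff_const.smulRight hS1)
    · refine (hasStrictFDerivAt_uncurry_coprod (f := S)
        (f₁ := fun t x => (1 : ℝ →L[ℝ] ℝ).smulRight (H (t, S t x, deriv (S t) x)))
        (f₂ := fun t x => (1 : ℝ →L[ℝ] ℝ).smulRight (deriv (S t) x))
        (Eventually.of_forall fun v => ?_) (Eventually.of_forall fun v => ?_) ?_ ?_).hasFDerivAt
      · exact (ht v.1 v.2).hasFDerivAt.congr_fderiv (by ext; simp [Function.HasUncurry.uncurry])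
      · exact (hd v.1 v.2).hasFDerivAt.congr_fderiv (by ext; simp [Function.HasUncurry.uncurry])
      · exact (contDiff_const.smulRight hHk).continuous.continuousAt
      · exact (contDiff_const.smulRight hS1).continuous.continuousAt

namespace IsSolutionOn

variable {E : Type} [NormedAddCommGroup E] [NormedSpace ℝ E] {G : E × E → E} {I : Set ℝ}
  {U : ℝ → ℝ → E}

lemma congr (hU : IsSolutionOn G I U) {W : ℝ → ℝ → E} (h : ∀ t ∈ I, W t = U t) :
    IsSolutionOn G I W where
  regular := ⟨hU.regular.schwartz.congr h, fun m => (hU.regular.jets m).congr fun p hp => by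
    dsimp only; rw [h p.1 hp.1]⟩
  eq t ht x := by
    rw [h t ht]
    exact (hU.eq t ht x).congr (fun s hs => by rw [h s hs]) (by rw [h t ht])

lemma mono (hU : IsSolutionOn G I U) {J : Set ℝ} (h : J ⊆ I) : IsSolutionOn G J U where
  regular := ⟨hU.regular.schwartz.mono h, fun m => (hU.regular.jets m).mono
    (prod_mono h subset_rfl)⟩
  eq t ht x := (hU.eq t (h ht) x).mono h

/-- Affine changes of time. -/
lemma comp_affine (hU : IsSolutionOn G I U) {J : Set ℝ} {c d : ℝ}
    (h : ∀ t ∈ J, c * t + d ∈ I) :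
    IsSolutionOn (fun q => c • G q) J (fun t => U (c * t + d)) where
  regular := ⟨hU.regular.schwartz.comp_index h, fun m =>
    (hU.regular.jets m).comp (f := fun p : ℝ × ℝ => (c * p.1 + d, p.2))
      (Continuous.continuousOn (by fun_prop)) fun p hp => ⟨h p.1 hp.1, mem_univ _⟩⟩
  eq t ht x := by
    have h1 : HasDerivWithinAt (fun t => c * t + d) c J t := by
      simpa using (((hasDerivAt_id t).const_mul c).add_const d).hasDerivWithinAt
    exact (hU.eq _ (h t ht) x).scomp t h1 h

lemma glue {a b c : ℝ} (h1 : IsSolutionOn G (Icc a b) U) (h2 : IsSolutionOn G (Icc b c) U) :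
    IsSolutionOn G (Icc a c) U := by
  have key : IsSolutionOn G (Icc a b ∪ Icc b c) U := by
    refine ⟨⟨h1.regular.schwartz.union h2.regular.schwartz, fun m => ?_⟩, fun t ht x => ?_⟩
    · rw [union_prod]
      exact (h1.regular.jets m).union_of_isClosed (h2.regular.jets m)
        (isClosed_Icc.prod isClosed_univ) (isClosed_Icc.prod isClosed_univ)
    · refine HasDerivWithinAt.union ?_ ?_
      · by_cases h : t ∈ Icc a b
        · exact h1.eq t h x
        · refine HasFDerivWithinAt.of_notMem_closure ?_
          rw [isClosed_Icc.closure_eq]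
          exact h
      · by_cases h : t ∈ Icc b c
        · exact h2.eq t h x
        · refine HasFDerivWithinAt.of_notMem_closure ?_
          rw [isClosed_Icc.closure_eq]
          exact h
  exact key.mono fun t ht => (le_total t b).elim (fun h => Or.inl ⟨ht.1, h⟩)
    fun h => Or.inr ⟨h, ht.2⟩

end IsSolutionOn

/-- Continuation: if every state in `𝒮` can be evolved for a fixed time within the constraint `Q`,
ending in `𝒮`, then it can be evolved forever. -/
theorem exists_global_solution {E : Type} [NormedAddCommGroup E] [NormedSpace ℝ E]
    {G : E × E → E} {T T' : ℝ} (hT : 0 < T) {𝒮 : Set (ℝ → E)}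
    {Q : (ℝ → E) → Prop}
    (fwd : ∀ V ∈ 𝒮, ∃ U : ℝ → ℝ → E, U 0 = V ∧ IsSolutionOn G (Icc 0 T) U ∧ U T ∈ 𝒮 ∧
      ∀ t ∈ Icc 0 T, Q (U t)) {V₀ : ℝ → E} (hV₀ : V₀ ∈ 𝒮)
    (bwd : ∃ U : ℝ → ℝ → E, U 0 = V₀ ∧ IsSolutionOn G (Icc (-T') 0) U) :
    ∃ U : ℝ → ℝ → E, U 0 = V₀ ∧ (∀ b, IsSolutionOn G (Icc (-T') b) U) ∧
      ∀ t, 0 ≤ t → Q (U t) := by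
  choose! sol sol0 solEq solT solQ using fwd
  obtain ⟨B, hB0, hB⟩ := bwd
  let S : ℕ → ℝ → E := fun k => Nat.rec V₀ (fun _ V => sol V T) k
  have hS : ∀ k, S k ∈ 𝒮 := fun k => by
    induction k with
    | zero => exact hV₀
    | succ k ih => exact solT _ ih
  have hSs : ∀ k, S (k + 1) = sol (S k) T := fun k => rfl
  set U : ℝ → ℝ → E := fun t =>
    if t < 0 then B t else sol (S ⌊t / T⌋₊) (t - ⌊t / T⌋₊ * T) with hU
  have hUk : ∀ k : ℕ, ∀ t ∈ Icc (k * T) ((k + 1 : ℕ) * T), U t = sol (S k) (t - k * T) := by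
    intro k t ht
    have ht0 : 0 ≤ t := le_trans (by positivity) ht.1
    simp only [hU, if_neg (not_lt.2 ht0)]
    rcases ht.2.lt_or_eq with h | h
    · have : ⌊t / T⌋₊ = k := by
        rw [Nat.floor_eq_iff (by positivity), le_div_iff₀ hT, div_lt_iff₀ hT]
        exact ⟨ht.1, by push_cast at h; exact h⟩
      rw [this]
    · have : ⌊t / T⌋₊ = k + 1 := by
        rw [h, mul_div_assoc, div_self hT.ne', mul_one, Nat.floor_natCast]
      rw [this, h, sub_self, sol0 _ (hS (k + 1)), hSs]
      congr 1
      push_cast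
      ring
  have hU0 : U 0 = V₀ := by
    have := hUk 0 0 ⟨by simp, by push_cast; linarith⟩
    rw [this, show S 0 = V₀ from rfl]
    simpa using sol0 V₀ hV₀
  have hpiece : ∀ k : ℕ, IsSolutionOn G (Icc (k * T) ((k + 1 : ℕ) * T)) U := by
    intro k
    have h1 := (solEq _ (hS k)).comp_affine (J := Icc (k * T) ((k + 1 : ℕ) * T)) (c := 1)
      (d := -(k * T)) (fun t ht => by
        have h1 := ht.1
        have h2 := ht.2
        push_cast at h2
        constructor <;> linarith)
    simp only [one_smul] at h1
    refine h1.congr fun t ht => ?_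
    rw [hUk k t ht]
    congr 1
    ring
  have hneg : IsSolutionOn G (Icc (-T') 0) U := hB.congr fun t ht => by
    rcases ht.2.lt_or_eq with h | h
    · simp only [hU, if_pos h]
    · rw [h, hU0, hB0]
  have hall : ∀ k : ℕ, IsSolutionOn G (Icc (-T') (k * T)) U := by
    intro k
    induction k with
    | zero => simpa using hneg
    | succ k ih => exact ih.glue (hpiece k)
  refine ⟨U, hU0, fun b => ?_, fun t ht => ?_⟩
  · obtain ⟨k, hk⟩ := exists_nat_ge (b / T)
    rw [div_le_iff₀ hT] at hk
    exact (hall k).mono (Icc_subset_Icc_right hk)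
  · have h1 := Nat.floor_le (div_nonneg ht hT.le)
    have h2 := (Nat.lt_floor_add_one (t / T)).le
    rw [le_div_iff₀ hT] at h1
    rw [div_le_iff₀ hT] at h2
    rw [hUk ⌊t / T⌋₊ t ⟨h1, by push_cast; exact h2⟩]
    exact solQ _ (hS _) _ ⟨by linarith, by linarith⟩

/-- A smooth change of time which is the identity on `[0,∞)` and stays above a negative bound. -/
lemma exists_smooth_time_change {T' : ℝ} (hT' : 0 < T') :
    ∃ θ : ℝ → ℝ, ContDiff ℝ ∞ θ ∧ (∀ t, 0 ≤ t → θ t = t) ∧ (∀ t, -T' < θ t) ∧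
      ∀ t, 0 ≤ t → deriv θ t = 1 := by
  have hsm : ContDiff ℝ ∞ (fun t : ℝ => t * Real.smoothTransition (1 + t / T')) :=
    contDiff_id.mul (Real.smoothTransition.contDiff.comp (by fun_prop))
  have hid : ∀ t, 0 ≤ t → t * Real.smoothTransition (1 + t / T') = t := fun t ht => by
    rw [Real.smoothTransition.one_of_one_le (by
      have := div_nonneg ht hT'.le
      linarith), mul_one]
  refine ⟨_, hsm, hid, fun t => ?_, fun t ht => ?_⟩
  · have h0 := Real.smoothTransition.nonneg (1 + t / T')
    have h1 := Real.smoothTransition.le_one (1 + t / T')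
    rcases le_or_gt t (-T') with h | h
    · rw [Real.smoothTransition.zero_of_nonpos, mul_zero]
      · linarith
      · have : t / T' ≤ -1 := by rw [div_le_iff₀ hT']; linarith
        linarith
    · rcases le_total 0 t with h' | h'
      · have := mul_nonneg h' h0
        linarith
      · nlinarith
  · have h1 := (hsm.hasDerivAt_smooth t).hasDerivWithinAt (s := Ici t)
    have h2 : HasDerivWithinAt (fun t : ℝ => t * Real.smoothTransition (1 + t / T')) 1 (Ici t) t :=
      (hasDerivWithinAt_id t _).congr (fun s hs => hid s (ht.trans hs)) (hid t ht)
    exact (uniqueDiffWithinAt_Ici t).eq_deriv _ h1 h2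

/-- A solution defined slightly before time `0` coincides for nonnegative times with a function
which is smooth on the whole plane. -/
theorem exists_smooth_extension {E : Type} [NormedAddCommGroup E] [NormedSpace ℝ E]
    {G : E × E → E} (hG : ContDiff ℝ ∞ G) {T' : ℝ} (hT' : 0 < T') {U : ℝ → ℝ → E}
    (hU : ∀ b, IsSolutionOn G (Icc (-T') b) U) :
    ∃ S : ℝ → ℝ → E, ContDiff ℝ ∞ (fun p : ℝ × ℝ => S p.1 p.2) ∧ (∀ t, 0 ≤ t → S t = U t) ∧
      ∀ t x, 0 ≤ t → HasDerivAt (fun s => S s x) (G (U t x, deriv (U t) x)) t := by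
  obtain ⟨θ, hθ, hid, hθT, hθ1⟩ := exists_smooth_time_change hT'
  have hmem : ∀ t, Icc (-T') (θ t + 1) ∈ 𝓝 (θ t) := fun t =>
    Icc_mem_nhds (hθT t) (by linarith)
  have hder : ∀ t x, HasDerivAt (fun s => U (θ s) x)
      (deriv θ t • G (U (θ t) x, deriv (U (θ t)) x)) t := fun t x =>
    (((hU (θ t + 1)).eq (θ t) (mem_of_mem_nhds (hmem t)) x).hasDerivAt (hmem t)).scomp t
      (hθ.hasDerivAt_smooth t)
  refine ⟨fun t => U (θ t), ?_, fun t ht => congrArg U (hid t ht), fun t x ht => ?_⟩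
  · refine contDiff_of_evolution (H := fun q => deriv θ q.1 • G (q.2.1, q.2.2))
      (fun t => (hU (θ t + 1)).regular.schwartz.smooth _ (mem_of_mem_nhds (hmem t)))
      (fun m => ?_) ?_ hder
    · rw [continuous_iff_continuousAt]
      rintro ⟨t, x⟩
      have h1 : ContinuousAt (fun p : ℝ × ℝ => iteratedDeriv m (U p.1) p.2) (θ t, x) :=
        ((hU (θ t + 1)).regular.jets m).continuousAt (prod_mem_nhds (hmem t) univ_mem)
      exact ContinuousAt.comp (f := fun p : ℝ × ℝ => (θ p.1, p.2)) (x := (t, x)) h1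
        ((hθ.continuous.comp continuous_fst).prodMk continuous_snd).continuousAt
    · exact (hθ.deriv_smooth.comp contDiff_fst).smul
        (hG.comp (contDiff_snd.fst.prodMk contDiff_snd.snd))
  · simpa [hθ1 t ht, hid t ht] using hder t x

namespace SchwartzFamily

variable {τ : Type*} {s : Set τ} {e : τ → ℝ → ℝ}

lemma exists_domination (he : SchwartzFamily s e) :
    ∃ C, ∀ t ∈ s, ∀ x, ‖e t x‖ ≤ C * (1 + x ^ 2)⁻¹ := by
  obtain ⟨C, hC⟩ := he.decay 2 0
  simp only [iteratedDeriv_zero] at hC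
  refine ⟨C, fun t ht x => ?_⟩
  rw [← div_eq_mul_inv, le_div_iff₀ (by positivity), mul_comm]
  refine le_trans ?_ (hC t ht x)
  gcongr
  rw [← sq_abs x]
  nlinarith [abs_nonneg x]

lemma continuous (he : SchwartzFamily s e) {t : τ} (ht : t ∈ s) : Continuous (e t) :=
  (he.smooth t ht).continuous

lemma integrable (he : SchwartzFamily s e) {t : τ} (ht : t ∈ s) : Integrable (e t) := by
  obtain ⟨C, hC⟩ := he.exists_domination
  exact (integrable_inv_one_add_sq.const_mul C).mono' (he.continuous ht).aestronglyMeasurable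
    (ae_of_all _ (hC t ht))

lemma integral_deriv_eq_zero (he : SchwartzFamily s e) {t : τ} (ht : t ∈ s) :
    ∫ x, _root_.deriv (e t) x = 0 :=
  integral_eq_zero_of_hasDerivAt_of_integrable ((he.smooth t ht).hasDerivAt_smooth)
    (he.deriv.integrable ht) (he.integrable ht)

lemma integral_le_of_flux {j d : τ → ℝ → ℝ} (he : SchwartzFamily s e) (hj : SchwartzFamily s j)
    (hd : SchwartzFamily s d) {t : τ} (ht : t ∈ s)
    (h : ∀ x, e t x ≤ _root_.deriv (j t) x + d t x) : ∫ x, e t x ≤ ∫ x, d t x := by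
  calc ∫ x, e t x ≤ ∫ x, (_root_.deriv (j t) x + d t x) :=
        integral_mono (he.integrable ht) ((hj.deriv.integrable ht).add (hd.integrable ht)) h
    _ = ∫ x, d t x := by
        rw [integral_add (hj.deriv.integrable ht) (hd.integrable ht),
          hj.integral_deriv_eq_zero ht, zero_add]

lemma integral_hasDerivAt {a b : ℝ} {e e' : ℝ → ℝ → ℝ} (he : SchwartzFamily (Icc a b) e)
    (he' : SchwartzFamily (Icc a b) e')
    (hd : ∀ t ∈ Ioo a b, ∀ x, HasDerivAt (fun s => e s x) (e' t x) t) {t : ℝ}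
    (ht : t ∈ Ioo a b) : HasDerivAt (fun s => ∫ x, e s x) (∫ x, e' t x) t := by
  obtain ⟨C, hC⟩ := he'.exists_domination
  have hn : Ioo a b ∈ 𝓝 t := Ioo_mem_nhds ht.1 ht.2
  refine (hasDerivAt_integral_of_dominated_loc_of_deriv_le (F := fun s x => e s x)
    (F' := fun s x => e' s x) (bound := fun x => C * (1 + x ^ 2)⁻¹) hn ?_
    (he.integrable (Ioo_subset_Icc_self ht))
    (he'.continuous (Ioo_subset_Icc_self ht)).aestronglyMeasurable
    (ae_of_all _ fun x s hs => hC s (Ioo_subset_Icc_self hs) x)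
    (integrable_inv_one_add_sq.const_mul C) (ae_of_all _ fun x s hs => hd s hs x)).2
  filter_upwards [hn] with s hs
  exact (he.continuous (Ioo_subset_Icc_self hs)).aestronglyMeasurable

lemma integral_continuousOn {a b : ℝ} {e : ℝ → ℝ → ℝ} (he : SchwartzFamily (Icc a b) e)
    (hc : ∀ x, ContinuousOn (fun s => e s x) (Icc a b)) :
    ContinuousOn (fun s => ∫ x, e s x) (Icc a b) := by
  obtain ⟨C, hC⟩ := he.exists_domination
  exact continuousOn_of_dominated
    (fun s hs => (he.continuous hs).aestronglyMeasurable) (fun s hs => ae_of_all _ (hC s hs))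
    (integrable_inv_one_add_sq.const_mul C) (ae_of_all _ hc)

end SchwartzFamily

/-- A classical solution on `[a,b]` of the symmetrised damped Euler system
`∂ₜσ + u ∂ₓσ + c(σ) ∂ₓu = 0`, `∂ₜu + u ∂ₓu + c(σ) ∂ₓσ = -λu`. -/
structure IsAcousticOn (c : ℝ → ℝ) (lam a b : ℝ) (σ u : ℝ → ℝ → ℝ) : Prop where
  speed_smooth : ContDiff ℝ ∞ c
  regular_sigma : RegularOn (Icc a b) σ
  regular_u : RegularOn (Icc a b) u
  eq_sigma : ∀ t ∈ Icc a b, ∀ x, HasDerivWithinAt (fun s => σ s x)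
    (-(u t x * deriv (σ t) x + c (σ t x) * deriv (u t) x)) (Icc a b) t
  eq_u : ∀ t ∈ Icc a b, ∀ x, HasDerivWithinAt (fun s => u s x)
    (-(u t x * deriv (u t) x + c (σ t x) * deriv (σ t) x) - lam * u t x) (Icc a b) t

/-- A point in the space of spatial `3`-jets of `(σ, u)`. -/
abbrev Jet := (ℝ × ℝ) × (ℝ × ℝ) × (ℝ × ℝ) × (ℝ × ℝ)

/-- The spatial `3`-jet of `(σ, u)`. -/
def jet (σ u : ℝ → ℝ → ℝ) (t x : ℝ) : Jet :=
  ((iteratedDeriv 0 (σ t) x, iteratedDeriv 0 (u t) x),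
   (iteratedDeriv 1 (σ t) x, iteratedDeriv 1 (u t) x),
   (iteratedDeriv 2 (σ t) x, iteratedDeriv 2 (u t) x),
   (iteratedDeriv 3 (σ t) x, iteratedDeriv 3 (u t) x))

lemma SchwartzFamily.iteratedDeriv {τ E : Type*} [NormedAddCommGroup E] [NormedSpace ℝ E]
    {s : Set τ} {f : τ → ℝ → E} (hf : SchwartzFamily s f) (n : ℕ) :
    SchwartzFamily s (fun t => _root_.iteratedDeriv n (f t)) := by
  induction n with
  | zero => simpa using hf
  | succ n ih => simpa only [iteratedDeriv_succ] using ih.deriv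

/-- The time derivative of `∂ₓσ`, as a function of the jet. -/
def sigmaRate₁ (c : ℝ → ℝ) (j : Jet) : ℝ :=
  -(j.1.2 * j.2.2.1.1 + j.2.1.2 * j.2.1.1 + c j.1.1 * j.2.2.1.2 + deriv c j.1.1 * j.2.1.1 * j.2.1.2)

/-- The time derivative of `∂ₓu`, as a function of the jet. -/
def uRate₁ (c : ℝ → ℝ) (lam : ℝ) (j : Jet) : ℝ :=
  -(j.1.2 * j.2.2.1.2 + j.2.1.2 ^ 2 + c j.1.1 * j.2.2.1.1 + deriv c j.1.1 * j.2.1.1 ^ 2) -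
    lam * j.2.1.2

/-- The time derivative of `∂ₓ²σ`, as a function of the jet. -/
def sigmaRate₂ (c : ℝ → ℝ) (j : Jet) : ℝ :=
  -(j.1.2 * j.2.2.2.1 + 2 * j.2.1.2 * j.2.2.1.1 + j.2.2.1.2 * j.2.1.1 + c j.1.1 * j.2.2.2.2 +
    2 * deriv c j.1.1 * j.2.1.1 * j.2.2.1.2 +
    (deriv c j.1.1 * j.2.2.1.1 + deriv (deriv c) j.1.1 * j.2.1.1 ^ 2) * j.2.1.2)

/-- The time derivative of `∂ₓ²u`, as a function of the jet. -/
def uRate₂ (c : ℝ → ℝ) (lam : ℝ) (j : Jet) : ℝ :=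
  -(j.1.2 * j.2.2.2.2 + 3 * j.2.1.2 * j.2.2.1.2 + c j.1.1 * j.2.2.2.1 +
    2 * deriv c j.1.1 * j.2.1.1 * j.2.2.1.1 +
    (deriv c j.1.1 * j.2.2.1.1 + deriv (deriv c) j.1.1 * j.2.1.1 ^ 2) * j.2.1.1) -
    lam * j.2.2.1.2

namespace IsAcousticOn

variable {c : ℝ → ℝ} {lam a b : ℝ} {σ u : ℝ → ℝ → ℝ}

lemma jet_schwartz (h : IsAcousticOn c lam a b σ u) : SchwartzFamily (Icc a b) (jet σ u) :=
  have hs := h.regular_sigma.schwartz.iteratedDeriv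
  have hu := h.regular_u.schwartz.iteratedDeriv
  ((hs 0).prodMk (hu 0)).prodMk (((hs 1).prodMk (hu 1)).prodMk
    (((hs 2).prodMk (hu 2)).prodMk ((hs 3).prodMk (hu 3))))

lemma jet_continuousOn (h : IsAcousticOn c lam a b σ u) :
    ContinuousOn (fun p : ℝ × ℝ => jet σ u p.1 p.2) (Icc a b ×ˢ univ) :=
  have hs := h.regular_sigma.jets
  have hu := h.regular_u.jets
  ((hs 0).prodMk (hu 0)).prodMk (((hs 1).prodMk (hu 1)).prodMk
    (((hs 2).prodMk (hu 2)).prodMk ((hs 3).prodMk (hu 3))))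

lemma hasDerivAt_sigma_iterated (h : IsAcousticOn c lam a b σ u) {t : ℝ} (ht : t ∈ Icc a b)
    (n : ℕ) (x : ℝ) : HasDerivAt (iteratedDeriv n (σ t)) (iteratedDeriv (n + 1) (σ t) x) x := by
  rw [iteratedDeriv_succ]
  exact ((h.regular_sigma.schwartz.iteratedDeriv n).smooth t ht).hasDerivAt_smooth x

lemma hasDerivAt_u_iterated (h : IsAcousticOn c lam a b σ u) {t : ℝ} (ht : t ∈ Icc a b)
    (n : ℕ) (x : ℝ) : HasDerivAt (iteratedDeriv n (u t)) (iteratedDeriv (n + 1) (u t) x) x := by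
  rw [iteratedDeriv_succ]
  exact ((h.regular_u.schwartz.iteratedDeriv n).smooth t ht).hasDerivAt_smooth x

lemma hasDerivAt_speed (h : IsAcousticOn c lam a b σ u) {t : ℝ} (ht : t ∈ Icc a b) (x : ℝ) :
    HasDerivAt (fun y => c (iteratedDeriv 0 (σ t) y))
      (deriv c (iteratedDeriv 0 (σ t) x) * iteratedDeriv 1 (σ t) x) x :=
  (h.speed_smooth.hasDerivAt_smooth _).comp x (h.hasDerivAt_sigma_iterated ht 0 x)

lemma hasDerivAt_deriv_speed (h : IsAcousticOn c lam a b σ u) {t : ℝ} (ht : t ∈ Icc a b) (x : ℝ) :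
    HasDerivAt (fun y => deriv c (iteratedDeriv 0 (σ t) y))
      (deriv (deriv c) (iteratedDeriv 0 (σ t) x) * iteratedDeriv 1 (σ t) x) x :=
  (h.speed_smooth.deriv_smooth.hasDerivAt_smooth _).comp x (h.hasDerivAt_sigma_iterated ht 0 x)

lemma time_deriv_sigma (h : IsAcousticOn c lam a b σ u) {t : ℝ} (ht : t ∈ Ioo a b) (x : ℝ) :
    HasDerivAt (fun s => iteratedDeriv 0 (σ s) x)
      (-(iteratedDeriv 0 (u t) x * iteratedDeriv 1 (σ t) x +
        c (iteratedDeriv 0 (σ t) x) * iteratedDeriv 1 (u t) x)) t := by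
  simp only [iteratedDeriv_zero, iteratedDeriv_one]
  exact (h.eq_sigma t (Ioo_subset_Icc_self ht) x).hasDerivAt (Icc_mem_nhds ht.1 ht.2)

lemma time_deriv_u (h : IsAcousticOn c lam a b σ u) {t : ℝ} (ht : t ∈ Ioo a b) (x : ℝ) :
    HasDerivAt (fun s => iteratedDeriv 0 (u s) x)
      (-(iteratedDeriv 0 (u t) x * iteratedDeriv 1 (u t) x +
        c (iteratedDeriv 0 (σ t) x) * iteratedDeriv 1 (σ t) x) - lam * iteratedDeriv 0 (u t) x)
      t := by
  simp only [iteratedDeriv_zero, iteratedDeriv_one]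
  exact (h.eq_u t (Ioo_subset_Icc_self ht) x).hasDerivAt (Icc_mem_nhds ht.1 ht.2)

lemma continuousAt_comp_jet (h : IsAcousticOn c lam a b σ u) {t : ℝ} (ht : t ∈ Ioo a b) (x : ℝ)
    {Ψ : Jet → ℝ} (hΨ : Continuous Ψ) :
    ContinuousAt (fun p : ℝ × ℝ => Ψ (jet σ u p.1 p.2)) (t, x) :=
  hΨ.continuousAt.comp (f := fun p : ℝ × ℝ => jet σ u p.1 p.2)
    (h.jet_continuousOn.continuousAt (prod_mem_nhds (Icc_mem_nhds ht.1 ht.2) univ_mem))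

lemma contDiff_speeds (hc : ContDiff ℝ ∞ c) : ContDiff ℝ ∞ (fun j : Jet => c j.1.1) ∧
    ContDiff ℝ ∞ (fun j : Jet => deriv c j.1.1) ∧
    ContDiff ℝ ∞ (fun j : Jet => deriv (deriv c) j.1.1) :=
  ⟨hc.comp (by fun_prop), hc.deriv_smooth.comp (by fun_prop),
    hc.deriv_smooth.deriv_smooth.comp (by fun_prop)⟩

lemma contDiff_sigmaRate₁ (hc : ContDiff ℝ ∞ c) : ContDiff ℝ ∞ (sigmaRate₁ c) := by
  obtain ⟨h0, h1, -⟩ := contDiff_speeds hc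
  unfold sigmaRate₁
  fun_prop

lemma contDiff_uRate₁ (hc : ContDiff ℝ ∞ c) : ContDiff ℝ ∞ (uRate₁ c lam) := by
  obtain ⟨h0, h1, -⟩ := contDiff_speeds hc
  unfold uRate₁
  fun_prop

lemma contDiff_sigmaRate₂ (hc : ContDiff ℝ ∞ c) : ContDiff ℝ ∞ (sigmaRate₂ c) := by
  obtain ⟨h0, h1, h2⟩ := contDiff_speeds hc
  unfold sigmaRate₂
  fun_prop

lemma contDiff_uRate₂ (hc : ContDiff ℝ ∞ c) : ContDiff ℝ ∞ (uRate₂ c lam) := by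
  obtain ⟨h0, h1, h2⟩ := contDiff_speeds hc
  unfold uRate₂
  fun_prop

lemma time_deriv_sigma₁ (h : IsAcousticOn c lam a b σ u) {t : ℝ} (ht : t ∈ Ioo a b) (x : ℝ) :
    HasDerivAt (fun s => iteratedDeriv 1 (σ s) x) (sigmaRate₁ c (jet σ u t x)) t := by
  have hI : ∀ᶠ s in 𝓝 t, s ∈ Ioo a b := Ioo_mem_nhds ht.1 ht.2
  refine hasDerivAt_of_hasDerivAt_swap (R' := fun s y => sigmaRate₁ c (jet σ u s y))
    (hI.mono fun s hs y => h.hasDerivAt_sigma_iterated (Ioo_subset_Icc_self hs) 0 y)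
    (hI.mono fun s hs y => ?_) (hI.mono fun s hs y => h.time_deriv_sigma hs y)
    (h.continuousAt_comp_jet ht x (contDiff_sigmaRate₁ h.speed_smooth).continuous)
  have hs' := Ioo_subset_Icc_self hs
  have hσ := fun n => h.hasDerivAt_sigma_iterated hs' n y
  have hu := fun n => h.hasDerivAt_u_iterated hs' n y
  have hc := h.hasDerivAt_speed hs' y
  refine (((hu 0).mul (hσ 1)).add (hc.mul (hu 1))).neg.congr_deriv ?_
  simp only [sigmaRate₁, jet]
  ring

lemma time_deriv_u₁ (h : IsAcousticOn c lam a b σ u) {t : ℝ} (ht : t ∈ Ioo a b) (x : ℝ) :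
    HasDerivAt (fun s => iteratedDeriv 1 (u s) x) (uRate₁ c lam (jet σ u t x)) t := by
  have hI : ∀ᶠ s in 𝓝 t, s ∈ Ioo a b := Ioo_mem_nhds ht.1 ht.2
  refine hasDerivAt_of_hasDerivAt_swap (R' := fun s y => uRate₁ c lam (jet σ u s y))
    (hI.mono fun s hs y => h.hasDerivAt_u_iterated (Ioo_subset_Icc_self hs) 0 y)
    (hI.mono fun s hs y => ?_) (hI.mono fun s hs y => h.time_deriv_u hs y)
    (h.continuousAt_comp_jet ht x (contDiff_uRate₁ h.speed_smooth).continuous)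
  have hs' := Ioo_subset_Icc_self hs
  have hσ := fun n => h.hasDerivAt_sigma_iterated hs' n y
  have hu := fun n => h.hasDerivAt_u_iterated hs' n y
  have hc := h.hasDerivAt_speed hs' y
  refine (((((hu 0).mul (hu 1)).add (hc.mul (hσ 1))).neg).sub ((hu 0).const_mul lam)).congr_deriv ?_
  simp only [uRate₁, jet]
  ring

lemma time_deriv_sigma₂ (h : IsAcousticOn c lam a b σ u) {t : ℝ} (ht : t ∈ Ioo a b) (x : ℝ) :
    HasDerivAt (fun s => iteratedDeriv 2 (σ s) x) (sigmaRate₂ c (jet σ u t x)) t := by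
  have hI : ∀ᶠ s in 𝓝 t, s ∈ Ioo a b := Ioo_mem_nhds ht.1 ht.2
  refine hasDerivAt_of_hasDerivAt_swap (R' := fun s y => sigmaRate₂ c (jet σ u s y))
    (hI.mono fun s hs y => h.hasDerivAt_sigma_iterated (Ioo_subset_Icc_self hs) 1 y)
    (hI.mono fun s hs y => ?_) (hI.mono fun s hs y => h.time_deriv_sigma₁ hs y)
    (h.continuousAt_comp_jet ht x (contDiff_sigmaRate₂ h.speed_smooth).continuous)
  have hs' := Ioo_subset_Icc_self hs
  have hσ := fun n => h.hasDerivAt_sigma_iterated hs' n y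
  have hu := fun n => h.hasDerivAt_u_iterated hs' n y
  have hc := h.hasDerivAt_speed hs' y
  have hc' := h.hasDerivAt_deriv_speed hs' y
  refine (((((hu 0).mul (hσ 2)).add ((hu 1).mul (hσ 1))).add (hc.mul (hu 2))).add
    ((hc'.mul (hσ 1)).mul (hu 1))).neg.congr_deriv ?_
  simp only [sigmaRate₂, jet, Pi.mul_apply]
  ring

lemma time_deriv_u₂ (h : IsAcousticOn c lam a b σ u) {t : ℝ} (ht : t ∈ Ioo a b) (x : ℝ) :
    HasDerivAt (fun s => iteratedDeriv 2 (u s) x) (uRate₂ c lam (jet σ u t x)) t := by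
  have hI : ∀ᶠ s in 𝓝 t, s ∈ Ioo a b := Ioo_mem_nhds ht.1 ht.2
  refine hasDerivAt_of_hasDerivAt_swap (R' := fun s y => uRate₂ c lam (jet σ u s y))
    (hI.mono fun s hs y => h.hasDerivAt_u_iterated (Ioo_subset_Icc_self hs) 1 y)
    (hI.mono fun s hs y => ?_) (hI.mono fun s hs y => h.time_deriv_u₁ hs y)
    (h.continuousAt_comp_jet ht x (contDiff_uRate₂ h.speed_smooth).continuous)
  have hs' := Ioo_subset_Icc_self hs
  have hσ := fun n => h.hasDerivAt_sigma_iterated hs' n y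
  have hu := fun n => h.hasDerivAt_u_iterated hs' n y
  have hc := h.hasDerivAt_speed hs' y
  have hc' := h.hasDerivAt_deriv_speed hs' y
  refine (((((((hu 0).mul (hu 2)).add ((hu 1).pow 2)).add (hc.mul (hσ 2))).add
    (hc'.mul ((hσ 1).pow 2))).neg).sub ((hu 1).const_mul lam)).congr_deriv ?_
  simp only [uRate₂, jet, Pi.pow_apply]
  push_cast
  ring

end IsAcousticOn

lemma mul_mul_le_of_sq_le {p α β : ℝ} (hα : 0 < α) (hp : p ^ 2 ≤ 4 * (α * β)) (x y : ℝ) :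
    p * x * y ≤ α * x ^ 2 + β * y ^ 2 := by
  have h : 0 ≤ 4 * α * (α * x ^ 2 + β * y ^ 2 - p * x * y) := by
    nlinarith [sq_nonneg (2 * α * x - p * y), mul_nonneg (sub_nonneg.2 hp) (sq_nonneg y)]
  have := nonneg_of_mul_nonneg_right h (by positivity)
  linarith

lemma mul_mul_le_of_abs_le {p r : ℝ} (hp : |p| ≤ r) (x y : ℝ) :
    p * x * y ≤ r * (x ^ 2 + y ^ 2) / 2 := by
  have h1 := abs_le.1 hp
  nlinarith [mul_nonneg (sub_nonneg.2 h1.1) (sq_nonneg (x - y)),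
    mul_nonneg (sub_nonneg.2 h1.2) (sq_nonneg (x - y)),
    mul_nonneg (sub_nonneg.2 h1.1) (sq_nonneg (x + y)),
    mul_nonneg (sub_nonneg.2 h1.2) (sq_nonneg (x + y))]

/-- Constants for which the energy method closes: `m ≤ c ≤ N`, `K` bounds two derivatives of the
sound speed, `η` is the smallness of the solution, `ε` the weight of the cross terms, `κ` the
resulting dissipation rate and `L` the size of the remaining source terms. -/
structure EnergyConstants (lam m N K ε η κ L : ℝ) : Prop where
  lam_pos : 0 < lam
  m_pos : 0 < m
  one_le_K : 1 ≤ K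
  ε_pos : 0 < ε
  ε_le : ε ≤ 1 / 4
  ε_N : ε * N ≤ lam / 4
  ε_lam : 2 * ε * lam ≤ m
  η_pos : 0 < η
  η_le : η ≤ 1
  κ_pos : 0 < κ
  η_κ : 40 * (K * η) ≤ κ
  κ_lam : κ ≤ lam / 4
  κ_m : κ ≤ ε * m / 4
  L_pos : 0 < L
  L_one : (1 / 2 + K) ^ 2 ≤ lam / 2 * L
  L_two : 2 * ε * K ^ 2 ≤ m * L
  L_three : K * η ≤ L
  L_N : N ^ 2 ≤ 2 * lam * L

lemma exists_energyConstants {lam m N K : ℝ} (hlam : 0 < lam) (hm : 0 < m) (hN : 0 < N)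
    (hK : 1 ≤ K) : ∃ ε η κ L, EnergyConstants lam m N K ε η κ L := by
  have hK0 : 0 < K := by linarith
  obtain ⟨ε, hε0, hε⟩ : ∃ ε, 0 < ε ∧ ε ≤ min (1 / 4) (min (lam / (4 * N)) (m / (2 * lam))) :=
    ⟨_, by positivity, le_rfl⟩
  simp only [le_min_iff] at hε
  obtain ⟨κ, hκ0, hκ⟩ : ∃ κ, 0 < κ ∧ κ ≤ min (lam / 4) (ε * m / 4) := ⟨_, by positivity, le_rfl⟩
  simp only [le_min_iff] at hκ
  obtain ⟨η, hη0, hη⟩ : ∃ η, 0 < η ∧ η ≤ min 1 (κ / (40 * K)) := ⟨_, by positivity, le_rfl⟩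
  simp only [le_min_iff] at hη
  obtain ⟨L, hL⟩ : ∃ L, max (max 1 ((1 / 2 + K) ^ 2 / (lam / 2))) (max (2 * ε * K ^ 2 / m)
      (max (K * η) (N ^ 2 / (2 * lam)))) ≤ L := ⟨_, le_rfl⟩
  simp only [max_le_iff] at hL
  obtain ⟨⟨h1, h2⟩, h3, h4, h5⟩ := hL
  rw [div_le_iff₀ (by positivity)] at h2 h3 h5
  rw [le_div_iff₀ (by positivity)] at hη
  obtain ⟨e1, e2, e3⟩ := hε
  rw [le_div_iff₀ (by positivity)] at e2 e3
  exact ⟨ε, η, κ, L, hlam, hm, hK, hε0, e1, by linarith, by linarith, hη0, hη.1, hκ0,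
    by linarith, hκ.1, hκ.2, by linarith, by linarith, by linarith, h4, by linarith⟩

namespace EnergyConstants

variable {lam m N K ε η κ L : ℝ} (k : EnergyConstants lam m N K ε η κ L)
include k

lemma products {s0 u0 s1 u1 D F : ℝ} (hD : |D| ≤ K) (hF : |F| ≤ K) (hs0 : |s0| ≤ η)
    (hu0 : |u0| ≤ η) (hs1 : |s1| ≤ η) (hu1 : |u1| ≤ η) :
    |s0| ≤ K * η ∧ |u0| ≤ K * η ∧ |s1| ≤ K * η ∧ |u1| ≤ K * η ∧ |D * s0| ≤ K * η ∧
    |D * s1| ≤ K * η ∧ |D * u1| ≤ K * η ∧ |F * s1| ≤ K * η ∧ |F * s1 ^ 2| ≤ K * η := by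
  have hη := k.η_pos
  have hη1 := k.η_le
  have hK := k.one_le_K
  have h1 : η ≤ K * η := by nlinarith
  have h2 : ∀ {a b : ℝ}, |a| ≤ K → |b| ≤ η → |a * b| ≤ K * η := fun ha hb => by
    rw [abs_mul]
    exact mul_le_mul ha hb (abs_nonneg _) (by linarith)
  refine ⟨by linarith, by linarith, by linarith, by linarith, h2 hD hs0, h2 hD hs1, h2 hD hu1,
    h2 hF hs1, h2 hF ?_⟩
  rw [abs_pow]
  nlinarith [abs_nonneg s1]

set_option maxHeartbeats 1000000 in
/-- The dissipation estimate for the full energy. -/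
lemma dissipation {s0 u0 s1 u1 s2 u2 C D F : ℝ} (hC : m ≤ C) (hCN : C ≤ N) (hD : |D| ≤ K)
    (hF : |F| ≤ K) (hs0 : |s0| ≤ η) (hu0 : |u0| ≤ η) (hs1 : |s1| ≤ η) (hu1 : |u1| ≤ η) :
    (-s0 * u0 * s1 - u0 ^ 2 * u1 + D * s0 * s1 * u0 - lam * u0 ^ 2) +
    (-(1 / 2) * u1 * (s1 ^ 2 + u1 ^ 2) - D * s1 ^ 2 * u1 - lam * u1 ^ 2) +
    (1 / 2 * u1 * (s2 ^ 2 + u2 ^ 2) - 2 * u1 * s2 ^ 2 - u2 * s1 * s2 -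
      4 * (D * s1 * s2 * u2) - D * s2 ^ 2 * u1 - F * s1 ^ 2 * u1 * s2 - 3 * u1 * u2 ^ 2 -
      F * s1 ^ 3 * u2 - lam * u2 ^ 2) +
    ε * ((-C * s1 ^ 2 + C * u1 ^ 2 - lam * u0 * s1) +
      (-C * s2 ^ 2 - u1 ^ 2 * s2 - D * s1 ^ 2 * s2 - lam * u1 * s2 + C * u2 ^ 2 + u1 * u2 * s1 +
        D * s1 * u1 * u2)) ≤ -κ * (u0 ^ 2 + u1 ^ 2 + u2 ^ 2 + s1 ^ 2 + s2 ^ 2) := by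
  obtain ⟨p1, p2, p3, p4, p5, p6, p7, p8, p9⟩ := k.products hD hF hs0 hu0 hs1 hu1
  have hε := k.ε_pos
  have hm := k.m_pos
  have hlam := k.lam_pos
  have hr : 0 ≤ K * η := (abs_nonneg _).trans p1
  have q : ∀ {p : ℝ}, |p| ≤ K * η → |-p| ≤ K * η := fun h => by rwa [abs_neg]
  have a1 := mul_mul_le_of_abs_le (q p1) u0 s1
  have a2 := mul_mul_le_of_abs_le (q p2) u0 u1
  have a3 := mul_mul_le_of_abs_le p5 s1 u0
  have a4 := mul_mul_le_of_abs_le (q p4) s1 s1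
  have a5 := mul_mul_le_of_abs_le (q p4) u1 u1
  have a6 := mul_mul_le_of_abs_le (q p6) s1 u1
  have a7 := mul_mul_le_of_abs_le p4 s2 s2
  have a8 := mul_mul_le_of_abs_le p4 u2 u2
  have a9 := mul_mul_le_of_abs_le (q p4) s2 s2
  have a10 := mul_mul_le_of_abs_le (q p3) u2 s2
  have a11 := mul_mul_le_of_abs_le (q p6) s2 u2
  have a12 := mul_mul_le_of_abs_le (q p7) s2 s2
  have a13 := mul_mul_le_of_abs_le (q p9) u1 s2
  have a14 := mul_mul_le_of_abs_le (q p4) u2 u2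
  have a15 := mul_mul_le_of_abs_le (q p9) s1 u2
  have b1 := mul_le_mul_of_nonneg_left (mul_mul_le_of_abs_le (q p4) u1 s2) hε.le
  have b2 := mul_le_mul_of_nonneg_left (mul_mul_le_of_abs_le (q p6) s1 s2) hε.le
  have b3 := mul_le_mul_of_nonneg_left (mul_mul_le_of_abs_le p4 u2 s1) hε.le
  have b4 := mul_le_mul_of_nonneg_left (mul_mul_le_of_abs_le p6 u1 u2) hε.le
  have hy : (-(ε * lam)) ^ 2 ≤ 4 * (lam / 4 * (ε * m / 2)) := by
    have := mul_le_mul_of_nonneg_left k.ε_lam (mul_pos hε hlam).le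
    nlinarith
  have y1 := mul_mul_le_of_sq_le (by positivity) hy u0 s1
  have y2 := mul_mul_le_of_sq_le (by positivity) hy u1 s2
  have c1 : ε * (C * u1 ^ 2) ≤ lam / 4 * u1 ^ 2 := by
    rw [← mul_assoc]
    exact mul_le_mul_of_nonneg_right ((mul_le_mul_of_nonneg_left hCN hε.le).trans k.ε_N)
      (sq_nonneg _)
  have c2 : ε * (C * u2 ^ 2) ≤ lam / 4 * u2 ^ 2 := by
    rw [← mul_assoc]
    exact mul_le_mul_of_nonneg_right ((mul_le_mul_of_nonneg_left hCN hε.le).trans k.ε_N)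
      (sq_nonneg _)
  have c3 := mul_le_mul_of_nonneg_left (mul_le_mul_of_nonneg_right hC (sq_nonneg s1)) hε.le
  have c4 := mul_le_mul_of_nonneg_left (mul_le_mul_of_nonneg_right hC (sq_nonneg s2)) hε.le
  have e : ∀ x : ℝ, ε * (K * η * x ^ 2) ≤ 1 / 4 * (K * η * x ^ 2) := fun x =>
    mul_le_mul_of_nonneg_right k.ε_le (by positivity)
  have z : ∀ x : ℝ, 40 * (K * η * x ^ 2) ≤ κ * x ^ 2 := fun x => by
    have := mul_le_mul_of_nonneg_right k.η_κ (sq_nonneg x)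
    linarith
  have z0 : ∀ x : ℝ, 0 ≤ K * η * x ^ 2 := fun x => by positivity
  have w : ∀ x : ℝ, κ * x ^ 2 ≤ lam / 4 * x ^ 2 := fun x =>
    mul_le_mul_of_nonneg_right k.κ_lam (sq_nonneg x)
  have v : ∀ x : ℝ, κ * x ^ 2 ≤ ε * m / 4 * x ^ 2 := fun x =>
    mul_le_mul_of_nonneg_right k.κ_m (sq_nonneg x)
  have l : ∀ x : ℝ, 0 ≤ lam * x ^ 2 := fun x => by positivity
  linarith [e u0, e u1, e u2, e s1, e s2, z u0, z u1, z u2, z s1, z s2, w u0, w u1, w u2, v s1,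
    v s2, z0 u0, z0 u1, z0 u2, z0 s1, z0 s2, l u0, l u1, l u2]

set_option maxHeartbeats 1000000 in
/-- The growth estimate for the energy of the derivatives. -/
lemma derivative_growth {s0 u0 s1 u1 s2 u2 C D F : ℝ} (hC : m ≤ C) (hCN : C ≤ N) (hD : |D| ≤ K)
    (hF : |F| ≤ K) (hs0 : |s0| ≤ η) (hu0 : |u0| ≤ η) (hs1 : |s1| ≤ η) (hu1 : |u1| ≤ η) :
    (-(1 / 2) * u1 * (s1 ^ 2 + u1 ^ 2) - D * s1 ^ 2 * u1 - lam * u1 ^ 2) +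
    (1 / 2 * u1 * (s2 ^ 2 + u2 ^ 2) - 2 * u1 * s2 ^ 2 - u2 * s1 * s2 -
      4 * (D * s1 * s2 * u2) - D * s2 ^ 2 * u1 - F * s1 ^ 2 * u1 * s2 - 3 * u1 * u2 ^ 2 -
      F * s1 ^ 3 * u2 - lam * u2 ^ 2) +
    ε * (-C * s2 ^ 2 - u1 ^ 2 * s2 - D * s1 ^ 2 * s2 - lam * u1 * s2 + C * u2 ^ 2 + u1 * u2 * s1 +
        D * s1 * u1 * u2) ≤ 3 * L * s1 ^ 4 := by
  obtain ⟨p1, p2, p3, p4, p5, p6, p7, p8, p9⟩ := k.products hD hF hs0 hu0 hs1 hu1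
  have hε := k.ε_pos
  have hm := k.m_pos
  have hlam := k.lam_pos
  have hL := k.L_pos
  have hr : 0 ≤ K * η := (abs_nonneg _).trans p1
  have q : ∀ {p : ℝ}, |p| ≤ K * η → |-p| ≤ K * η := fun h => by rwa [abs_neg]
  have a5 := mul_mul_le_of_abs_le (q p4) u1 u1
  have a7 := mul_mul_le_of_abs_le p4 s2 s2
  have a8 := mul_mul_le_of_abs_le p4 u2 u2
  have a9 := mul_mul_le_of_abs_le (q p4) s2 s2
  have a10 := mul_mul_le_of_abs_le (q p3) u2 s2
  have a11 := mul_mul_le_of_abs_le (q p6) s2 u2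
  have a12 := mul_mul_le_of_abs_le (q p7) s2 s2
  have a13 := mul_mul_le_of_abs_le (q p9) u1 s2
  have a14 := mul_mul_le_of_abs_le (q p4) u2 u2
  have a15 := mul_mul_le_of_abs_le (q p8) (s1 ^ 2) u2
  have b1 := mul_le_mul_of_nonneg_left (mul_mul_le_of_abs_le (q p4) u1 s2) hε.le
  have b3 := mul_le_mul_of_nonneg_left (mul_mul_le_of_abs_le p3 u1 u2) hε.le
  have b4 := mul_le_mul_of_nonneg_left (mul_mul_le_of_abs_le p6 u1 u2) hε.le
  have hy : (-(ε * lam)) ^ 2 ≤ 4 * (lam / 4 * (ε * m / 2)) := by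
    have := mul_le_mul_of_nonneg_left k.ε_lam (mul_pos hε hlam).le
    nlinarith
  have y2 := mul_mul_le_of_sq_le (by positivity) hy u1 s2
  have hD2 := abs_le.1 hD
  have y3 := mul_mul_le_of_sq_le (p := -(1 / 2 + D)) (α := lam / 8) (β := L) (by positivity)
    (by
      have h1 : (1 / 2 + D) ^ 2 ≤ (1 / 2 + K) ^ 2 := sq_le_sq' (by linarith) (by linarith)
      have h2 := k.L_one
      linarith) u1 (s1 ^ 2)
  have y4 := mul_mul_le_of_sq_le (p := -(ε * D)) (α := ε * m / 8) (β := L) (by positivity)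
    (by
      have h1 : D ^ 2 ≤ K ^ 2 := sq_le_sq' hD2.1 hD2.2
      have h2 := mul_le_mul_of_nonneg_left k.L_two hε.le
      have h3 := mul_le_mul_of_nonneg_left h1 (sq_nonneg ε)
      have h4 : 0 ≤ ε ^ 2 * K ^ 2 := by positivity
      linarith) s2 (s1 ^ 2)
  have c2 : ε * (C * u2 ^ 2) ≤ lam / 4 * u2 ^ 2 := by
    rw [← mul_assoc]
    exact mul_le_mul_of_nonneg_right ((mul_le_mul_of_nonneg_left hCN hε.le).trans k.ε_N)
      (sq_nonneg _)
  have c4 := mul_le_mul_of_nonneg_left (mul_le_mul_of_nonneg_right hC (sq_nonneg s2)) hε.le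
  have e : ∀ x : ℝ, ε * (K * η * x ^ 2) ≤ 1 / 4 * (K * η * x ^ 2) := fun x =>
    mul_le_mul_of_nonneg_right k.ε_le (by positivity)
  have z : ∀ x : ℝ, 40 * (K * η * x ^ 2) ≤ κ * x ^ 2 := fun x => by
    have := mul_le_mul_of_nonneg_right k.η_κ (sq_nonneg x)
    linarith
  have z0 : ∀ x : ℝ, 0 ≤ K * η * x ^ 2 := fun x => by positivity
  have w : ∀ x : ℝ, κ * x ^ 2 ≤ lam / 4 * x ^ 2 := fun x =>
    mul_le_mul_of_nonneg_right k.κ_lam (sq_nonneg x)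
  have v : ∀ x : ℝ, κ * x ^ 2 ≤ ε * m / 4 * x ^ 2 := fun x =>
    mul_le_mul_of_nonneg_right k.κ_m (sq_nonneg x)
  have l : ∀ x : ℝ, 0 ≤ lam * x ^ 2 := fun x => by positivity
  have l' : ∀ x : ℝ, 0 ≤ ε * m * x ^ 2 := fun x => by positivity
  have f := mul_le_mul_of_nonneg_right k.L_three (by positivity : 0 ≤ s1 ^ 4)
  have f' : 0 ≤ L * s1 ^ 4 := by positivity
  linarith [e u0, e u1, e u2, e s2, z u1, z u2, z s2, w u1, w u2,
    v s2, z0 u1, z0 u2, z0 s2, l u1, l u2, l' s2]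

lemma velocity_growth {u0 s1 C : ℝ} (hC : m ≤ C) (hCN : C ≤ N) :
    -C * u0 * s1 - lam * u0 ^ 2 ≤ -(lam / 2) * u0 ^ 2 + L * s1 ^ 2 := by
  have hlam := k.lam_pos
  have hm := k.m_pos
  have := mul_mul_le_of_sq_le (p := -C) (α := lam / 2) (β := L) (by positivity)
    (by nlinarith [k.L_N]) u0 s1
  linarith

end EnergyConstants

lemma antitoneOn_Icc_of_hasDerivAt_nonpos {a b : ℝ} {f : ℝ → ℝ} (hf : ContinuousOn f (Icc a b))
    (h : ∀ t ∈ Ioo a b, ∃ y, HasDerivAt f y t ∧ y ≤ 0) : AntitoneOn f (Icc a b) := by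
  refine antitoneOn_of_deriv_nonpos (convex_Icc a b) hf (fun t ht => ?_) (fun t ht => ?_)
  all_goals
    rw [interior_Icc] at ht
    obtain ⟨y, hy, hy0⟩ := h t ht
  · exact hy.differentiableAt.differentiableWithinAt
  · rwa [hy.deriv]

/-- Time-weighted decay: if `E` dissipates `X`, and `X` grows at most quadratically, then
`X` and any quantity `F` damped up to a source `X` decay like `1 / (1 + t)`. -/
lemma decay_of_dissipation {κ A B lam b : ℝ} (hκ : 0 < κ) (hA : 0 < A) (hB : 0 < B)
    (hlam : 0 < lam) {E X F : ℝ → ℝ} (hE : ContinuousOn E (Icc 0 b))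
    (hX : ContinuousOn X (Icc 0 b)) (hF : ContinuousOn F (Icc 0 b))
    (hE0 : ∀ t ∈ Icc 0 b, 0 ≤ E t) (hX0 : ∀ t ∈ Icc 0 b, 0 ≤ X t)
    (hXE : ∀ t ∈ Icc 0 b, X t ≤ B * E t) (hFE : ∀ t ∈ Icc 0 b, F t ≤ B * E t)
    (hE' : ∀ t ∈ Ioo 0 b, ∃ y, HasDerivAt E y t ∧ y ≤ -κ * X t)
    (hX' : ∀ t ∈ Ioo 0 b, ∃ y, HasDerivAt X y t ∧ y ≤ A * X t ^ 2)
    (hF' : ∀ t ∈ Ioo 0 b, ∃ y, HasDerivAt F y t ∧ y ≤ -lam * F t + A * X t)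
    (h1 : E 0 ≤ 1) :
    ∀ t ∈ Icc 0 b, E t ≤ E 0 ∧
      (1 + t) * X t ≤ (B + 1 / κ) * Real.exp (A / κ) * E 0 ∧
      (1 + t) * F t ≤ ((B + A * ((B + 1 / κ) * Real.exp (A / κ))) / lam + B) * E 0 := by
  intro t ht
  have h0 : (0 : ℝ) ∈ Icc 0 b := ⟨le_rfl, ht.1.trans ht.2⟩
  have mE : AntitoneOn E (Icc 0 b) := antitoneOn_Icc_of_hasDerivAt_nonpos hE fun s hs => by
    obtain ⟨y, hy, hy'⟩ := hE' s hs
    exact ⟨y, hy, hy'.trans (by nlinarith [hX0 s (Ioo_subset_Icc_self hs)])⟩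
  have e0 := hE0 0 h0
  have key : ∀ s ∈ Icc 0 b, (1 + s) * X s ≤ (B + 1 / κ) * Real.exp (A / κ) * E 0 := by
    have mW : AntitoneOn (fun s => (1 + A * ((1 + s) * X s)) * Real.exp (A / κ * E s))
        (Icc 0 b) := by
      refine antitoneOn_Icc_of_hasDerivAt_nonpos (by fun_prop) fun s hs => ?_
      obtain ⟨e', de, he⟩ := hE' s hs
      obtain ⟨x', dx, hx⟩ := hX' s hs
      have d1 : HasDerivAt (fun s : ℝ => 1 + s) 1 s := (hasDerivAt_id s).const_add 1
      refine ⟨_, (((d1.mul dx).const_mul A).const_add 1).mul ((de.const_mul (A / κ)).exp), ?_⟩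
      simp only [Pi.mul_apply]
      have x0 := hX0 s (Ioo_subset_Icc_self hs)
      have hs0 := hs.1
      have i1 : A / κ * e' ≤ -(A * X s) := by
        calc A / κ * e' ≤ A / κ * (-κ * X s) := by gcongr
          _ = -(A * X s) := by field_simp
      have i2 : (1 + s) * x' ≤ (1 + s) * (A * X s ^ 2) := by gcongr
      have i3 : 0 ≤ A * ((1 + s) * X s) := by positivity
      have i4 : A * (1 * X s + (1 + s) * x') + (1 + A * ((1 + s) * X s)) * (A / κ * e') ≤ 0 := by
        nlinarith [mul_le_mul_of_nonneg_left i1 (by linarith : 0 ≤ 1 + A * ((1 + s) * X s)),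
          mul_le_mul_of_nonneg_left i2 hA.le]
      nlinarith [Real.exp_pos (A / κ * E s)]
    intro s hs
    have hW := mW h0 hs hs.1
    simp only [add_zero, one_mul] at hW
    have x0 := hX0 s hs
    have hs0 := hs.1
    have j1 : 1 + A * ((1 + s) * X s) ≤ (1 + A * X 0) * Real.exp (A / κ * E 0) := by
      refine le_trans ?_ hW
      have : 1 ≤ Real.exp (A / κ * E s) := Real.one_le_exp (mul_nonneg (by positivity) (hE0 s hs))
      exact le_mul_of_one_le_right (by positivity) this
    have j2 : Real.exp (A / κ * E 0) ≤ Real.exp (A / κ) :=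
      Real.exp_le_exp.2 (mul_le_of_le_one_right (by positivity) h1)
    have j3 : Real.exp (A / κ * E 0) ≤ 1 + A / κ * E 0 * Real.exp (A / κ) := by
      have := Real.add_one_le_exp (-(A / κ * E 0))
      rw [Real.exp_neg] at this
      have hp := Real.exp_pos (A / κ * E 0)
      have h2 : (-(A / κ * E 0) + 1) * Real.exp (A / κ * E 0) ≤ 1 := by
        rwa [← le_div_iff₀ hp, one_div]
      have h3 : 0 ≤ A / κ * E 0 := by positivity
      nlinarith
    have j4 : A * X 0 * Real.exp (A / κ * E 0) ≤ A * (B * E 0) * Real.exp (A / κ) := by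
      have := hXE 0 h0
      have := hX0 0 h0
      gcongr
    have j5 : A * ((1 + s) * X s) ≤ A * ((B + 1 / κ) * Real.exp (A / κ) * E 0) := by
      have : A * ((B + 1 / κ) * Real.exp (A / κ) * E 0) =
        A * (B * E 0) * Real.exp (A / κ) + A / κ * E 0 * Real.exp (A / κ) := by ring
      rw [this]
      linarith
    exact le_of_mul_le_mul_left j5 hA
  refine ⟨mE h0 ht ht.1, key t ht, ?_⟩
  set Y := (B + 1 / κ) * Real.exp (A / κ) with hY
  have Y0 : 0 < Y := by positivity
  set Z := (B + A * Y) / lam * E 0 with hZ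
  have hZl : lam * Z = (B + A * Y) * E 0 := by rw [hZ]; field_simp
  have mG : AntitoneOn (fun s => ((1 + s) * F s - Z) * Real.exp (lam * s)) (Icc 0 b) := by
    refine antitoneOn_Icc_of_hasDerivAt_nonpos (by fun_prop) fun s hs => ?_
    obtain ⟨f', df, hf⟩ := hF' s hs
    have d1 : HasDerivAt (fun s : ℝ => 1 + s) 1 s := (hasDerivAt_id s).const_add 1
    refine ⟨_, ((d1.mul df).sub_const Z).mul (((hasDerivAt_id s).const_mul lam).exp), ?_⟩
    simp only [Pi.mul_apply, id, mul_one]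
    have hs' := Ioo_subset_Icc_self hs
    have hs0 := hs.1
    have i1 := key s hs'
    have i2 : F s ≤ B * E 0 := (hFE s hs').trans (by gcongr; exact mE h0 hs' hs'.1)
    have i3 : (1 + s) * f' ≤ (1 + s) * (-lam * F s + A * X s) := by gcongr
    have i4 : 1 * F s + (1 + s) * f' + ((1 + s) * F s - Z) * lam ≤ 0 := by
      nlinarith [mul_le_mul_of_nonneg_left i1 hA.le]
    nlinarith [Real.exp_pos (lam * s)]
  have hG := mG h0 ht ht.1
  simp only [add_zero, one_mul, mul_zero, Real.exp_zero, mul_one] at hG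
  have hZ0 : 0 ≤ Z := by positivity
  have i1 := hFE 0 h0
  have i2 : 1 ≤ Real.exp (lam * t) := Real.one_le_exp (mul_nonneg hlam.le ht.1)
  rw [add_mul ((B + A * Y) / lam), ← hZ]
  by_contra hcon
  push Not at hcon
  have : 0 ≤ B * E 0 := by positivity
  nlinarith

lemma SchwartzFamily.sq_le_integral {τ : Type*} {s : Set τ} {f : τ → ℝ → ℝ}
    (hf : SchwartzFamily s f) {t : τ} (ht : t ∈ s) (x : ℝ) :
    f t x ^ 2 ≤ (∫ y, f t y ^ 2) + ∫ y, _root_.deriv (f t) y ^ 2 := by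
  have hsq : ∀ {g : τ → ℝ → ℝ}, SchwartzFamily s g → SchwartzFamily s (fun t x => g t x ^ 2) :=
    fun hg => hg.smooth_comp (H := fun y : ℝ => y ^ 2) (by fun_prop) (by simp)
  have hd : ∀ y, HasDerivAt (fun y => f t y ^ 2) (2 * f t y * _root_.deriv (f t) y) y := fun y => by
    refine (((hf.smooth t ht).hasDerivAt_smooth y).fun_pow 2).congr_deriv ?_
    norm_num
  have h1 := (hsq hf).integrable ht
  have h2 := (hsq hf.deriv).integrable ht
  have hD : (fun y => 2 * f t y * _root_.deriv (f t) y) = _root_.deriv (fun y => f t y ^ 2) := by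
    funext y
    rw [(hd y).deriv]
  have hI : Integrable (fun y => 2 * f t y * _root_.deriv (f t) y) := by
    rw [hD]
    exact (hsq hf).deriv.integrable ht
  have hlim : Tendsto (fun y => f t y ^ 2) atBot (𝓝 0) := by
    refine tendsto_zero_of_hasDerivAt_of_integrableOn_Iic (a := x)
      (f' := fun y => 2 * f t y * _root_.deriv (f t) y) (fun y _ => hd y) hI.integrableOn
      h1.integrableOn
  have hF := integral_Iic_of_hasDerivAt_of_tendsto' (a := x) (f := fun y => f t y ^ 2)
    (f' := fun y => 2 * f t y * _root_.deriv (f t) y)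
    (fun y _ => hd y) hI.integrableOn hlim
  rw [sub_zero] at hF
  rw [← hF, ← integral_add h1 h2]
  calc ∫ y in Iic x, 2 * f t y * _root_.deriv (f t) y
      ≤ ∫ y in Iic x, (f t y ^ 2 + _root_.deriv (f t) y ^ 2) :=
        integral_mono hI.restrict (h1.add h2).restrict fun y => by
          change _ ≤ f t y ^ 2 + _root_.deriv (f t) y ^ 2
          nlinarith [sq_nonneg (f t y - _root_.deriv (f t) y)]
    _ ≤ ∫ y, (f t y ^ 2 + _root_.deriv (f t) y ^ 2) :=
        setIntegral_le_integral (h1.add h2) (ae_of_all _ fun y => by positivity)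

/-- The energy density of the first and second derivatives, with a cross term. -/
def derivEnergyDensity (ε : ℝ) (j : Jet) : ℝ :=
  (j.2.1.1 ^ 2 + j.2.1.2 ^ 2 + j.2.2.1.1 ^ 2 + j.2.2.1.2 ^ 2) / 2 + ε * (j.2.1.2 * j.2.2.1.1)

/-- The full energy density. -/
def energyDensity (ε : ℝ) (j : Jet) : ℝ :=
  (j.1.1 ^ 2 + j.1.2 ^ 2) / 2 + ε * (j.1.2 * j.2.1.1) + derivEnergyDensity ε j

/-- The energy flux of the first and second derivatives. -/
def derivEnergyFlux (c : ℝ → ℝ) (ε : ℝ) (j : Jet) : ℝ :=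
  -(j.1.2 * (j.2.1.1 ^ 2 + j.2.1.2 ^ 2 + j.2.2.1.1 ^ 2 + j.2.2.1.2 ^ 2) / 2) -
    c j.1.1 * (j.2.1.1 * j.2.1.2 + j.2.2.1.1 * j.2.2.1.2) +
    ε * (j.2.1.2 * sigmaRate₁ c j)

/-- The full energy flux. -/
def energyFlux (c : ℝ → ℝ) (ε : ℝ) (j : Jet) : ℝ :=
  -(c j.1.1 * (j.1.1 * j.1.2)) - ε * (j.1.2 * (j.1.2 * j.2.1.1 + c j.1.1 * j.2.1.2)) +
    derivEnergyFlux c ε j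

/-- The time derivative of `derivEnergyDensity`. -/
def derivEnergyRate (c : ℝ → ℝ) (lam ε : ℝ) (j : Jet) : ℝ :=
  j.2.1.1 * sigmaRate₁ c j + j.2.1.2 * uRate₁ c lam j + j.2.2.1.1 * sigmaRate₂ c j +
    j.2.2.1.2 * uRate₂ c lam j +
    ε * (uRate₁ c lam j * j.2.2.1.1 + j.2.1.2 * sigmaRate₂ c j)

/-- The time derivative of `energyDensity`. -/
def energyRate (c : ℝ → ℝ) (lam ε : ℝ) (j : Jet) : ℝ :=
  -(j.1.1 * (j.1.2 * j.2.1.1 + c j.1.1 * j.2.1.2)) -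
    j.1.2 * (j.1.2 * j.2.1.2 + c j.1.1 * j.2.1.1 + lam * j.1.2) +
    ε * (-(j.1.2 * j.2.1.2 + c j.1.1 * j.2.1.1 + lam * j.1.2) * j.2.1.1 +
      j.1.2 * sigmaRate₁ c j) + derivEnergyRate c lam ε j

/-- Bounds for the sound speed on `[-η, η]`. -/
def SpeedBounds (c : ℝ → ℝ) (m N K η : ℝ) : Prop :=
  ∀ s, |s| ≤ η → m ≤ c s ∧ c s ≤ N ∧ |deriv c s| ≤ K ∧ |deriv (deriv c) s| ≤ K

lemma energyDensity_bounds {ε : ℝ} (h0 : 0 < ε) (h : ε ≤ 1 / 4) (j : Jet) :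
    j.1.1 ^ 2 + j.1.2 ^ 2 + j.2.1.1 ^ 2 + j.2.1.2 ^ 2 + j.2.2.1.1 ^ 2 + j.2.2.1.2 ^ 2 ≤
      4 * energyDensity ε j ∧
    energyDensity ε j ≤
      j.1.1 ^ 2 + j.1.2 ^ 2 + j.2.1.1 ^ 2 + j.2.1.2 ^ 2 + j.2.2.1.1 ^ 2 + j.2.2.1.2 ^ 2 ∧
    j.2.1.1 ^ 2 + j.2.1.2 ^ 2 + j.2.2.1.1 ^ 2 + j.2.2.1.2 ^ 2 ≤ 4 * derivEnergyDensity ε j ∧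
    derivEnergyDensity ε j ≤ j.2.1.1 ^ 2 + j.2.1.2 ^ 2 + j.2.2.1.1 ^ 2 + j.2.2.1.2 ^ 2 := by
  have h1 : |ε| ≤ 1 / 4 := by rwa [abs_of_pos h0]
  have h2 : |-ε| ≤ 1 / 4 := by rwa [abs_neg]
  have a1 := mul_mul_le_of_abs_le h1 j.1.2 j.2.1.1
  have a2 := mul_mul_le_of_abs_le h2 j.1.2 j.2.1.1
  have a3 := mul_mul_le_of_abs_le h1 j.2.1.2 j.2.2.1.1
  have a4 := mul_mul_le_of_abs_le h2 j.2.1.2 j.2.2.1.1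
  have s1 := sq_nonneg j.1.1
  have s2 := sq_nonneg j.1.2
  have s3 := sq_nonneg j.2.1.1
  have s4 := sq_nonneg j.2.1.2
  have s5 := sq_nonneg j.2.2.1.1
  have s6 := sq_nonneg j.2.2.1.2
  simp only [energyDensity, derivEnergyDensity]
  refine ⟨?_, ?_, ?_, ?_⟩ <;> linarith

namespace IsAcousticOn

variable {c : ℝ → ℝ} {lam a b : ℝ} {σ u : ℝ → ℝ → ℝ}

lemma schwartz_comp_jet (h : IsAcousticOn c lam a b σ u) {Ψ : Jet → ℝ} (hΨ : ContDiff ℝ ∞ Ψ)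
    (h0 : Ψ 0 = 0) : SchwartzFamily (Icc a b) (fun t x => Ψ (jet σ u t x)) :=
  h.jet_schwartz.smooth_comp hΨ h0

lemma integral_rate (h : IsAcousticOn c lam a b σ u) {Ψ Ψ' J D : Jet → ℝ}
    (hΨ : ContDiff ℝ ∞ Ψ) (hΨ0 : Ψ 0 = 0) (hΨ' : ContDiff ℝ ∞ Ψ') (hΨ'0 : Ψ' 0 = 0)
    (hJ : ContDiff ℝ ∞ J) (hJ0 : J 0 = 0) (hD : ContDiff ℝ ∞ D) (hD0 : D 0 = 0)
    (hd : ∀ t ∈ Ioo a b, ∀ x,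
      HasDerivAt (fun s => Ψ (jet σ u s x)) (Ψ' (jet σ u t x)) t)
    (hle : ∀ t ∈ Ioo a b, ∀ x, ∃ J', HasDerivAt (fun y => J (jet σ u t y)) J' x ∧
      Ψ' (jet σ u t x) ≤ J' + D (jet σ u t x)) :
    ContinuousOn (fun t => ∫ x, Ψ (jet σ u t x)) (Icc a b) ∧ ∀ t ∈ Ioo a b, ∃ y,
      HasDerivAt (fun t => ∫ x, Ψ (jet σ u t x)) y t ∧ y ≤ ∫ x, D (jet σ u t x) := by
  refine ⟨(h.schwartz_comp_jet hΨ hΨ0).integral_continuousOn fun x =>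
    hΨ.continuous.comp_continuousOn (h.jet_continuousOn.comp (f := fun t => (t, x))
      (by fun_prop) fun t ht => ⟨ht, mem_univ _⟩), fun t ht => ⟨_,
    (h.schwartz_comp_jet hΨ hΨ0).integral_hasDerivAt (h.schwartz_comp_jet hΨ' hΨ'0) hd ht,
    (h.schwartz_comp_jet hΨ' hΨ'0).integral_le_of_flux (h.schwartz_comp_jet hJ hJ0)
      (h.schwartz_comp_jet hD hD0) (Ioo_subset_Icc_self ht) fun x => ?_⟩⟩
  obtain ⟨J', hJ', hle⟩ := hle t ht x
  rwa [hJ'.deriv]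

lemma time_deriv_derivEnergyDensity (h : IsAcousticOn c lam a b σ u) (ε : ℝ) {t : ℝ}
    (ht : t ∈ Ioo a b) (x : ℝ) :
    HasDerivAt (fun s => derivEnergyDensity ε (jet σ u s x))
      (derivEnergyRate c lam ε (jet σ u t x)) t := by
  have s1 := h.time_deriv_sigma₁ ht x
  have u1 := h.time_deriv_u₁ ht x
  have s2 := h.time_deriv_sigma₂ ht x
  have u2 := h.time_deriv_u₂ ht x
  refine (((((s1.fun_pow 2).add (u1.fun_pow 2)).add (s2.fun_pow 2)).add (u2.fun_pow 2)).div_const 2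
    |>.add ((u1.mul s2).const_mul ε)).congr_deriv ?_
  simp only [derivEnergyRate]
  generalize sigmaRate₁ c (jet σ u t x) = S1
  generalize uRate₁ c lam (jet σ u t x) = U1
  generalize sigmaRate₂ c (jet σ u t x) = S2
  generalize uRate₂ c lam (jet σ u t x) = U2
  simp only [jet]
  push_cast
  ring

lemma time_deriv_energyDensity (h : IsAcousticOn c lam a b σ u) (ε : ℝ) {t : ℝ}
    (ht : t ∈ Ioo a b) (x : ℝ) :
    HasDerivAt (fun s => energyDensity ε (jet σ u s x))
      (energyRate c lam ε (jet σ u t x)) t := by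
  have s0 := h.time_deriv_sigma ht x
  have u0 := h.time_deriv_u ht x
  have s1 := h.time_deriv_sigma₁ ht x
  refine (((((s0.fun_pow 2).add (u0.fun_pow 2)).div_const 2).add ((u0.mul s1).const_mul ε)).add
    (h.time_deriv_derivEnergyDensity ε ht x)).congr_deriv ?_
  simp only [energyRate]
  generalize sigmaRate₁ c (jet σ u t x) = S1
  generalize derivEnergyRate c lam ε (jet σ u t x) = R
  simp only [jet]
  push_cast
  ring

lemma hasDerivAt_derivEnergyFlux (h : IsAcousticOn c lam a b σ u) (ε : ℝ) {t : ℝ}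
    (ht : t ∈ Ioo a b) (x : ℝ) : ∃ J',
    HasDerivAt (fun y => derivEnergyFlux c ε (jet σ u t y)) J' x ∧
    ∀ s0 u0 s1 u1 s2 u2 C D F : ℝ, s0 = iteratedDeriv 0 (σ t) x → u0 = iteratedDeriv 0 (u t) x →
      s1 = iteratedDeriv 1 (σ t) x → u1 = iteratedDeriv 1 (u t) x →
      s2 = iteratedDeriv 2 (σ t) x → u2 = iteratedDeriv 2 (u t) x →
      C = c s0 → D = deriv c s0 → F = deriv (deriv c) s0 →
    derivEnergyRate c lam ε (jet σ u t x) = J' +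
      ((-(1 / 2) * u1 * (s1 ^ 2 + u1 ^ 2) - D * s1 ^ 2 * u1 - lam * u1 ^ 2) +
    (1 / 2 * u1 * (s2 ^ 2 + u2 ^ 2) - 2 * u1 * s2 ^ 2 - u2 * s1 * s2 -
      4 * (D * s1 * s2 * u2) - D * s2 ^ 2 * u1 - F * s1 ^ 2 * u1 * s2 - 3 * u1 * u2 ^ 2 -
      F * s1 ^ 3 * u2 - lam * u2 ^ 2) +
    ε * (-C * s2 ^ 2 - u1 ^ 2 * s2 - D * s1 ^ 2 * s2 - lam * u1 * s2 + C * u2 ^ 2 + u1 * u2 * s1 +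
        D * s1 * u1 * u2)) := by
  have hI := Ioo_subset_Icc_self ht
  have hs := fun n => h.hasDerivAt_sigma_iterated hI n x
  have hu := fun n => h.hasDerivAt_u_iterated hI n x
  have hc := h.hasDerivAt_speed hI x
  have hc' := h.hasDerivAt_deriv_speed hI x
  have hS1 : HasDerivAt (fun y => sigmaRate₁ c (jet σ u t y)) _ x :=
    (((((hu 0).mul (hs 2)).add ((hu 1).mul (hs 1))).add (hc.mul (hu 2))).add
      ((hc'.mul (hs 1)).mul (hu 1))).neg
  refine ⟨_, ((((hu 0).mul (((((hs 1).fun_pow 2).add ((hu 1).fun_pow 2)).add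
    ((hs 2).fun_pow 2)).add ((hu 2).fun_pow 2))).div_const 2).neg.sub
    (hc.mul (((hs 1).mul (hu 1)).add ((hs 2).mul (hu 2))))).add
    (((hu 1).mul hS1).const_mul ε), ?_⟩
  rintro s0 u0 s1 u1 s2 u2 C D F rfl rfl rfl rfl rfl rfl rfl rfl rfl
  simp only [derivEnergyRate, jet, sigmaRate₁, sigmaRate₂, uRate₁, uRate₂, Pi.mul_apply,
    Pi.add_apply]
  push_cast
  ring

lemma hasDerivAt_energyFlux (h : IsAcousticOn c lam a b σ u) (ε : ℝ) {t : ℝ}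
    (ht : t ∈ Ioo a b) (x : ℝ) : ∃ J',
    HasDerivAt (fun y => energyFlux c ε (jet σ u t y)) J' x ∧
    ∀ s0 u0 s1 u1 s2 u2 C D F : ℝ, s0 = iteratedDeriv 0 (σ t) x → u0 = iteratedDeriv 0 (u t) x →
      s1 = iteratedDeriv 1 (σ t) x → u1 = iteratedDeriv 1 (u t) x →
      s2 = iteratedDeriv 2 (σ t) x → u2 = iteratedDeriv 2 (u t) x →
      C = c s0 → D = deriv c s0 → F = deriv (deriv c) s0 →
    energyRate c lam ε (jet σ u t x) = J' +
      ((-s0 * u0 * s1 - u0 ^ 2 * u1 + D * s0 * s1 * u0 - lam * u0 ^ 2) +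
    (-(1 / 2) * u1 * (s1 ^ 2 + u1 ^ 2) - D * s1 ^ 2 * u1 - lam * u1 ^ 2) +
    (1 / 2 * u1 * (s2 ^ 2 + u2 ^ 2) - 2 * u1 * s2 ^ 2 - u2 * s1 * s2 -
      4 * (D * s1 * s2 * u2) - D * s2 ^ 2 * u1 - F * s1 ^ 2 * u1 * s2 - 3 * u1 * u2 ^ 2 -
      F * s1 ^ 3 * u2 - lam * u2 ^ 2) +
    ε * ((-C * s1 ^ 2 + C * u1 ^ 2 - lam * u0 * s1) +
      (-C * s2 ^ 2 - u1 ^ 2 * s2 - D * s1 ^ 2 * s2 - lam * u1 * s2 + C * u2 ^ 2 + u1 * u2 * s1 +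
        D * s1 * u1 * u2))) := by
  have hI := Ioo_subset_Icc_self ht
  have hs := fun n => h.hasDerivAt_sigma_iterated hI n x
  have hu := fun n => h.hasDerivAt_u_iterated hI n x
  have hc := h.hasDerivAt_speed hI x
  obtain ⟨J', hJ', hJ⟩ := h.hasDerivAt_derivEnergyFlux ε ht x
  refine ⟨_, ((hc.mul ((hs 0).mul (hu 0))).neg.sub (((hu 0).mul (((hu 0).mul (hs 1)).add
    (hc.mul (hu 1)))).const_mul ε)).add hJ', ?_⟩
  intro s0 u0 s1 u1 s2 u2 C D F h1 h2 h3 h4 h5 h6 h7 h8 h9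
  rw [energyRate, hJ s0 u0 s1 u1 s2 u2 C D F h1 h2 h3 h4 h5 h6 h7 h8 h9]
  subst h1 h2 h3 h4 h5 h6 h7 h8 h9
  simp only [jet, sigmaRate₁, Pi.mul_apply, Pi.add_apply]
  ring

end IsAcousticOn

/-- The total energy of a pair of functions. -/
def totalEnergy (ε : ℝ) (f g : ℝ → ℝ) : ℝ :=
  ∫ x, energyDensity ε (jet (fun _ => f) (fun _ => g) 0 x)

namespace IsAcousticOn

variable {c : ℝ → ℝ} {lam m N K ε η κ L a b : ℝ} {σ u : ℝ → ℝ → ℝ}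

lemma contDiff_densities (ε : ℝ) (hc : ContDiff ℝ ∞ c) :
    ContDiff ℝ ∞ (derivEnergyDensity ε) ∧ ContDiff ℝ ∞ (energyDensity ε) ∧
    ContDiff ℝ ∞ (derivEnergyFlux c ε) ∧ ContDiff ℝ ∞ (energyFlux c ε) ∧
    ContDiff ℝ ∞ (derivEnergyRate c lam ε) ∧ ContDiff ℝ ∞ (energyRate c lam ε) := by
  have c0 := (contDiff_speeds hc).1
  have r1 := contDiff_sigmaRate₁ hc
  have r2 := contDiff_uRate₁ (lam := lam) hc
  have r3 := contDiff_sigmaRate₂ hc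
  have r4 := contDiff_uRate₂ (lam := lam) hc
  have h1 : ContDiff ℝ ∞ (derivEnergyDensity ε) := by unfold derivEnergyDensity; fun_prop
  have h3 : ContDiff ℝ ∞ (derivEnergyFlux c ε) := by unfold derivEnergyFlux; fun_prop
  have h5 : ContDiff ℝ ∞ (derivEnergyRate c lam ε) := by unfold derivEnergyRate; fun_prop
  refine ⟨h1, ?_, h3, ?_, h5, ?_⟩
  · unfold energyDensity; fun_prop
  · unfold energyFlux; fun_prop
  · unfold energyRate; fun_prop

lemma jet_integral_sq (h : IsAcousticOn c lam a b σ u) {t : ℝ} (ht : t ∈ Icc a b) {p : Jet → ℝ}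
    (hp : ContDiff ℝ ∞ p) (h0 : p 0 = 0) : Integrable (fun x => p (jet σ u t x) ^ 2) :=
  (h.schwartz_comp_jet (Ψ := fun j => p j ^ 2) (hp.pow 2) (by simp [h0])).integrable ht

lemma integral_mono_jet (h : IsAcousticOn c lam a b σ u) {t : ℝ} (ht : t ∈ Icc a b)
    {p q : Jet → ℝ} (hp : ContDiff ℝ ∞ p) (hp0 : p 0 = 0) (hq : ContDiff ℝ ∞ q) (hq0 : q 0 = 0)
    (hle : ∀ j, p j ≤ q j) : ∫ x, p (jet σ u t x) ≤ ∫ x, q (jet σ u t x) :=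
  integral_mono ((h.schwartz_comp_jet hp hp0).integrable ht)
    ((h.schwartz_comp_jet hq hq0).integrable ht) fun _ => hle _

lemma sqL2_sum (h : IsAcousticOn c lam a b σ u) {t : ℝ} (ht : t ∈ Icc a b) :
    sqL2 (deriv (σ t)) + sqL2 (deriv (u t)) + sqL2 (deriv (deriv (σ t))) +
      sqL2 (deriv (deriv (u t))) = (∫ x, (fun j : Jet => j.2.1.1 ^ 2 + j.2.1.2 ^ 2 +
        j.2.2.1.1 ^ 2 + j.2.2.1.2 ^ 2) (jet σ u t x)) ∧
    sqH2pair (σ t) (u t) = ∫ x, (fun j : Jet => j.1.1 ^ 2 + j.1.2 ^ 2 + j.2.1.1 ^ 2 +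
      j.2.1.2 ^ 2 + j.2.2.1.1 ^ 2 + j.2.2.1.2 ^ 2) (jet σ u t x) := by
  have i1 := h.jet_integral_sq ht (p := fun j => j.1.1) (by fun_prop) rfl
  have i2 := h.jet_integral_sq ht (p := fun j => j.1.2) (by fun_prop) rfl
  have i3 := h.jet_integral_sq ht (p := fun j => j.2.1.1) (by fun_prop) rfl
  have i4 := h.jet_integral_sq ht (p := fun j => j.2.1.2) (by fun_prop) rfl
  have i5 := h.jet_integral_sq ht (p := fun j => j.2.2.1.1) (by fun_prop) rfl
  have i6 := h.jet_integral_sq ht (p := fun j => j.2.2.1.2) (by fun_prop) rfl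
  have e1 : ∀ f : ℝ → ℝ, sqL2 f = ∫ x, iteratedDeriv 0 f x ^ 2 := fun f => by
    simp [sqL2]
  have e2 : ∀ f : ℝ → ℝ, sqL2 (deriv f) = ∫ x, iteratedDeriv 1 f x ^ 2 := fun f => by
    simp [sqL2]
  have e3 : ∀ f : ℝ → ℝ, sqL2 (deriv (deriv f)) = ∫ x, iteratedDeriv 2 f x ^ 2 := fun f => by
    simp [sqL2, iteratedDeriv_succ]
  constructor
  · rw [integral_add, integral_add, integral_add, e2, e2, e3, e3]
    · rfl
    all_goals first | assumption | skip
    · exact i3.add i4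
    · exact (i3.add i4).add i5
  · rw [integral_add, integral_add, integral_add, integral_add, integral_add]
    · simp only [sqH2pair, sqH2, sqH1]
      rw [e3 (σ t), e3 (u t), e2 (σ t), e2 (u t), e1 (σ t), e1 (u t)]
      simp only [jet]
      ring
    all_goals first | assumption | skip
    · exact i1.add i2
    · exact (i1.add i2).add i3
    · exact ((i1.add i2).add i3).add i4
    · exact (((i1.add i2).add i3).add i4).add i5

lemma totalEnergy_bounds (h : IsAcousticOn c lam a b σ u) (h0 : 0 < ε) (h1 : ε ≤ 1 / 4)
    {t : ℝ} (ht : t ∈ Icc a b) :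
    sqH2pair (σ t) (u t) ≤ 4 * totalEnergy ε (σ t) (u t) ∧
      totalEnergy ε (σ t) (u t) ≤ sqH2pair (σ t) (u t) := by
  obtain ⟨-, c2, -⟩ := contDiff_densities (lam := lam) ε h.speed_smooth
  rw [(h.sqL2_sum ht).2, totalEnergy, ← integral_const_mul]
  constructor
  · exact h.integral_mono_jet ht (by fun_prop) (by simp) (q := fun j => 4 * energyDensity ε j)
      (by fun_prop) (by simp [energyDensity, derivEnergyDensity])
      fun j => (energyDensity_bounds h0 h1 j).1
  · exact h.integral_mono_jet ht c2 (by simp [energyDensity, derivEnergyDensity])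
      (by fun_prop) (by simp) fun j => (energyDensity_bounds h0 h1 j).2.1

set_option maxHeartbeats 1000000 in
/-- A priori bounds for small solutions. -/
theorem energy_decay (h : IsAcousticOn c lam 0 b σ u) (k : EnergyConstants lam m N K ε η κ L)
    (hc : SpeedBounds c m N K η)
    (hs : ∀ t ∈ Icc 0 b, ∀ x, |σ t x| ≤ η ∧ |u t x| ≤ η ∧ |deriv (σ t) x| ≤ η ∧
      |deriv (u t) x| ≤ η) (hE : totalEnergy ε (σ 0) (u 0) ≤ 1) :
    ∀ t ∈ Icc 0 b, totalEnergy ε (σ t) (u t) ≤ totalEnergy ε (σ 0) (u 0) ∧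
      (1 + t) * (sqL2 (u t) + (sqL2 (deriv (σ t)) + sqL2 (deriv (u t)))) ≤
      (4 * ((4 + 1 / κ) * Real.exp (48 * L / κ)) +
        2 * ((4 + 48 * L * ((4 + 1 / κ) * Real.exp (48 * L / κ))) / lam + 4)) *
          totalEnergy ε (σ 0) (u 0) := by
  have hκ := k.κ_pos
  have hL := k.L_pos
  have hlam := k.lam_pos
  have B := energyDensity_bounds k.ε_pos k.ε_le
  obtain ⟨c1, c2, c3, c4, c5, c6⟩ := contDiff_densities (lam := lam) ε h.speed_smooth
  have z1 : derivEnergyDensity ε 0 = 0 := by simp [derivEnergyDensity]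
  have z2 : energyDensity ε 0 = 0 := by simp [energyDensity, z1]
  have z3 : derivEnergyFlux c ε 0 = 0 := by simp [derivEnergyFlux]
  have z4 : energyFlux c ε 0 = 0 := by simp [energyFlux, z3]
  have z5 : derivEnergyRate c lam ε 0 = 0 := by simp [derivEnergyRate]
  have z6 : energyRate c lam ε 0 = 0 := by simp [energyRate, z5]
  have hs' : ∀ t ∈ Ioo 0 b, ∀ x, |iteratedDeriv 0 (σ t) x| ≤ η ∧ |iteratedDeriv 0 (u t) x| ≤ η ∧
      |iteratedDeriv 1 (σ t) x| ≤ η ∧ |iteratedDeriv 1 (u t) x| ≤ η := fun t ht x => by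
    simpa only [iteratedDeriv_zero, iteratedDeriv_one] using hs t (Ioo_subset_Icc_self ht) x
  obtain ⟨EC, ED⟩ := h.integral_rate c2 z2 c6 z6 c4 z4
    (D := fun j => -κ * derivEnergyDensity ε j) (by fun_prop) (by simp [z1])
    (fun t ht x => h.time_deriv_energyDensity ε ht x) fun t ht x => by
      obtain ⟨J', hJ', hJ⟩ := h.hasDerivAt_energyFlux ε ht x
      refine ⟨J', hJ', ?_⟩
      rw [hJ _ _ _ _ _ _ _ _ _ rfl rfl rfl rfl rfl rfl rfl rfl rfl]
      obtain ⟨q1, q2, q3, q4⟩ := hs' t ht x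
      obtain ⟨p1, p2, p3, p4⟩ := hc _ q1
      gcongr
      refine (k.dissipation p1 p2 p3 p4 q1 q2 q3 q4).trans ?_
      have := (B (jet σ u t x)).2.2.2
      simp only [jet] at this ⊢
      nlinarith [sq_nonneg (iteratedDeriv 0 (u t) x)]
  obtain ⟨XC, XD⟩ := h.integral_rate c1 z1 c5 z5 c3 z3
    (D := fun j => 3 * L * j.2.1.1 ^ 4) (by fun_prop) (by simp)
    (fun t ht x => h.time_deriv_derivEnergyDensity ε ht x) fun t ht x => by
      obtain ⟨J', hJ', hJ⟩ := h.hasDerivAt_derivEnergyFlux ε ht x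
      refine ⟨J', hJ', ?_⟩
      rw [hJ _ _ _ _ _ _ _ _ _ rfl rfl rfl rfl rfl rfl rfl rfl rfl]
      obtain ⟨q1, q2, q3, q4⟩ := hs' t ht x
      obtain ⟨p1, p2, p3, p4⟩ := hc _ q1
      gcongr
      exact k.derivative_growth p1 p2 p3 p4 q1 q2 q3 q4
  have c0 := h.speed_smooth
  obtain ⟨FC, FD⟩ := h.integral_rate (Ψ := fun j => j.1.2 ^ 2 / 2) (by fun_prop) (by simp)
    (Ψ' := fun j => j.1.2 * (-(j.1.2 * j.2.1.2 + c j.1.1 * j.2.1.1) - lam * j.1.2))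
    (by fun_prop) (by simp) (J := fun j => -j.1.2 ^ 3 / 3) (by fun_prop) (by simp)
    (D := fun j => -lam * (j.1.2 ^ 2 / 2) + 4 * L * derivEnergyDensity ε j) (by fun_prop)
    (by simp [z1]) (fun t ht x => by
      refine (((h.time_deriv_u ht x).fun_pow 2).div_const 2).congr_deriv ?_
      simp only [jet]
      push_cast
      ring) fun t ht x => by
      refine ⟨_, (((h.hasDerivAt_u_iterated (Ioo_subset_Icc_self ht) 0 x).fun_pow 3).neg.div_const
        3), ?_⟩
      obtain ⟨q1, q2, q3, q4⟩ := hs' t ht x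
      obtain ⟨p1, p2, p3, p4⟩ := hc _ q1
      have h1 := k.velocity_growth (u0 := iteratedDeriv 0 (u t) x) (s1 := iteratedDeriv 1 (σ t) x)
        p1 p2
      have h2 := mul_le_mul_of_nonneg_left (B (jet σ u t x)).2.2.1 hL.le
      simp only [jet] at h2 ⊢
      push_cast
      nlinarith [mul_nonneg hL.le (sq_nonneg (iteratedDeriv 1 (u t) x)),
        mul_nonneg hL.le (sq_nonneg (iteratedDeriv 2 (u t) x)),
        mul_nonneg hL.le (sq_nonneg (iteratedDeriv 2 (σ t) x))]
  have hdecay := decay_of_dissipation hκ (A := 48 * L) (by positivity) (B := 4) (by norm_num) hlam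
    EC XC FC
    (fun t ht => integral_nonneg fun x => by
      change 0 ≤ energyDensity ε (jet σ u t x)
      have := (B (jet σ u t x)).1
      have : (0 : ℝ) ≤ 4 * energyDensity ε (jet σ u t x) := le_trans (by positivity) this
      linarith)
    (fun t ht => integral_nonneg fun x => by
      change 0 ≤ derivEnergyDensity ε (jet σ u t x)
      have := (B (jet σ u t x)).2.2.1
      have : (0 : ℝ) ≤ 4 * derivEnergyDensity ε (jet σ u t x) := le_trans (by positivity) this
      linarith)
    (fun t ht => by
      rw [← integral_const_mul]
      refine h.integral_mono_jet ht (q := fun j => 4 * energyDensity ε j) c1 z1 (by fun_prop)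
        (by simp [z2]) fun j => ?_
      linarith [(B j).1, (B j).2.2.2, sq_nonneg j.1.1, sq_nonneg j.1.2])
    (fun t ht => by
      rw [← integral_const_mul]
      refine h.integral_mono_jet ht (p := fun j => j.1.2 ^ 2 / 2)
        (q := fun j => 4 * energyDensity ε j) (by fun_prop) (by simp) (by fun_prop)
        (by simp [z2]) fun j => ?_
      have := (B j).1
      nlinarith [sq_nonneg j.1.1, sq_nonneg j.1.2, sq_nonneg j.2.1.1, sq_nonneg j.2.1.2,
        sq_nonneg j.2.2.1.1, sq_nonneg j.2.2.1.2])
    (fun t ht => by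
      obtain ⟨y, hy, hle⟩ := ED t ht
      exact ⟨y, hy, by rwa [integral_const_mul] at hle⟩)
    (fun t ht => by
      obtain ⟨y, hy, hle⟩ := XD t ht
      refine ⟨y, hy, hle.trans ?_⟩
      have hI := Ioo_subset_Icc_self ht
      set X := ∫ x, derivEnergyDensity ε (jet σ u t x) with hX
      have i1 : ∫ x, (fun j : Jet => j.2.1.1 ^ 2 + j.2.2.1.1 ^ 2) (jet σ u t x) ≤ 4 * X := by
        rw [hX, ← integral_const_mul]
        refine h.integral_mono_jet hI (p := fun j => j.2.1.1 ^ 2 + j.2.2.1.1 ^ 2)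
          (q := fun j => 4 * derivEnergyDensity ε j) (by fun_prop) (by simp) (by fun_prop)
            (by simp [z1]) fun j => ?_
        have := (B j).2.2.1
        nlinarith [sq_nonneg j.2.1.2, sq_nonneg j.2.2.1.2]
      have j1 := h.jet_integral_sq hI (p := fun j => j.2.1.1) (by fun_prop) rfl
      have j2 := h.jet_integral_sq hI (p := fun j => j.2.2.1.1) (by fun_prop) rfl
      rw [integral_add j1 j2] at i1
      have n1 : 0 ≤ ∫ x, (jet σ u t x).2.1.1 ^ 2 := integral_nonneg fun x => sq_nonneg _
      have n2 : 0 ≤ ∫ x, (jet σ u t x).2.2.1.1 ^ 2 := integral_nonneg fun x => sq_nonneg _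
      have hsup : ∀ x, (jet σ u t x).2.1.1 ^ 2 ≤ 4 * X := fun x => by
        refine le_trans ?_ i1
        have := (h.regular_sigma.schwartz.iteratedDeriv 1).sq_le_integral hI x
        rwa [← iteratedDeriv_succ] at this
      calc ∫ x, 3 * L * (jet σ u t x).2.1.1 ^ 4
          ≤ ∫ x, 3 * L * (4 * X) * (jet σ u t x).2.1.1 ^ 2 := by
            refine integral_mono ((h.schwartz_comp_jet (Ψ := fun j => 3 * L * j.2.1.1 ^ 4)
              (by fun_prop) (by simp)).integrable hI) (j1.const_mul _) fun x => ?_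
            have := mul_le_mul_of_nonneg_right (hsup x) (sq_nonneg (jet σ u t x).2.1.1)
            have := mul_le_mul_of_nonneg_left this hL.le
            simp only
            nlinarith
        _ = 3 * L * (4 * X) * ∫ x, (jet σ u t x).2.1.1 ^ 2 := integral_const_mul _ _
        _ ≤ 3 * L * (4 * X) * (4 * X) := by
            have : 0 ≤ X := by linarith
            gcongr
            linarith
        _ = 48 * L * X ^ 2 := by ring)
    (fun t ht => by
      obtain ⟨y, hy, hle⟩ := FD t ht
      refine ⟨y, hy, hle.trans ?_⟩
      have hI := Ioo_subset_Icc_self ht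
      have j1 := (h.jet_integral_sq hI (p := fun j => j.1.2) (by fun_prop) rfl).div_const 2
      have j2 := (h.schwartz_comp_jet c1 z1).integrable hI
      have j3 : 0 ≤ ∫ x, derivEnergyDensity ε (jet σ u t x) := integral_nonneg fun x => by
        change 0 ≤ derivEnergyDensity ε (jet σ u t x)
        have := (B (jet σ u t x)).2.2.1
        have : (0 : ℝ) ≤ 4 * derivEnergyDensity ε (jet σ u t x) := le_trans (by positivity) this
        linarith
      rw [integral_add (j1.const_mul _) (j2.const_mul _), integral_const_mul, integral_const_mul]
      gcongr
      linarith)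
    hE
  intro t ht
  obtain ⟨d1, d2, d3⟩ := hdecay t ht
  refine ⟨d1, ?_⟩
  have hu : sqL2 (u t) = 2 * ∫ x, (jet σ u t x).1.2 ^ 2 / 2 := by
    rw [integral_div, mul_div_cancel₀ _ two_ne_zero]
    simp [sqL2, jet]
  have hd : sqL2 (deriv (σ t)) + sqL2 (deriv (u t)) ≤
      4 * ∫ x, derivEnergyDensity ε (jet σ u t x) := by
    have h1 := (h.sqL2_sum ht).1
    have h2 : ∀ f : ℝ → ℝ, 0 ≤ sqL2 f := fun f => integral_nonneg fun x => sq_nonneg _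
    have h3 := h.integral_mono_jet ht (p := fun j : Jet => j.2.1.1 ^ 2 + j.2.1.2 ^ 2 +
        j.2.2.1.1 ^ 2 + j.2.2.1.2 ^ 2) (q := fun j => 4 * derivEnergyDensity ε j) (by fun_prop)
        (by simp) (by fun_prop) (by simp [z1]) fun j => (B j).2.2.1
    rw [integral_const_mul] at h3
    linarith [h2 (deriv (deriv (σ t))), h2 (deriv (deriv (u t)))]
  have ht0 : 0 ≤ 1 + t := by linarith [ht.1]
  have := mul_le_mul_of_nonneg_left hd ht0
  change _ ≤ _ * ∫ x, energyDensity ε (jet σ u 0 x)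
  rw [hu]
  linarith

end IsAcousticOn

lemma ContinuousLinearMap.deriv_comp_smooth {E F : Type*} [NormedAddCommGroup E]
    [NormedSpace ℝ E] [NormedAddCommGroup F] [NormedSpace ℝ F] (Q : E →L[ℝ] F) {f : ℝ → E}
    (hf : ContDiff ℝ ∞ f) (x : ℝ) : deriv (fun y => Q (f y)) x = Q (deriv f x) :=
  (Q.hasFDerivAt.comp_hasDerivAt x (hf.hasDerivAt_smooth x)).deriv

lemma RegularOn.clm_comp {E F : Type} [NormedAddCommGroup E] [NormedSpace ℝ E] [ProperSpace E]
    [NormedAddCommGroup F] [NormedSpace ℝ F] {I : Set ℝ} {U : ℝ → ℝ → E} (hU : RegularOn I U)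
    (Q : E →L[ℝ] F) : RegularOn I (fun t x => Q (U t x)) where
  schwartz := hU.schwartz.smooth_comp Q.contDiff (map_zero Q)
  jets m := (Q.continuous.comp_continuousOn (hU.jets m)).congr fun p hp =>
    congrFun (Q.iteratedDeriv_comp_smooth (hU.schwartz.smooth p.1 hp.1) m) p.2

/-- Recovers `σ` from the Riemann invariants `(u + σ, u - σ)`. -/
def soundPart : (Fin 2 → ℝ) →L[ℝ] ℝ :=
  (1 / 2 : ℝ) • (ContinuousLinearMap.proj (R := ℝ) (φ := fun _ : Fin 2 => ℝ) 0 -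
    ContinuousLinearMap.proj (R := ℝ) (φ := fun _ : Fin 2 => ℝ) 1)

/-- Recovers `u` from the Riemann invariants `(u + σ, u - σ)`. -/
def velocityPart : (Fin 2 → ℝ) →L[ℝ] ℝ :=
  (1 / 2 : ℝ) • (ContinuousLinearMap.proj (R := ℝ) (φ := fun _ : Fin 2 => ℝ) 0 +
    ContinuousLinearMap.proj (R := ℝ) (φ := fun _ : Fin 2 => ℝ) 1)

lemma soundPart_apply (v : Fin 2 → ℝ) : soundPart v = 1 / 2 * (v 0 - v 1) := rfl

lemma velocityPart_apply (v : Fin 2 → ℝ) : velocityPart v = 1 / 2 * (v 0 + v 1) := rfl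

lemma abs_parts_le (v : Fin 2 → ℝ) : |soundPart v| ≤ ‖v‖ ∧ |velocityPart v| ≤ ‖v‖ := by
  have h0 := abs_le.1 (norm_le_pi_norm v 0)
  have h1 := abs_le.1 (norm_le_pi_norm v 1)
  rw [soundPart_apply, velocityPart_apply]
  constructor <;> rw [abs_le] <;> constructor <;> linarith

lemma norm_le_of_abs_parts_le {v : Fin 2 → ℝ} {r : ℝ} (h0 : |soundPart v| ≤ r)
    (h1 : |velocityPart v| ≤ r) : ‖v‖ ≤ 2 * r := by
  rw [soundPart_apply, abs_le] at h0
  rw [velocityPart_apply, abs_le] at h1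
  refine (pi_norm_le_iff_of_nonneg (by linarith)).2 (Fin.forall_fin_two.2 ⟨?_, ?_⟩) <;>
    rw [Real.norm_eq_abs, abs_le] <;> constructor <;> linarith

/-- The characteristic speeds `u ± c(σ)`. -/
def riemannSpeed (c : ℝ → ℝ) (i : Fin 2) (v : Fin 2 → ℝ) : ℝ :=
  velocityPart v + (if i = 0 then 1 else -1) * c (soundPart v)

/-- The damping term in Riemann invariants. -/
def riemannSource (lam : ℝ) (_ : Fin 2) (v : Fin 2 → ℝ) : ℝ := -lam * velocityPart v

/-- The damped Euler system in Riemann invariants. -/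
abbrev riemannVelocity (c : ℝ → ℝ) (lam : ℝ) : (Fin 2 → ℝ) × (Fin 2 → ℝ) → Fin 2 → ℝ :=
  diagonalVelocity (riemannSpeed c) (riemannSource lam)

section

variable {c : ℝ → ℝ} {lam : ℝ}

lemma contDiff_riemannSpeed (hc : ContDiff ℝ ∞ c) (i : Fin 2) :
    ContDiff ℝ ∞ (riemannSpeed c i) :=
  velocityPart.contDiff.add (contDiff_const.mul (hc.comp soundPart.contDiff))

lemma contDiff_riemannSource (lam : ℝ) (i : Fin 2) : ContDiff ℝ ∞ (riemannSource lam i) :=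
  contDiff_const.mul velocityPart.contDiff

lemma contDiff_riemannVelocity (hc : ContDiff ℝ ∞ c) : ContDiff ℝ ∞ (riemannVelocity c lam) := by
  refine contDiff_pi.2 fun i => ?_
  have h1 := (contDiff_riemannSpeed hc i).comp (contDiff_fst (𝕜 := ℝ) (F := Fin 2 → ℝ))
  have h2 := (contDiff_riemannSource lam i).comp (contDiff_fst (𝕜 := ℝ) (F := Fin 2 → ℝ))
  exact (h1.neg.mul (by fun_prop)).add h2

lemma riemannVelocity_parts (v w : Fin 2 → ℝ) :
    soundPart (riemannVelocity c lam (v, w)) =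
      -(velocityPart v * soundPart w + c (soundPart v) * velocityPart w) ∧
    velocityPart (riemannVelocity c lam (v, w)) =
      -(velocityPart v * velocityPart w + c (soundPart v) * soundPart w) -
        lam * velocityPart v := by
  rw [soundPart_apply (riemannVelocity c lam (v, w)),
    velocityPart_apply (riemannVelocity c lam (v, w))]
  simp only [riemannVelocity, diagonalVelocity, riemannSpeed, riemannSource, if_true,
    one_ne_zero, if_false, soundPart_apply w, velocityPart_apply w]
  constructor <;> ring

lemma IsSolutionOn.isAcousticOn (hc : ContDiff ℝ ∞ c) {a b : ℝ} {V : ℝ → ℝ → Fin 2 → ℝ}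
    (hV : IsSolutionOn (riemannVelocity c lam) (Icc a b) V) :
    IsAcousticOn c lam a b (fun t x => soundPart (V t x)) (fun t x => velocityPart (V t x)) where
  speed_smooth := hc
  regular_sigma := hV.regular.clm_comp soundPart
  regular_u := hV.regular.clm_comp velocityPart
  eq_sigma t ht x := by
    have hs := hV.regular.schwartz.smooth t ht
    refine (soundPart.hasFDerivAt.comp_hasDerivWithinAt t (hV.eq t ht x)).congr_deriv ?_
    rw [soundPart.deriv_comp_smooth hs, velocityPart.deriv_comp_smooth hs]
    exact (riemannVelocity_parts _ _).1
  eq_u t ht x := by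
    have hs := hV.regular.schwartz.smooth t ht
    refine (velocityPart.hasFDerivAt.comp_hasDerivWithinAt t (hV.eq t ht x)).congr_deriv ?_
    rw [soundPart.deriv_comp_smooth hs, velocityPart.deriv_comp_smooth hs]
    exact (riemannVelocity_parts _ _).2

end

lemma SchwartzFamily.sq_le_sqH2pair {τ : Type*} {s : Set τ} {f g : τ → ℝ → ℝ}
    (hf : SchwartzFamily s f) (hg : SchwartzFamily s g) {t : τ} (ht : t ∈ s) (x : ℝ) :
    f t x ^ 2 ≤ sqH2pair (f t) (g t) ∧ g t x ^ 2 ≤ sqH2pair (f t) (g t) ∧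
      _root_.deriv (f t) x ^ 2 ≤ sqH2pair (f t) (g t) ∧
      _root_.deriv (g t) x ^ 2 ≤ sqH2pair (f t) (g t) := by
  have h : ∀ f : ℝ → ℝ, 0 ≤ sqL2 f := fun f => integral_nonneg fun x => sq_nonneg _
  have h1 := hf.sq_le_integral ht x
  have h2 := hg.sq_le_integral ht x
  have h3 := hf.deriv.sq_le_integral ht x
  have h4 := hg.deriv.sq_le_integral ht x
  simp only [sqH2pair, sqH2, sqH1]
  have a1 := h (f t)
  have a2 := h (g t)
  have a3 := h (_root_.deriv (f t))
  have a4 := h (_root_.deriv (g t))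
  have a5 := h (_root_.deriv (_root_.deriv (f t)))
  have a6 := h (_root_.deriv (_root_.deriv (g t)))
  simp only [sqL2] at *
  refine ⟨?_, ?_, ?_, ?_⟩ <;> linarith

/-- Global existence and decay for small Schwartz data of the system in Riemann invariants. -/
theorem exists_global_riemann {c : ℝ → ℝ} {lam m N K ε η κ L : ℝ} (hc : ContDiff ℝ ∞ c)
    (k : EnergyConstants lam m N K ε η κ L) (hb : SpeedBounds c m N K η) :
    ∃ δ B T' : ℝ, 0 < δ ∧ 0 < B ∧ 0 < T' ∧ ∀ V₀ : ℝ → Fin 2 → ℝ,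
      SchwartzFamily univ (fun _ : ℕ => V₀) →
      sqH2pair (fun x => soundPart (V₀ x)) (fun x => velocityPart (V₀ x)) ≤ δ →
      ∃ V : ℝ → ℝ → Fin 2 → ℝ, V 0 = V₀ ∧
        (∀ b, IsSolutionOn (riemannVelocity c lam) (Icc (-T') b) V) ∧
        ∀ t, 0 ≤ t → (∀ x, |soundPart (V t x)| ≤ η) ∧
          sqH2pair (fun x => soundPart (V t x)) (fun x => velocityPart (V t x)) ≤
            B * sqH2pair (fun x => soundPart (V₀ x)) (fun x => velocityPart (V₀ x)) ∧
          (1 + t) * (sqL2 (fun x => velocityPart (V t x)) +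
            (sqL2 (deriv fun x => soundPart (V t x)) +
              sqL2 (deriv fun x => velocityPart (V t x)))) ≤
            B * sqH2pair (fun x => soundPart (V₀ x)) (fun x => velocityPart (V₀ x)) := by
  have hη := k.η_pos
  have hκ := k.κ_pos
  have hL := k.L_pos
  have hlam := k.lam_pos
  set E : (ℝ → Fin 2 → ℝ) → ℝ := fun V =>
    totalEnergy ε (fun x => soundPart (V x)) (fun x => velocityPart (V x)) with hE
  set B₀ := 4 * ((4 + 1 / κ) * Real.exp (48 * L / κ)) +
        2 * ((4 + 48 * L * ((4 + 1 / κ) * Real.exp (48 * L / κ))) / lam + 4) with hB₀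
  have B₀pos : 0 < B₀ := by positivity
  set δ := min 1 ((η / 8) ^ 2) with hδ
  have δpos : 0 < δ := by positivity
  -- small solutions obey the a priori bounds
  have apriori : ∀ {b : ℝ} {V : ℝ → ℝ → Fin 2 → ℝ}, 0 ≤ b →
      IsSolutionOn (riemannVelocity c lam) (Icc 0 b) V → E (V 0) ≤ δ →
      (∀ t ∈ Icc 0 b, (∀ x, ‖V t x‖ ≤ η) ∧ ∀ x, ‖deriv (V t) x‖ ≤ η) →
      ∀ t ∈ Icc 0 b, E (V t) ≤ E (V 0) ∧
        (1 + t) * (sqL2 (fun x => velocityPart (V t x)) +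
            (sqL2 (deriv fun x => soundPart (V t x)) +
              sqL2 (deriv fun x => velocityPart (V t x)))) ≤ B₀ * E (V 0) := by
    intro b V hb0 hV hV0 hsmall
    refine (hV.isAcousticOn hc).energy_decay k hb (fun t ht x => ?_) (hV0.trans (min_le_left _ _))
    have hs := hV.regular.schwartz.smooth t ht
    rw [soundPart.deriv_comp_smooth hs, velocityPart.deriv_comp_smooth hs]
    have h1 := abs_parts_le (V t x)
    have h2 := abs_parts_le (deriv (V t) x)
    have h3 := (hsmall t ht).1 x
    have h4 := (hsmall t ht).2 x
    exact ⟨h1.1.trans h3, h1.2.trans h3, h2.1.trans h4, h2.2.trans h4⟩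
  have parts : ∀ {V : ℝ → Fin 2 → ℝ}, SchwartzFamily univ (fun _ : ℕ => V) →
      SchwartzFamily univ (fun (_ : ℕ) x => soundPart (V x)) ∧
      SchwartzFamily univ (fun (_ : ℕ) x => velocityPart (V x)) := fun hV =>
    ⟨hV.smooth_comp soundPart.contDiff (map_zero _),
      hV.smooth_comp velocityPart.contDiff (map_zero _)⟩
  -- small energy controls the `C¹` norm
  have sobolev : ∀ {V : ℝ → Fin 2 → ℝ}, SchwartzFamily univ (fun _ : ℕ => V) →
      sqH2pair (fun x => soundPart (V x)) (fun x => velocityPart (V x)) ≤ 4 * δ →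
      (∀ x, ‖V x‖ ≤ η / 2) ∧ ∀ x, ‖deriv V x‖ ≤ η / 2 := by
    intro V hV hδV
    have hle : sqH2pair (fun x => soundPart (V x)) (fun x => velocityPart (V x)) ≤ (η / 4) ^ 2 := by
      have : δ ≤ (η / 8) ^ 2 := min_le_right _ _
      nlinarith
    obtain ⟨p1, p2⟩ := parts hV
    have hs := hV.smooth 0 (mem_univ _)
    have key := fun x => p1.sq_le_sqH2pair p2 (mem_univ 0) x
    have hη4 : 0 ≤ η / 4 := by positivity
    have e : η / 2 = 2 * (η / 4) := by ring
    refine ⟨fun x => ?_, fun x => ?_⟩ <;> rw [e]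
    · exact norm_le_of_abs_parts_le (abs_le_of_sq_le_sq ((key x).1.trans hle) hη4)
        (abs_le_of_sq_le_sq ((key x).2.1.trans hle) hη4)
    · refine norm_le_of_abs_parts_le ?_ ?_
      · rw [← soundPart.deriv_comp_smooth hs]
        exact abs_le_of_sq_le_sq ((key x).2.2.1.trans hle) hη4
      · rw [← velocityPart.deriv_comp_smooth hs]
        exact abs_le_of_sq_le_sq ((key x).2.2.2.trans hle) hη4
  obtain ⟨T, hT, fwd⟩ := exists_local_solution (contDiff_riemannSpeed hc)
    (contDiff_riemannSource lam) (fun i => by simp [riemannSource]) (by positivity : 0 ≤ η / 2)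
  obtain ⟨T', hT', bwd⟩ := exists_local_solution (A := fun i v => -riemannSpeed c i v)
    (f := fun i v => -riemannSource lam i v) (fun i => (contDiff_riemannSpeed hc i).neg)
    (fun i => (contDiff_riemannSource lam i).neg) (fun i => by simp [riemannSource])
    (by positivity : 0 ≤ η / 2)
  rw [mul_div_cancel₀ _ (two_ne_zero' ℝ)] at fwd
  have comparison : ∀ {a b t : ℝ} {V : ℝ → ℝ → Fin 2 → ℝ}, t ∈ Icc a b →
      IsSolutionOn (riemannVelocity c lam) (Icc a b) V →
      sqH2pair (fun x => soundPart (V t x)) (fun x => velocityPart (V t x)) ≤ 4 * E (V t) ∧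
      E (V t) ≤ sqH2pair (fun x => soundPart (V t x)) (fun x => velocityPart (V t x)) :=
    fun ht hV => (hV.isAcousticOn hc).totalEnergy_bounds k.ε_pos k.ε_le ht
  refine ⟨δ, 4 + B₀, T', δpos, by positivity, hT', fun V₀ hV₀ hδV₀ => ?_⟩
  have hnn : ∀ f : ℝ → ℝ, 0 ≤ sqL2 f := fun f => integral_nonneg fun x => sq_nonneg _
  have hnn' : ∀ f g : ℝ → ℝ, 0 ≤ sqH2pair f g := fun f g => by
    have := hnn f
    have := hnn g
    have := hnn (deriv f)
    have := hnn (deriv g)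
    have := hnn (deriv (deriv f))
    have := hnn (deriv (deriv g))
    simp only [sqH2pair, sqH2, sqH1]
    positivity
  obtain ⟨n0, n1⟩ := sobolev hV₀ (by linarith)
  obtain ⟨W, W0, hW, -⟩ := bwd V₀ hV₀ n0 n1
  have hback : IsSolutionOn (riemannVelocity c lam) (Icc (-T') 0) (fun t => W (-1 * t + 0)) := by
    have h1 := hW.comp_affine (J := Icc (-T') 0) (c := -1) (d := 0) fun t ht => by
      have h1 := ht.1
      have h2 := ht.2
      constructor <;> linarith
    convert h1 using 1
    funext q i
    simp only [riemannVelocity, diagonalVelocity, Pi.smul_apply, smul_eq_mul]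
    ring
  have hE₀ : E V₀ ≤ δ := by
    have := (comparison (right_mem_Icc.2 (by linarith)) hback).2
    simp only [mul_zero, add_zero, W0] at this
    exact this.trans hδV₀
  obtain ⟨V, V0, hV, hQ⟩ := exists_global_solution hT
    (𝒮 := {V | SchwartzFamily univ (fun _ : ℕ => V) ∧ E V ≤ δ ∧
      sqH2pair (fun x => soundPart (V x)) (fun x => velocityPart (V x)) ≤ 4 * δ})
    (Q := fun V => (∀ x, ‖V x‖ ≤ η) ∧ ∀ x, ‖deriv V x‖ ≤ η)
    (G := riemannVelocity c lam) (T' := T')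
    (fun V ⟨hV, hVE, hVδ⟩ => by
      obtain ⟨n0, n1⟩ := sobolev hV hVδ
      obtain ⟨U, rfl, hU, hUb⟩ := fwd V hV n0 n1
      have hTT : T ∈ Icc 0 T := ⟨hT.le, le_rfl⟩
      have hQ : ∀ t ∈ Icc 0 T, (∀ x, ‖U t x‖ ≤ η) ∧ ∀ x, ‖deriv (U t) x‖ ≤ η := fun t ht =>
        ⟨fun x => (hUb t ht x).1, fun x => (hUb t ht x).2⟩
      have hET := ((apriori hT.le hU hVE hQ) T hTT).1.trans hVE
      exact ⟨U, rfl, hU, ⟨hU.regular.schwartz.comp_index (g := fun _ => T) fun _ _ => hTT, hET,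
        ((comparison hTT hU).1.trans (by linarith))⟩, hQ⟩)
    (V₀ := V₀) ⟨hV₀, hE₀, by linarith⟩ ⟨_, by simp [W0], hback⟩
  refine ⟨V, V0, hV, fun t ht => ?_⟩
  have hV' := (hV t).mono (J := Icc 0 t) (Icc_subset_Icc_left (by linarith))
  have htt : t ∈ Icc 0 t := ⟨ht, le_rfl⟩
  obtain ⟨a1, a2⟩ := apriori ht hV' (by rwa [V0]) (fun s hs => hQ s hs.1) t htt
  have c0 := (comparison ⟨le_rfl, ht⟩ hV').2
  have c1 := (comparison htt hV').1
  rw [V0] at a1 a2 c0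
  have hp := hnn' (fun x => soundPart (V₀ x)) (fun x => velocityPart (V₀ x))
  refine ⟨fun x => (abs_parts_le _).1.trans ((hQ t ht).1 x), ?_, ?_⟩
  · have := mul_nonneg B₀pos.le hp
    linarith
  · have := mul_le_mul_of_nonneg_left c0 B₀pos.le
    linarith

/-- A smooth function on the line whose derivative is bounded below by a positive constant has a
smooth inverse. -/
lemma exists_smooth_inverse {Φ k : ℝ → ℝ} {m : ℝ} (hm : 0 < m) (hk : ∀ r, m ≤ k r)
    (hΦ : ContDiff ℝ ∞ Φ) (hd : ∀ r, HasDerivAt Φ (k r) r) :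
    ∃ G : ℝ → ℝ, ContDiff ℝ ∞ G ∧ (∀ r, G (Φ r) = r) ∧ ∀ s, deriv G s * k (G s) = 1 := by
  have hkpos : ∀ r, 0 < k r := fun r => hm.trans_le (hk r)
  have hmono : StrictMono Φ := strictMono_of_deriv_pos fun r => by
    rw [(hd r).deriv]
    exact hkpos r
  have hlin : Monotone fun r => Φ r - m * r := by
    have h : ∀ r, HasDerivAt (fun r => Φ r - m * r) (k r - m) r := fun r => by
      simpa using (hd r).fun_sub ((hasDerivAt_id r).const_mul m)
    refine monotone_of_deriv_nonneg (fun r => (h r).differentiableAt) fun r => ?_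
    rw [(h r).deriv]
    linarith [hk r]
  have htop : Tendsto Φ atTop atTop := by
    refine tendsto_atTop_mono' _ ?_ (tendsto_atTop_add_const_right _ (Φ 0)
      (tendsto_id.const_mul_atTop hm))
    filter_upwards [eventually_ge_atTop 0] with r hr
    have := hlin hr
    simp only [mul_zero, sub_zero, id] at this ⊢
    linarith
  have hbot : Tendsto Φ atBot atBot := by
    refine tendsto_atBot_mono' _ ?_ (tendsto_atBot_add_const_right _ (Φ 0)
      (tendsto_id.const_mul_atBot hm))
    filter_upwards [eventually_le_atBot 0] with r hr
    have := hlin hr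
    simp only [mul_zero, sub_zero, id] at this ⊢
    linarith
  set e := (hmono.orderIsoOfSurjective Φ (hΦ.continuous.surjective htop hbot)).toHomeomorph with he
  have heΦ : ⇑e = Φ := rfl
  have hG : ContDiff ℝ ∞ e.symm := e.contDiff_symm_deriv (f' := k) (fun r => (hkpos r).ne') hd hΦ
  refine ⟨e.symm, hG, fun r => e.symm_apply_apply r, fun s => ?_⟩
  have h1 := (hd (e.symm s)).comp s (hG.hasDerivAt_smooth s)
  have h2 : (Φ ∘ e.symm) = id := funext fun s => e.apply_symm_apply s
  rw [h2] at h1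
  rw [mul_comm]
  exact h1.unique (hasDerivAt_id s)

/-- A positive function on a neighbourhood of `a`, modified to be smooth on the line and bounded
below by a positive constant. -/
lemma exists_smooth_positive_extension {f : ℝ → ℝ} (hf : ContDiffOn ℝ ∞ f (Ioi 0))
    (hpos : ∀ r, 0 < r → 0 < f r) {a : ℝ} (ha : 0 < a) :
    ∃ (k : ℝ → ℝ) (m : ℝ), ContDiff ℝ ∞ k ∧ 0 < m ∧ (∀ r, m ≤ k r) ∧
      ∀ r, |r - a| ≤ a / 4 → k r = f r := by
  set χ : ContDiffBump a := ⟨a / 4, a / 2, by positivity, by linarith⟩ with hχ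
  have hzero : ∀ r, a / 2 ≤ |r - a| → χ r = 0 := fun r hr => χ.zero_of_le_dist hr
  set k : ℝ → ℝ := fun r => χ r * f r + (1 - χ r) with hk
  have hks : ContDiff ℝ ∞ k := by
    refine contDiff_iff_contDiffAt.2 fun r => ?_
    have hχs : ContDiffAt ℝ ∞ χ r := χ.contDiff.contDiffAt
    rcases lt_or_ge 0 r with hr | hr
    · exact (hχs.mul (hf.contDiffAt (Ioi_mem_nhds hr))).add (contDiffAt_const.sub hχs)
    · refine (contDiffAt_const (c := (1 : ℝ))).congr_of_eventuallyEq ?_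
      filter_upwards [Iio_mem_nhds (show r < a / 2 by linarith)] with y hy
      have hy : y < a / 2 := hy
      have : χ y = 0 := hzero y (by rw [le_abs]; right; linarith)
      simp [hk, this]
  have hkpos : ∀ r, 0 < k r := fun r => by
    rcases lt_or_ge 0 r with hr | hr
    · have h0 := χ.nonneg (x := r)
      have h1 := χ.le_one (x := r)
      rcases h0.eq_or_lt with h | h
      · simp [hk, ← h]
      · have := mul_pos h (hpos r hr)
        simp only [hk]
        linarith
    · have : χ r = 0 := hzero r (by rw [le_abs]; right; linarith)
      simp [hk, this]
  obtain ⟨r₀, -, hr₀⟩ := (isCompact_closedBall a (a / 2)).exists_isMinOn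
    ⟨a, Metric.mem_closedBall_self (by positivity)⟩ hks.continuous.continuousOn
  refine ⟨k, min 1 (k r₀), hks, lt_min one_pos (hkpos r₀), fun r => ?_, fun r hr => ?_⟩
  · by_cases h : r ∈ Metric.closedBall a (a / 2)
    · exact (min_le_right _ _).trans (hr₀ h)
    · have h' : a / 2 ≤ |r - a| := by
        rw [Metric.mem_closedBall, not_le] at h
        exact h.le
      simp [hk, hzero r h']
  · have : χ r = 1 := χ.one_of_mem_closedBall hr
    simp [hk, this]

/-- The change of variables `ρ = G(σ)`, with `dσ = √P'(ρ) / ρ dρ`, which symmetrizes the Euler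
system; `c` is the sound speed as a function of `σ`. -/
lemma exists_symmetrizing_variable {P : ℝ → ℝ} (hP : ContDiffOn ℝ ∞ P (Ioi 0))
    (hP' : ∀ s : ℝ, 0 < s → 0 < deriv P s) {ρbar : ℝ} (hρbar : 0 < ρbar) :
    ∃ (G Φ c : ℝ → ℝ) (η₀ : ℝ), ContDiff ℝ ∞ G ∧ ContDiff ℝ ∞ Φ ∧ ContDiff ℝ ∞ c ∧ 0 < η₀ ∧
      G 0 = ρbar ∧ Φ ρbar = 0 ∧ (∀ r, G (Φ r) = r) ∧
      ∀ s, |s| ≤ η₀ → 0 < G s ∧ 0 < c s ∧ deriv G s * c s = G s ∧ c s ^ 2 = deriv P (G s) := by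
  have hdP : ContDiffOn ℝ ∞ (deriv P) (Ioi 0) := hP.deriv_of_isOpen isOpen_Ioi (by simp)
  obtain ⟨k, m, hk, hm, hmk, hkf⟩ := exists_smooth_positive_extension
    (f := fun r => √(deriv P r) / r)
    ((hdP.sqrt fun r hr => (hP' r hr).ne').div contDiffOn_id fun r hr => ne_of_gt hr)
    (fun r hr => div_pos (Real.sqrt_pos.2 (hP' r hr)) hr) hρbar
  set Φ : ℝ → ℝ := fun r => ∫ y in ρbar..r, k y with hΦ
  have hd : ∀ r, HasDerivAt Φ (k r) r := fun r =>
    intervalIntegral.integral_hasDerivAt_right (hk.continuous.intervalIntegrable _ _)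
      hk.continuous.stronglyMeasurable.stronglyMeasurableAtFilter hk.continuous.continuousAt
  have hΦs : ContDiff ℝ ∞ Φ := by
    refine contDiff_infty_iff_deriv.2 ⟨fun r => (hd r).differentiableAt, ?_⟩
    rwa [show deriv Φ = k from funext fun r => (hd r).deriv]
  obtain ⟨G, hG, hGΦ, hGd⟩ := exists_smooth_inverse hm hmk hΦs hd
  have hΦ0 : Φ ρbar = 0 := intervalIntegral.integral_same
  have hG0 : G 0 = ρbar := by rw [← hΦ0, hGΦ]
  obtain ⟨η₀, hη₀, hclose⟩ := Metric.continuousAt_iff.1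
    (hG.continuous.continuousAt (x := 0)) (ρbar / 4) (by positivity)
  refine ⟨G, Φ, fun s => G s * k (G s), η₀ / 2, hG, hΦs, hG.mul (hk.comp hG), by positivity, hG0,
    hΦ0, hGΦ, fun s hs => ?_⟩
  have h1 : |G s - ρbar| ≤ ρbar / 4 := by
    have := hclose (x := s) (by rw [Real.dist_eq, sub_zero]; linarith)
    rw [Real.dist_eq, hG0] at this
    exact this.le
  have hpos : 0 < G s := by linarith [(abs_le.1 h1).1]
  have hkpos : 0 < k (G s) := hm.trans_le (hmk _)
  refine ⟨hpos, mul_pos hpos hkpos, ?_, ?_⟩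
  · linear_combination G s * hGd s
  · change (G s * k (G s)) ^ 2 = _
    rw [hkf _ h1, mul_div_cancel₀ _ hpos.ne', Real.sq_sqrt (hP' _ hpos).le]

/-- Near the origin, a positive smooth function satisfies the bounds the energy method needs. -/
lemma exists_speedBounds {c : ℝ → ℝ} (hc : ContDiff ℝ ∞ c) {η₀ lam : ℝ} (hη₀ : 0 < η₀)
    (hpos : ∀ s, |s| ≤ η₀ → 0 < c s) (hlam : 0 < lam) :
    ∃ m N K ε η κ L, EnergyConstants lam m N K ε η κ L ∧ SpeedBounds c m N K η ∧ η ≤ η₀ := by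
  have hcpt := isCompact_Icc (a := -η₀) (b := η₀)
  obtain ⟨s₀, hs₀, hmin⟩ := hcpt.exists_isMinOn ⟨0, by simp [hη₀.le]⟩ hc.continuous.continuousOn
  obtain ⟨N, hN⟩ := hcpt.exists_bound_of_continuousOn hc.continuous.continuousOn
  obtain ⟨K₁, hK₁⟩ := hcpt.exists_bound_of_continuousOn hc.deriv_smooth.continuous.continuousOn
  obtain ⟨K₂, hK₂⟩ := hcpt.exists_bound_of_continuousOn
    hc.deriv_smooth.deriv_smooth.continuous.continuousOn
  obtain ⟨K, hK⟩ : ∃ K, max (max 1 (lam / (160 * η₀))) (max K₁ K₂) ≤ K := ⟨_, le_rfl⟩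
  simp only [max_le_iff] at hK
  obtain ⟨⟨k1, k2⟩, k3, k4⟩ := hK
  have hm : 0 < c s₀ := hpos _ (abs_le.2 hs₀)
  have hNpos : 0 < N := hm.trans_le ((le_abs_self _).trans (hN s₀ hs₀))
  obtain ⟨ε, η, κ, L, h⟩ := exists_energyConstants hlam hm hNpos k1
  have hη : η ≤ η₀ := by
    have h1 := h.η_κ
    have h2 := h.κ_lam
    rw [div_le_iff₀ (by positivity)] at k2
    have hK0 : 0 < K := by linarith
    by_contra! hlt
    have := mul_lt_mul_of_pos_left hlt hK0
    linarith
  refine ⟨_, _, _, ε, η, κ, L, h, fun s hs => ?_, hη⟩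
  have hs' : s ∈ Icc (-η₀) η₀ := abs_le.1 (hs.trans hη)
  exact ⟨hmin hs', (le_abs_self _).trans (hN s hs'), (hK₁ s hs').trans k3, (hK₂ s hs').trans k4⟩

lemma sqL2_nonneg (f : ℝ → ℝ) : 0 ≤ sqL2 f := integral_nonneg fun _ => sq_nonneg _

lemma SchwartzFamily.integrable_sq {f : ℝ → ℝ} (hf : SchwartzFamily univ (fun _ : ℕ => f)) :
    Integrable fun x => f x ^ 2 :=
  (hf.smooth_comp (H := fun y : ℝ => y ^ 2) (by fun_prop) (by simp)).integrable (mem_univ 0)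

/-- Composition with a smooth function fixing the origin is bounded for the `H²` norm on functions
which are bounded in `C¹`. -/
lemma exists_sqH2_comp_le {H : ℝ → ℝ} (hH : ContDiff ℝ ∞ H) (hH0 : H 0 = 0) :
    ∃ C : ℝ, 0 < C ∧ ∀ f : ℝ → ℝ, SchwartzFamily univ (fun _ : ℕ => f) → (∀ x, |f x| ≤ 1) →
      (∀ x, |deriv f x| ≤ 1) →
      sqH2 (fun x => H (f x)) ≤ C * sqH2 f ∧
      sqL2 (deriv fun x => H (f x)) ≤ C * sqL2 (deriv f) := by
  obtain ⟨M, hM0, hM, hMl⟩ := exists_norm_le_mul_norm_of_contDiff hH 1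
  obtain ⟨M', hM'0, hM', -⟩ := exists_norm_le_mul_norm_of_contDiff hH.deriv_smooth 1
  have b0 : ∀ y, |y| ≤ 1 → |H y| ≤ M * |y| := fun y hy => by
    simpa [hH0] using hMl y 0 hy (by simp)
  have b1 : ∀ y, |y| ≤ 1 → |deriv H y| ≤ M := fun y hy => by
    rw [← Real.norm_eq_abs, norm_deriv_eq_norm_fderiv]
    exact hM y hy
  have b2 : ∀ y, |y| ≤ 1 → |deriv (deriv H) y| ≤ M' := fun y hy => by
    rw [← Real.norm_eq_abs, norm_deriv_eq_norm_fderiv]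
    exact hM' y hy
  refine ⟨2 * (M ^ 2 + M' ^ 2) + 1, by positivity, fun f hf hf0 hf1 => ?_⟩
  have hs := hf.smooth 0 (mem_univ _)
  have d1 : deriv (fun x => H (f x)) = fun x => deriv H (f x) * deriv f x := funext fun x =>
    ((hH.hasDerivAt_smooth _).comp x (hs.hasDerivAt_smooth x)).deriv
  have d2 : deriv (deriv fun x => H (f x)) = fun x =>
      deriv (deriv H) (f x) * deriv f x * deriv f x + deriv H (f x) * deriv (deriv f) x := by
    rw [d1]
    exact funext fun x => (((hH.deriv_smooth.hasDerivAt_smooth _).comp x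
      (hs.hasDerivAt_smooth x)).mul (hs.deriv_smooth.hasDerivAt_smooth x)).deriv
  have hH' : SchwartzFamily univ (fun (_ : ℕ) x => H (f x)) := hf.smooth_comp hH hH0
  have i0 := hf.integrable_sq
  have i1 := hf.deriv.integrable_sq
  have i2 := hf.deriv.deriv.integrable_sq
  have e0 : sqL2 (fun x => H (f x)) ≤ M ^ 2 * sqL2 f := by
    rw [sqL2, sqL2, ← integral_const_mul]
    refine integral_mono hH'.integrable_sq (i0.const_mul _) fun x => ?_
    dsimp only
    rw [← mul_pow, ← sq_abs (H _), ← sq_abs (M * _), abs_mul, abs_of_nonneg hM0]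
    exact pow_le_pow_left₀ (abs_nonneg _) (b0 _ (hf0 x)) 2
  have e1 : sqL2 (deriv fun x => H (f x)) ≤ M ^ 2 * sqL2 (deriv f) := by
    rw [sqL2, sqL2, ← integral_const_mul]
    refine integral_mono hH'.deriv.integrable_sq (i1.const_mul _) fun x => ?_
    simp only [d1, mul_pow]
    refine mul_le_mul_of_nonneg_right ?_ (sq_nonneg _)
    rw [← sq_abs (deriv H _)]
    exact pow_le_pow_left₀ (abs_nonneg _) (b1 _ (hf0 x)) 2
  have e2 : sqL2 (deriv (deriv fun x => H (f x))) ≤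
      2 * M' ^ 2 * sqL2 (deriv f) + 2 * M ^ 2 * sqL2 (deriv (deriv f)) := by
    rw [sqL2, sqL2, sqL2, ← integral_const_mul, ← integral_const_mul,
      ← integral_add (i1.const_mul _) (i2.const_mul _)]
    refine integral_mono hH'.deriv.deriv.integrable_sq ((i1.const_mul _).add (i2.const_mul _))
      fun x => ?_
    simp only [d2]
    have q1 : deriv H (f x) ^ 2 ≤ M ^ 2 := by
      rw [← sq_abs]
      exact pow_le_pow_left₀ (abs_nonneg _) (b1 _ (hf0 x)) 2
    have q2 : (deriv (deriv H) (f x) * deriv f x) ^ 2 ≤ M' ^ 2 := by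
      rw [← sq_abs, abs_mul]
      refine pow_le_pow_left₀ (by positivity) ?_ 2
      simpa using mul_le_mul (b2 _ (hf0 x)) (hf1 x) (abs_nonneg _) hM'0
    have q3 := mul_le_mul_of_nonneg_right q1 (sq_nonneg (deriv (deriv f) x))
    have q4 := mul_le_mul_of_nonneg_right q2 (sq_nonneg (deriv f x))
    nlinarith [sq_nonneg (deriv (deriv H) (f x) * deriv f x * deriv f x -
      deriv H (f x) * deriv (deriv f) x)]
  have n0 := sqL2_nonneg f
  have n1 := sqL2_nonneg (deriv f)
  have n2 := sqL2_nonneg (deriv (deriv f))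
  have s1 := sq_nonneg M
  have s2 := sq_nonneg M'
  constructor
  · simp only [sqH2, sqH1]
    nlinarith [mul_nonneg s1 n0, mul_nonneg s2 n0, mul_nonneg s1 n1, mul_nonneg s2 n2]
  · nlinarith [mul_nonneg s1 n1, mul_nonneg s2 n1]

/-- A global solution in Riemann invariants yields a global solution of the damped Euler system. -/
lemma exists_isGlobalEulerSolution {P G c : ℝ → ℝ} {lam ρbar η T' : ℝ}
    (hP : ContDiffOn ℝ ∞ P (Ioi 0)) (hG : ContDiff ℝ ∞ G) (hc : ContDiff ℝ ∞ c)
    (hG0 : G 0 = ρbar) (hGc : ∀ s, |s| ≤ η →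
      0 < G s ∧ 0 < c s ∧ deriv G s * c s = G s ∧ c s ^ 2 = deriv P (G s))
    (hT' : 0 < T') {V : ℝ → ℝ → Fin 2 → ℝ}
    (hV : ∀ b, IsSolutionOn (riemannVelocity c lam) (Icc (-T') b) V)
    (hη : ∀ t, 0 ≤ t → ∀ x, |soundPart (V t x)| ≤ η) :
    ∃ ρ u : ℝ → ℝ → ℝ, IsGlobalEulerSolution P lam ρbar ρ u ∧
      (∀ t, 0 ≤ t → ρ t = fun x => G (soundPart (V t x))) ∧
      ∀ t, 0 ≤ t → u t = fun x => velocityPart (V t x) := by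
  obtain ⟨S, hS, hSV, hSd⟩ := exists_smooth_extension (contDiff_riemannVelocity hc) hT' hV
  have hVs : ∀ t, 0 ≤ t → ContDiff ℝ ∞ (V t) := fun t ht =>
    (hV t).regular.schwartz.smooth t ⟨by linarith, le_rfl⟩
  have hdx : ∀ t x, 0 ≤ t →
      HasDerivAt (fun y => G (soundPart (V t y)))
        (deriv G (soundPart (V t x)) * soundPart (deriv (V t) x)) x ∧
      HasDerivAt (fun y => velocityPart (V t y)) (velocityPart (deriv (V t) x)) x := by
    intro t x ht
    have h := (hVs t ht).hasDerivAt_smooth x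
    exact ⟨(hG.hasDerivAt_smooth _).comp x (soundPart.hasFDerivAt.comp_hasDerivAt x h),
      velocityPart.hasFDerivAt.comp_hasDerivAt x h⟩
  have hdt : ∀ t x, 0 ≤ t →
      HasDerivAt (fun s => G (soundPart (S s x)))
        (deriv G (soundPart (V t x)) *
          -(velocityPart (V t x) * soundPart (deriv (V t) x) +
            c (soundPart (V t x)) * velocityPart (deriv (V t) x))) t ∧
      HasDerivAt (fun s => velocityPart (S s x))
        (-(velocityPart (V t x) * velocityPart (deriv (V t) x) +
          c (soundPart (V t x)) * soundPart (deriv (V t) x)) - lam * velocityPart (V t x)) t := by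
    intro t x ht
    obtain ⟨p1, p2⟩ := riemannVelocity_parts (c := c) (lam := lam) (V t x) (deriv (V t) x)
    have h := hSd t x ht
    rw [← p1, ← p2]
    have hG' := hG.hasDerivAt_smooth (soundPart (S t x))
    have h1 := hG'.comp t (soundPart.hasFDerivAt.comp_hasDerivAt t h)
    rw [hSV t ht] at h1
    exact ⟨h1, velocityPart.hasFDerivAt.comp_hasDerivAt t h⟩
  refine ⟨fun t x => G (soundPart (S t x)), fun t x => velocityPart (S t x), ?_,
    fun t ht => by simp only [hSV t ht], fun t ht => by simp only [hSV t ht]⟩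
  constructor
  · intro t x ht
    simp only [hSV t ht]
    exact (hGc _ (hη t ht x)).1
  · exact hG.comp (soundPart.contDiff.comp hS)
  · exact velocityPart.contDiff.comp hS
  · intro k m b
    have hVb : SchwartzFamily (Icc 0 b) V :=
      (hV b).regular.schwartz.mono (Icc_subset_Icc_left (by linarith))
    have h1 : SchwartzFamily (Icc 0 b) (fun t x => G (soundPart (V t x)) - ρbar) :=
      hVb.smooth_comp (H := fun v => G (soundPart v) - ρbar)
        ((hG.comp soundPart.contDiff).sub contDiff_const) (by simp [hG0])
    have h2 : SchwartzFamily (Icc 0 b) (fun t x => velocityPart (V t x)) :=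
      hVb.smooth_comp velocityPart.contDiff (map_zero _)
    obtain ⟨C₁, hC₁⟩ := h1.decay k m
    obtain ⟨C₂, hC₂⟩ := h2.decay k m
    refine ⟨C₁ + C₂, fun t ht htb x => ?_⟩
    simp only [hSV t ht]
    have hk : |x| ^ k ≤ (1 + |x|) ^ k := by gcongr; linarith
    refine (mul_le_mul_of_nonneg_right hk (by positivity)).trans ?_
    rw [mul_add]
    exact add_le_add (hC₁ t ⟨ht, htb⟩ x) (hC₂ t ⟨ht, htb⟩ x)
  · intro t x ht
    simp only [hSV t ht]
    obtain ⟨-, -, g, -⟩ := hGc _ (hη t ht x)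
    obtain ⟨x1, x2⟩ := hdx t x ht
    rw [(hdt t x ht).1.deriv, (x1.fun_mul x2).deriv]
    linear_combination -velocityPart (deriv (V t) x) * g
  · intro t x ht
    obtain ⟨hpos, -, g, g2⟩ := hGc _ (hη t ht x)
    obtain ⟨x1, x2⟩ := hdx t x ht
    obtain ⟨t1, t2⟩ := hdt t x ht
    have hPd : HasDerivAt P (deriv P (G (soundPart (V t x)))) (G (soundPart (V t x))) :=
      ((hP.contDiffAt (Ioi_mem_nhds hpos)).differentiableAt (by simp)).hasDerivAt
    have x3 : HasDerivAt (fun y => P (G (soundPart (V t y)))) _ x := hPd.comp x x1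
    rw [(t1.fun_mul t2).deriv]
    simp only [hSV t ht]
    rw [(x1.fun_mul (x2.fun_pow 2)).deriv, x3.deriv, ← g2]
    simp only [Nat.cast_ofNat, Nat.add_one_sub_one, pow_one]
    linear_combination (-velocityPart (V t x) * velocityPart (deriv (V t) x) +
      c (soundPart (V t x)) * soundPart (deriv (V t) x)) * g

lemma schwartzFamily_of_decay {f : ℝ → ℝ} (hf : ContDiff ℝ ∞ f)
    (h : ∀ k m : ℕ, ∃ C : ℝ, ∀ x : ℝ, |x| ^ k * |iteratedDeriv m f x| ≤ C) :
    SchwartzFamily univ (fun _ : ℕ => f) where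
  smooth _ _ := hf
  decay k m := by
    obtain ⟨C₀, hC₀⟩ := h 0 m
    obtain ⟨C, hC⟩ := h k m
    refine ⟨2 ^ (k - 1) * (C₀ + C), fun _ _ x => ?_⟩
    have h1 := add_pow_le zero_le_one (abs_nonneg x) k
    have h2 := hC₀ x
    have h3 := hC x
    rw [one_pow] at h1
    rw [pow_zero] at h2
    calc (1 + |x|) ^ k * ‖iteratedDeriv m f x‖
        ≤ 2 ^ (k - 1) * (1 + |x| ^ k) * |iteratedDeriv m f x| :=
          mul_le_mul_of_nonneg_right h1 (abs_nonneg _)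
      _ = 2 ^ (k - 1) * (1 * |iteratedDeriv m f x| + |x| ^ k * |iteratedDeriv m f x|) := by ring
      _ ≤ 2 ^ (k - 1) * (C₀ + C) := by gcongr

lemma sqrt_add_sqrt_le {a b s D t : ℝ} (ha : 0 ≤ a) (hb : 0 ≤ b) (ht : 0 ≤ t)
    (h : (1 + t) * (a + b) ≤ s * D) (hs : 0 ≤ s) :
    √a + √b ≤ 2 * √s * (1 + t) ^ (-(1 / 2) : ℝ) * √D := by
  have ht1 : 0 < 1 + t := by linarith
  have e : (1 + t) ^ (-(1 / 2) : ℝ) = (√(1 + t))⁻¹ := by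
    rw [Real.rpow_neg ht1.le, Real.sqrt_eq_rpow]
  have hr := Real.sqrt_pos.2 ht1
  have key : √(a + b) * √(1 + t) ≤ √s * √D := by
    rw [← Real.sqrt_mul (by positivity), ← Real.sqrt_mul hs, mul_comm]
    exact Real.sqrt_le_sqrt h
  have h1 : √a ≤ √(a + b) := Real.sqrt_le_sqrt (by linarith)
  have h2 : √b ≤ √(a + b) := Real.sqrt_le_sqrt (by linarith)
  rw [← le_div_iff₀ hr] at key
  calc √a + √b ≤ 2 * (√s * √D / √(1 + t)) := by linarith
    _ = _ := by rw [e]; ring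

end

/-- **Theorem 4.** Global existence and decay for the damped
compressible Euler system: there are `δ₀ > 0` and `C > 0` such that every smooth
initial datum `(ρ₀,u₀)` with `(ρ₀−ρ̄,u₀)` Schwartz and `‖(ρ₀−ρ̄,u₀)‖_{H²} ≤ δ₀` gives
rise to a global classical solution satisfying the uniform `H²` bound and the decay
`‖u(t)‖_{L²} + ‖∂ₓ(ρ−ρ̄,u)(t)‖_{L²} ≤ C(1+t)^{−1/2}‖(ρ₀−ρ̄,u₀)‖_{H²}`. -/
theorem euler_global_existence_and_decay
    (P : ℝ → ℝ) (hP : ContDiffOn ℝ (⊤ : ℕ∞) P (Set.Ioi 0))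
    (hP' : ∀ s : ℝ, 0 < s → 0 < deriv P s)
    (lam : ℝ) (hlam : 0 < lam) (ρbar : ℝ) (hρbar : 0 < ρbar) :
    ∃ δ₀ : ℝ, 0 < δ₀ ∧ ∃ C : ℝ, 0 < C ∧
      ∀ ρ₀ u₀ : ℝ → ℝ,
        ContDiff ℝ (⊤ : ℕ∞) ρ₀ → ContDiff ℝ (⊤ : ℕ∞) u₀ →
        (∀ k m : ℕ, ∃ Cd : ℝ, ∀ x : ℝ,
          |x| ^ k * (|iteratedDeriv m (fun y => ρ₀ y - ρbar) x| +
            |iteratedDeriv m u₀ x|) ≤ Cd) →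
        Real.sqrt (sqH2pair (fun x => ρ₀ x - ρbar) u₀) ≤ δ₀ →
        ∃ ρ u : ℝ → ℝ → ℝ,
          IsGlobalEulerSolution P lam ρbar ρ u ∧ ρ 0 = ρ₀ ∧ u 0 = u₀ ∧
          (∀ t : ℝ, 0 ≤ t →
            sqH2pair (fun x => ρ t x - ρbar) (u t) ≤
              C * sqH2pair (fun x => ρ₀ x - ρbar) u₀) ∧
          (∀ t : ℝ, 0 < t →
            Real.sqrt (sqL2 (u t)) +
                Real.sqrt (sqL2 (deriv fun x => ρ t x - ρbar) + sqL2 (deriv (u t))) ≤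
              C * (1 + t) ^ (-(1 / 2) : ℝ) *
                Real.sqrt (sqH2pair (fun x => ρ₀ x - ρbar) u₀)) := by
  obtain ⟨G, Φ, c, η₀, hG, hΦ, hc, hη₀, hG0, hΦ0, hGΦ, hGc⟩ :=
    exists_symmetrizing_variable hP hP' hρbar
  obtain ⟨m, N, K, ε, η, κ, L, hk, hb, hη⟩ :=
    exists_speedBounds hc hη₀ (fun s hs => (hGc s hs).2.1) hlam
  obtain ⟨δ, B, T', hδ, hB, hT', main⟩ := exists_global_riemann hc hk hb
  obtain ⟨C₁, hC₁, cmp₁⟩ := exists_sqH2_comp_le (H := fun y => Φ (ρbar + y))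
    (hΦ.comp (contDiff_const.add contDiff_id)) (by simpa using hΦ0)
  obtain ⟨C₂, hC₂, cmp₂⟩ := exists_sqH2_comp_le (H := fun y => G y - ρbar)
    (hG.sub contDiff_const) (by simp [hG0])
  set A := (C₂ + 1) * (B * (C₁ + 1)) with hA
  have hApos : 0 < A := by positivity
  obtain ⟨δ₀, hδ₀, hδ₀'⟩ : ∃ δ₀, 0 < δ₀ ∧
      δ₀ ≤ min 1 (min (δ / (C₁ + 1)) (1 / (B * (C₁ + 1)))) := ⟨_, by positivity, le_rfl⟩
  simp only [le_min_iff] at hδ₀'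
  obtain ⟨d1, d2, d3⟩ := hδ₀'
  rw [le_div_iff₀ (by positivity)] at d2 d3
  refine ⟨δ₀, hδ₀, A + 2 * √A, by positivity, fun ρ₀ u₀ hρ₀ hu₀ hdecay hsmall => ?_⟩
  set D := sqH2pair (fun x => ρ₀ x - ρbar) u₀ with hD
  have hH2 : ∀ f, 0 ≤ sqH2 f := fun f =>
    add_nonneg (add_nonneg (sqL2_nonneg _) (sqL2_nonneg _)) (sqL2_nonneg _)
  have hD0 : 0 ≤ D := add_nonneg (hH2 _) (hH2 _)
  have hDδ : D ≤ δ₀ := by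
    have h1 := Real.sqrt_le_left hδ₀.le |>.1 hsmall
    nlinarith
  -- the data in Riemann invariants
  have hn : SchwartzFamily Set.univ (fun (_ : ℕ) x => ρ₀ x - ρbar) :=
    schwartzFamily_of_decay (hρ₀.sub contDiff_const) fun k m => (hdecay k m).imp fun C hC x =>
      (mul_le_mul_of_nonneg_left (le_add_of_nonneg_right (abs_nonneg _)) (by positivity)).trans
        (hC x)
  have hu : SchwartzFamily Set.univ (fun _ : ℕ => u₀) :=
    schwartzFamily_of_decay hu₀ fun k m => (hdecay k m).imp fun C hC x =>
      (mul_le_mul_of_nonneg_left (le_add_of_nonneg_left (abs_nonneg _)) (by positivity)).trans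
        (hC x)
  have hsob := fun x => hn.sq_le_sqH2pair hu (Set.mem_univ 0) x
  have hn0 : ∀ x, |ρ₀ x - ρbar| ≤ 1 := fun x =>
    abs_le_of_sq_le_sq (by linarith [(hsob x).1]) zero_le_one
  have hn1 : ∀ x, |deriv (fun x => ρ₀ x - ρbar) x| ≤ 1 := fun x =>
    abs_le_of_sq_le_sq (by linarith [(hsob x).2.2.1]) zero_le_one
  have hσ := (cmp₁ _ hn hn0 hn1).1
  simp only [add_sub_cancel] at hσ
  set V₀ : ℝ → Fin 2 → ℝ := fun x => ![u₀ x + Φ (ρ₀ x), u₀ x - Φ (ρ₀ x)] with hV₀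
  have hV₀s : (fun x => soundPart (V₀ x)) = fun x => Φ (ρ₀ x) := by
    funext x
    simp [hV₀, soundPart_apply]
    ring
  have hV₀u : (fun x => velocityPart (V₀ x)) = u₀ := by
    funext x
    simp [hV₀, velocityPart_apply]
    ring
  have hV₀d : sqH2pair (fun x => soundPart (V₀ x)) (fun x => velocityPart (V₀ x)) ≤
      (C₁ + 1) * D := by
    rw [hV₀s, hV₀u, hD, sqH2pair, sqH2pair]
    nlinarith [hH2 u₀, hH2 fun x => ρ₀ x - ρbar]
  have hV₀S : SchwartzFamily Set.univ (fun _ : ℕ => V₀) := by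
    have h := (hn.prodMk hu).smooth_comp
      (H := fun p : ℝ × ℝ => ![p.2 + Φ (ρbar + p.1), p.2 - Φ (ρbar + p.1)])
      (contDiff_pi.2 (Fin.forall_fin_two.2 ⟨by simp; fun_prop, by simp; fun_prop⟩))
      (by simp [hΦ0])
    simpa only [add_sub_cancel] using h
  obtain ⟨V, V0, hV, hVb⟩ := main V₀ hV₀S (by nlinarith)
  obtain ⟨ρ, u, hsol, hρt, hut⟩ := exists_isGlobalEulerSolution hP hG hc hG0 hGc hT' hV
    (fun t ht x => ((hVb t ht).1 x).trans hη)
  have hbound : ∀ t, 0 ≤ t →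
      sqH2 (fun x => ρ t x - ρbar) ≤ C₂ * sqH2 (fun x => soundPart (V t x)) ∧
      sqL2 (deriv fun x => ρ t x - ρbar) ≤ C₂ * sqL2 (deriv fun x => soundPart (V t x)) := by
    intro t ht
    have hVt : SchwartzFamily Set.univ (fun _ : ℕ => V t) :=
      (hV t).regular.schwartz.comp_index (g := fun _ => t) fun _ _ => ⟨by linarith, le_rfl⟩
    have hs : SchwartzFamily Set.univ (fun (_ : ℕ) x => soundPart (V t x)) :=
      hVt.smooth_comp soundPart.contDiff (map_zero _)
    have hv : SchwartzFamily Set.univ (fun (_ : ℕ) x => velocityPart (V t x)) :=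
      hVt.smooth_comp velocityPart.contDiff (map_zero _)
    have h1 : sqH2pair (fun x => soundPart (V t x)) (fun x => velocityPart (V t x)) ≤ 1 := by
      have h2 := (hVb t ht).2.1
      have h3 := mul_le_mul_of_nonneg_left hV₀d hB.le
      have h4 := mul_le_mul_of_nonneg_left hDδ (show 0 ≤ B * (C₁ + 1) by positivity)
      linarith
    simp only [hρt t ht]
    exact cmp₂ _ hs (fun x => ((hVb t ht).1 x).trans hk.η_le) fun x =>
      abs_le_of_sq_le_sq (by linarith [(hs.sq_le_sqH2pair hv (Set.mem_univ 0) x).2.2.1]) zero_le_one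
  have hBD : ∀ {y}, y ≤ B * sqH2pair (fun x => soundPart (V₀ x)) (fun x => velocityPart (V₀ x)) →
      (C₂ + 1) * y ≤ A * D := fun hy => by
    have h3 := mul_le_mul_of_nonneg_left hV₀d hB.le
    have h4 := mul_le_mul_of_nonneg_left (hy.trans h3) (show 0 ≤ C₂ + 1 by positivity)
    rw [hA]
    linarith
  refine ⟨ρ, u, hsol, ?_, ?_, fun t ht => ?_, fun t ht => ?_⟩
  · rw [hρt 0 le_rfl, V0]
    funext x
    rw [congrFun hV₀s x, hGΦ]
  · rw [hut 0 le_rfl, V0, hV₀u]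
  · have h1 := hBD (hVb t ht).2.1
    have h2 := (hbound t ht).1
    have h3 := mul_nonneg (Real.sqrt_nonneg A) hD0
    rw [sqH2pair] at h1 ⊢
    rw [hut t ht]
    nlinarith [hH2 fun x => soundPart (V t x), hH2 fun x => velocityPart (V t x)]
  · have h1 := hBD (hVb t ht.le).2.2
    have h2 := (hbound t ht.le).2
    have ht1 : 0 < 1 + t := by linarith
    refine (sqrt_add_sqrt_le (s := A) (D := D) (sqL2_nonneg _)
      (add_nonneg (sqL2_nonneg _) (sqL2_nonneg _)) ht.le ?_ hApos.le).trans ?_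
    · rw [hut t ht.le]
      refine le_trans ?_ h1
      rw [mul_left_comm]
      refine mul_le_mul_of_nonneg_left ?_ ht1.le
      nlinarith [sqL2_nonneg (deriv fun x => soundPart (V t x)),
        sqL2_nonneg (deriv fun x => velocityPart (V t x)),
        sqL2_nonneg fun x => velocityPart (V t x)]
    · have h3 := Real.rpow_nonneg ht1.le (-(1 / 2) : ℝ)
      gcongr
      linarith
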